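/- arXiv:1412.8621 — 3 statements merged into one kernel-verified Lean document; each statement's English description precedes it below -/
import Mathlib

section
/- (Colorful Lebesgue theorem) Let P ⊆ ℝ^n be a full-dimensional simple convex polytope admitting a proper coloring h of its facets by n colors. Suppose P is covered by a finite family of closed sets X_1, …, X_N with covering multiplicity at most n (each point of P belongs to at most n of the sets). Then for some i, a connected component of X_i intersects at least two distinct facets of P of the same color. -/
open Set

noncomputable section

/-- A full-dimensional convex polytope in `ℝ^d`: the convex hull of a finite
set of points, with nonempty interior. -/
def IsPolytope {d : ℕ} (P : Set (EuclideanSpace ℝ (Fin d))) : Prop :=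
  (∃ S : Finset (EuclideanSpace ℝ (Fin d)),
    P = convexHull ℝ (S : Set (EuclideanSpace ℝ (Fin d)))) ∧ (interior P).Nonempty

/-- A face of `P` is an exposed face: the set of points of `P` at which some
linear functional attains its maximum over `P`. -/
def IsFaceOf {d : ℕ} (P F : Set (EuclideanSpace ℝ (Fin d))) : Prop :=
  ∃ l : EuclideanSpace ℝ (Fin d) →L[ℝ] ℝ, F = {x ∈ P | ∀ y ∈ P, l y ≤ l x}

/-- The dimension of a subset of `ℝ^d`: the dimension of its affine span. -/
noncomputable def faceDim {d : ℕ} (F : Set (EuclideanSpace ℝ (Fin d))) : ℕ :=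
  Module.finrank ℝ (affineSpan ℝ F).direction

/-- A facet is a face of dimension `d - 1`. -/
def IsFacetOf {d : ℕ} (P F : Set (EuclideanSpace ℝ (Fin d))) : Prop :=
  IsFaceOf P F ∧ faceDim F = d - 1

/-- A vertex is a (zero-dimensional) face consisting of a single point. -/
def IsVertexOf {d : ℕ} (P : Set (EuclideanSpace ℝ (Fin d)))
    (v : EuclideanSpace ℝ (Fin d)) : Prop :=
  IsFaceOf P {v}

/-- A polytope is simple if every vertex is contained in exactly `d` facets. -/
def IsSimplePolytope {d : ℕ} (P : Set (EuclideanSpace ℝ (Fin d))) : Prop :=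
  IsPolytope P ∧ ∀ v, IsVertexOf P v → {F | IsFacetOf P F ∧ v ∈ F}.ncard = d

/-- A proper coloring of the facets of `P` by `k` colors: distinct facets with
nonempty intersection receive different colors. -/
def IsProperColoring {d k : ℕ} (P : Set (EuclideanSpace ℝ (Fin d)))
    (h : Set (EuclideanSpace ℝ (Fin d)) → Fin k) : Prop :=
  ∀ F₁ F₂, IsFacetOf P F₁ → IsFacetOf P F₂ → F₁ ≠ F₂ → (F₁ ∩ F₂).Nonempty →
    h F₁ ≠ h F₂


namespace CL

def vtx {n : ℕ} (a : Fin n → ℕ) (π : Equiv.Perm (Fin n)) (i : ℕ) : Fin n → ℕ :=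
  fun c => a c + if ((π c : Fin n) : ℕ) < i then 1 else 0

/-- door indicator -/
def door (n : ℕ) (g : ℕ → ℕ) (i : ℕ) : ZMod 2 :=
  if ((Finset.range (n+1)).erase i).image g = Finset.range n then 1 else 0

def rbow (n : ℕ) (g : ℕ → ℕ) : ZMod 2 :=
  if (Finset.range (n+1)).image g = Finset.range (n+1) then 1 else 0

lemma rbow_eq (n : ℕ) (g : ℕ → ℕ) (hg : ∀ i ≤ n, g i ≤ n) :
    rbow n g = ∑ i ∈ Finset.range (n+1), door n g i := by
  classical
  by_cases hex : ∃ i ∈ Finset.range (n+1), ((Finset.range (n+1)).erase i).image g = Finset.range n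
  · obtain ⟨i, hi, hd⟩ := hex
    have hinj : Set.InjOn g ((Finset.range (n+1)).erase i : Finset ℕ) := by
      apply Finset.injOn_of_card_image_eq
      rw [hd, Finset.card_erase_of_mem hi]; simp
    have himg : (Finset.range (n+1)).image g = insert (g i) (Finset.range n) := by
      rw [← hd, ← Finset.image_insert, Finset.insert_erase hi]
    have hdi : door n g i = 1 := by simp [door, hd]
    have hin : i ≤ n := by simpa [Nat.lt_succ_iff] using hi
    by_cases hgi : g i = n
    · have : rbow n g = 1 := by
        unfold rbow
        rw [if_pos]
        rw [himg, hgi, Finset.range_add_one]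
      rw [this, Finset.sum_eq_single i, hdi]
      · intro j hj hji
        unfold door
        rw [if_neg]
        intro h
        have : g i ∈ Finset.range n := by
          rw [← h]; exact Finset.mem_image_of_mem _ (Finset.mem_erase.2 ⟨hji.symm, hi⟩)
        simp [hgi] at this
      · exact fun h => absurd hi h
    · have hlt : g i < n := lt_of_le_of_ne (hg i hin) hgi
      have : rbow n g = 0 := by
        unfold rbow
        rw [if_neg]
        rw [himg, Finset.insert_eq_of_mem (by simpa using hlt)]
        intro h
        have := congrArg Finset.card h
        simp at this
      rw [this]
      have : g i ∈ ((Finset.range (n+1)).erase i).image g := by rw [hd]; simpa using hlt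
      obtain ⟨j, hj, hji⟩ := Finset.mem_image.1 this
      have hji' : j ≠ i := (Finset.mem_erase.1 hj).1
      have hjr : j ∈ Finset.range (n+1) := (Finset.mem_erase.1 hj).2
      rw [← Finset.add_sum_erase _ _ hi, ← Finset.add_sum_erase _ _ hj, Finset.sum_eq_zero, hdi]
      · have : door n g j = 1 := by
          unfold door
          rw [if_pos]
          rw [← hd]
          ext y
          simp only [Finset.mem_image, Finset.mem_erase]
          constructor
          · rintro ⟨k, ⟨hk, hkr⟩, rfl⟩
            by_cases hki : k = i
            · exact ⟨j, ⟨hji', hjr⟩, by rw [hji, hki]⟩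
            · exact ⟨k, ⟨hki, hkr⟩, rfl⟩
          · rintro ⟨k, ⟨hk, hkr⟩, rfl⟩
            by_cases hkj : k = j
            · exact ⟨i, ⟨hji'.symm, hi⟩, by rw [← hji, hkj]⟩
            · exact ⟨k, ⟨hkj, hkr⟩, rfl⟩
        rw [this]; decide
      · intro k hk
        simp only [Finset.mem_erase] at hk
        unfold door
        rw [if_neg]
        intro h
        have hc : Set.InjOn g ((Finset.range (n+1)).erase k : Finset ℕ) := by
          apply Finset.injOn_of_card_image_eq
          rw [h, Finset.card_erase_of_mem hk.2.2]; simp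
        apply hji'
        apply hc _ _ hji
        · simp only [Finset.coe_erase, Set.mem_sdiff, Finset.mem_coe, Set.mem_singleton_iff]
          exact ⟨hjr, fun h => hk.1 h.symm⟩
        · simp only [Finset.coe_erase, Set.mem_sdiff, Finset.mem_coe, Set.mem_singleton_iff]
          exact ⟨hi, fun h => hk.2.1 h.symm⟩
  · push Not at hex
    rw [Finset.sum_eq_zero]
    · unfold rbow
      rw [if_neg]
      intro h
      have hinj : Set.InjOn g (Finset.range (n+1) : Finset ℕ) := by
        apply Finset.injOn_of_card_image_eq; rw [h]
      have : n ∈ (Finset.range (n+1)).image g := by rw [h]; simp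
      obtain ⟨i, hi, hgi⟩ := Finset.mem_image.1 this
      apply hex i hi
      rw [Finset.erase_eq, Finset.image_sdiff_of_injOn hinj (by simpa using hi), h]
      ext y; simp [hgi]; omega
    · intro i hi; simp [door, hex i hi]

/-- middle terms cancel -/
lemma mid_zero (n : ℕ) (lam : (Fin n → ℕ) → ℕ) (a : Fin n → ℕ) (i : ℕ) (h0 : 0 < i) (hi : i < n) :
    ∑ π : Equiv.Perm (Fin n), door n (fun j => lam (vtx a π j)) i = 0 := by
  classical
  let s : Equiv.Perm (Fin n) := Equiv.swap ⟨i-1, by omega⟩ ⟨i, hi⟩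
  have key : ∀ π : Equiv.Perm (Fin n), door n (fun j => lam (vtx a (s * π) j)) i
      = door n (fun j => lam (vtx a π j)) i := by
    intro π
    unfold door
    have : ((Finset.range (n+1)).erase i).image (fun j => lam (vtx a (s * π) j))
       = ((Finset.range (n+1)).erase i).image (fun j => lam (vtx a π j)) := by
      apply Finset.image_congr
      intro j hj
      simp only [Finset.coe_erase, Set.mem_sdiff, Set.mem_singleton_iff] at hj
      dsimp only
      congr 1
      funext c
      unfold vtx
      congr 1
      have : (((s * π) c : Fin n) : ℕ) < j ↔ ((π c : Fin n) : ℕ) < j := by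
        simp only [Equiv.Perm.mul_apply, s, Equiv.swap_apply_def, Fin.ext_iff]
        split_ifs <;> simp <;> omega
      simp only [this]
    rw [this]
  refine Finset.sum_involution (fun π _ => s * π) ?_ ?_ ?_ ?_
  · intro π _
    rw [key]; exact CharTwo.add_self_eq_zero _
  · intro π _ _ h
    have : s = 1 := by simpa using h
    have := congrArg (fun f => f ⟨i, hi⟩) this
    simp [s] at this
    omega
  · simp
  · intro π _; simp [s]

def gsum (n m : ℕ) (lam : (Fin n → ℕ) → ℕ) : ZMod 2 :=
  ∑ a : Fin n → Fin m, ∑ π : Equiv.Perm (Fin n),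
    rbow n (fun j => lam (vtx (fun c => (a c : ℕ)) π j))

def dd (N : ℕ) (lam : (Fin (N+1) → ℕ) → ℕ) (a : Fin (N+1) → ℕ) (π : Equiv.Perm (Fin (N+1))) :
    ZMod 2 := rbow N (fun j => lam (vtx a π j))

lemma door_last (N : ℕ) (lam : (Fin (N+1) → ℕ) → ℕ) (a : Fin (N+1) → ℕ)
    (π : Equiv.Perm (Fin (N+1))) :
    door (N+1) (fun j => lam (vtx a π j)) (N+1) = dd N lam a π := by
  unfold door dd rbow
  have : (Finset.range (N+1+1)).erase (N+1) = Finset.range (N+1) := by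
    ext; simp; omega
  rw [this]

lemma door_zero (N : ℕ) (lam : (Fin (N+1) → ℕ) → ℕ) (a : Fin (N+1) → ℕ)
    (π : Equiv.Perm (Fin (N+1))) (c : Fin (N+1)) (hc : π c = Fin.last N) :
    door (N+1) (fun j => lam (vtx a (finRotate (N+1) * π) j)) 0 
      = dd N lam (Function.update a c (a c + 1)) π := by
  classical
  unfold door dd rbow
  have : (Finset.range (N+1+1)).erase 0 = (Finset.range (N+1)).image (· + 1) := by
    ext j; simp; cases j <;> simp
  rw [this, Finset.image_image]
  have : ∀ j ∈ (Finset.range (N+1) : Finset ℕ), 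
      ((fun j => lam (vtx a (finRotate (N+1) * π) j)) ∘ (· + 1)) j
        = lam (vtx (Function.update a c (a c + 1)) π j) := by
    intro j hj
    simp only [Function.comp]
    congr 1
    funext d
    unfold vtx
    have hj' : j < N + 1 := by simpa using hj
    by_cases hd : d = c
    · subst hd
      simp [hc]
      omega
    · rw [Function.update_of_ne hd]
      have hne : π d ≠ Fin.last N := by
        rw [← hc]; exact fun h => hd (π.injective h)
      congr 1
      rw [Equiv.Perm.mul_apply, coe_finRotate_of_ne_last hne]
      simp
  rw [Finset.image_congr this]

lemma tele (m : ℕ) (g : ℕ → ZMod 2) :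
    ∑ t : Fin m, (g (t : ℕ) + g ((t : ℕ) + 1)) = g 0 + g m := by
  rw [Fin.sum_univ_eq_sum_range (fun t => g t + g (t+1))]
  induction m with
  | zero => simp [CharTwo.add_self_eq_zero]
  | succ m ih => 
    rw [Finset.sum_range_succ, ih]
    linear_combination CharTwo.add_self_eq_zero (g m)

lemma rbow_zero (n : ℕ) (g : ℕ → ℕ) (k : ℕ) (hk : k ≤ n) (h : ∀ j ≤ n, g j ≠ k) : rbow n g = 0 := by
  unfold rbow
  rw [if_neg]
  intro he
  have : k ∈ (Finset.range (n+1)).image g := by rw [he]; simp; omega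
  obtain ⟨j, hj, hjk⟩ := Finset.mem_image.1 this
  exact h j (by simp at hj; omega) hjk

theorem sperner (m : ℕ) : ∀ (n : ℕ) (lam : (Fin n → ℕ) → ℕ)
    (_ : ∀ x, lam x ≤ n) (_ : ∀ x (c : Fin n), x c = 0 → lam x ≠ (c : ℕ) + 1)
    (_ : ∀ x c, x c = m → lam x ≠ 0), gsum n m lam = 1 := by
  intro n
  induction n with
  | zero =>
    intro lam hle _ _
    have h0 : ∀ x, lam x = 0 := fun x => by simpa using hle x
    simp [gsum, rbow, h0]
  | succ N ih =>
    intro lam hle hlo hhi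
    classical
    have step1 : gsum (N+1) m lam = ∑ π : Equiv.Perm (Fin (N+1)), ∑ a : Fin (N+1) → Fin m,
        (dd N lam (fun c => (a c : ℕ)) π + 
          dd N lam (Function.update (fun c => (a c : ℕ)) (π.symm (Fin.last N))
            ((a (π.symm (Fin.last N)) : ℕ) + 1)) π) := by
      rw [Finset.sum_comm]
      unfold gsum
      apply Finset.sum_congr rfl
      intro a _
      simp_rw [rbow_eq (N+1) _ (fun i _ => hle _)]
      rw [Finset.sum_comm, Finset.sum_range_succ, Finset.sum_range_succ', Finset.sum_eq_zero,
        zero_add, Finset.sum_add_distrib, add_comm]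
      · congr 1
        · exact Finset.sum_congr rfl fun π _ => door_last N lam _ π
        · rw [← Equiv.sum_comp (Equiv.mulLeft (finRotate (N+1)))]
          exact Finset.sum_congr rfl fun π _ => door_zero N lam _ π _ (by simp)
      · intro i hi
        exact mid_zero _ _ _ _ (by omega) (by simp at hi; omega)
    have step2 : ∀ π : Equiv.Perm (Fin (N+1)), ∑ a : Fin (N+1) → Fin m,
        (dd N lam (fun c => (a c : ℕ)) π + 
          dd N lam (Function.update (fun c => (a c : ℕ)) (π.symm (Fin.last N))
            ((a (π.symm (Fin.last N)) : ℕ) + 1)) π)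
        = if π (Fin.last N) = Fin.last N then ∑ b : Fin N → Fin m, 
            dd N lam (Fin.snoc (α := fun _ => ℕ) (fun c => (b c : ℕ)) 0) π else 0 := by
      intro π
      obtain ⟨c, hc⟩ : ∃ c, c = π.symm (Fin.last N) := ⟨_, rfl⟩
      rw [← hc]
      have hπc : π c = Fin.last N := by simp [hc]
      rw [← (Fin.insertNthEquiv (fun _ => Fin m) c).sum_comp, Fintype.sum_prod_type_right]
      have e1 : ∀ (b : Fin N → Fin m) (t : Fin m), 
          (fun d => ((Fin.insertNthEquiv (fun _ => Fin m) c (t, b) d : Fin m) : ℕ)) 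
            = Fin.insertNth (α := fun _ => ℕ) c (t : ℕ) (fun d => (b d : ℕ)) := by
        intro b t
        funext d
        refine Fin.succAboveCases c ?_ ?_ d <;> simp
      have e2 : ∀ b : Fin N → Fin m, ∑ t : Fin m, 
         (dd N lam (fun d => ((Fin.insertNthEquiv (fun _ => Fin m) c (t, b) d : Fin m) : ℕ)) π + 
          dd N lam (Function.update (fun d => ((Fin.insertNthEquiv (fun _ => Fin m) c (t, b) d : Fin m) : ℕ)) c
            (((Fin.insertNthEquiv (fun _ => Fin m) c (t, b) c : Fin m) : ℕ) + 1)) π)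
          = dd N lam (Fin.insertNth (α := fun _ => ℕ) c 0 (fun d => (b d : ℕ))) π := by
        intro b
        have := tele m (fun t => dd N lam (Fin.insertNth (α := fun _ => ℕ) c t (fun d => (b d : ℕ))) π)
        have hm : dd N lam (Fin.insertNth (α := fun _ => ℕ) c m (fun d => (b d : ℕ))) π = 0 := by
          apply rbow_zero N _ 0 (by omega)
          intro j hj
          apply hhi _ c
          simp [vtx, hπc]; omega
        rw [hm, add_zero] at this
        rw [← this]
        apply Finset.sum_congr rfl
        intro t _
        rw [e1]
        simp
      rw [Finset.sum_congr rfl fun b _ => e2 b]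
      split_ifs with hl
      · have : c = Fin.last N := by rw [hc, Equiv.symm_apply_eq, hl]
        subst this
        apply Finset.sum_congr rfl
        intro b _
        rw [Fin.insertNth_last']
      · apply Finset.sum_eq_zero
        intro b _
        have hcl : c ≠ Fin.last N := fun h => hl (by rw [← h, hπc, h])
        have hcN : (c : ℕ) < N := Fin.val_lt_last hcl
        apply rbow_zero N _ ((c : ℕ) + 1) (by omega)
        intro j hj
        apply hlo
        simp [vtx, hπc]; omega
    rw [step1, Finset.sum_congr rfl fun π _ => step2 π]
    let E : Equiv.Perm (Fin (N+1)) ≃ Option (Fin N) × Equiv.Perm (Fin N) :=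
      (finSuccEquivLast.permCongr).trans Equiv.Perm.decomposeOption
    rw [← E.symm.sum_comp, Fintype.sum_prod_type, Fintype.sum_option]
    have E1 : ∀ o e x, E.symm (o, e) x = finSuccEquivLast.symm (Equiv.swap none o (Option.map e (finSuccEquivLast x))) := by
      intro o e x
      simp [E, Equiv.permCongr_apply, Equiv.permCongr_symm, Equiv.Perm.decomposeOption_symm_apply]
    have E2 : ∀ o e, E.symm (some o, e) (Fin.last N) ≠ Fin.last N := by
      intro o e
      rw [E1]; simp
    have E3 : ∀ e, E.symm (none, e) (Fin.last N) = Fin.last N := by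
      intro e
      rw [E1]; simp
    have E4 : ∀ e (i : Fin N), E.symm (none, e) (Fin.castSucc i) = Fin.castSucc (e i) := by
      intro e i
      rw [E1]; simp
    simp only [E2, E3, if_true, if_false, Finset.sum_const_zero, add_zero]
    rw [Finset.sum_comm]
    rw [← ih (fun x => lam (Fin.snoc (α := fun _ => ℕ) x 0))]
    · unfold gsum
      apply Finset.sum_congr rfl
      intro b _
      apply Finset.sum_congr rfl
      intro e _
      unfold dd
      have hv : ∀ j ≤ N, vtx (Fin.snoc (α := fun _ => ℕ) (fun c => (b c : ℕ)) 0) (E.symm (none, e)) j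
          = Fin.snoc (α := fun _ => ℕ) (vtx (fun c => (b c : ℕ)) e j) 0 := by
        intro j hj
        funext d
        refine Fin.lastCases ?_ (fun i => ?_) d
        · simp [vtx, E3]; omega
        · simp [vtx, E4]
      unfold rbow
      rw [Finset.image_congr (g := fun j => lam (Fin.snoc (α := fun _ => ℕ) (vtx (fun c => (b c : ℕ)) e j) 0))]
      intro j hj
      dsimp only
      rw [hv j (by simp at hj; omega)]
    · intro x
      have h1 := hle (Fin.snoc (α := fun _ => ℕ) x 0)
      have h2 := hlo (Fin.snoc (α := fun _ => ℕ) x 0) (Fin.last N) (by simp)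
      simp at h2; omega
    · intro x c hx
      exact hlo _ c.castSucc (by simpa using hx)
    · intro x c hx
      exact hhi _ c.castSucc (by simpa using hx)

/-- existence form -/
theorem sperner_exists (n m : ℕ) (lam : (Fin n → ℕ) → ℕ)
    (h1 : ∀ x, (∀ c, x c ≤ m) → lam x ≤ n) 
    (h2 : ∀ x, (∀ c, x c ≤ m) → ∀ c : Fin n, x c = 0 → lam x ≠ (c : ℕ) + 1)
    (h3 : ∀ x, (∀ c, x c ≤ m) → ∀ c, x c = m → lam x ≠ 0) :
    ∃ a : Fin n → ℕ, (∀ c, a c < m) ∧ ∀ k ≤ n, ∃ x : Fin n → ℕ, 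
      (∀ c, a c ≤ x c ∧ x c ≤ a c + 1) ∧ lam x = k := by
  classical
  have := sperner m n (fun x => lam (fun c => min (x c) m)) 
    (fun x => h1 _ (by simp)) (fun x c hx => h2 _ (by simp) c (by simp [hx]))
    (fun x c hx => h3 _ (by simp) c (by simp [hx]))
  have hne : gsum n m (fun x => lam (fun c => min (x c) m)) ≠ 0 := by rw [this]; decide
  obtain ⟨a, _, ha⟩ := Finset.exists_ne_zero_of_sum_ne_zero hne
  obtain ⟨π, _, hπ⟩ := Finset.exists_ne_zero_of_sum_ne_zero ha
  refine ⟨fun c => a c, fun c => (a c).2, fun k hk => ?_⟩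
  by_contra hcon
  push Not at hcon
  apply hπ
  apply rbow_zero n _ k hk
  intro j hj
  apply hcon
  intro c
  have := (a c).2
  simp only [vtx]
  split_ifs <;> simp

end CL
namespace CL

theorem kkm (n : ℕ) (C : Fin (n+1) → Set (Fin n → ℝ)) (hC : ∀ k, IsClosed (C k))
    (hcov : Icc 0 1 ⊆ ⋃ k, C k)
    (h1 : ∀ y ∈ Icc (0 : Fin n → ℝ) 1, ∀ c : Fin n, y c = 0 → y ∉ C c.succ)
    (h2 : ∀ y ∈ Icc (0 : Fin n → ℝ) 1, ∀ c : Fin n, y c = 1 → y ∉ C 0) :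
    ∃ y ∈ Icc (0 : Fin n → ℝ) 1, ∀ k, y ∈ C k := by
  classical
  by_contra hcon
  push Not at hcon
  obtain ⟨δ, hδ, hball⟩ := lebesgue_number_lemma_of_metric (s := Icc (0 : Fin n → ℝ) 1)
    (c := fun k => (C k)ᶜ) isCompact_Icc (fun k => (hC k).isOpen_compl) (by
      intro y hy
      obtain ⟨k, hk⟩ := hcon y hy
      exact mem_iUnion.2 ⟨k, hk⟩)
  obtain ⟨m', hm'⟩ := exists_nat_one_div_lt hδ
  set m : ℕ := m' + 1 with hm
  have hm0 : (0 : ℝ) < m := by positivity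
  let g : (Fin n → ℕ) → (Fin n → ℝ) := fun x c => (x c : ℝ) / m
  have hg : ∀ x : Fin n → ℕ, (∀ c, x c ≤ m) → g x ∈ Icc (0 : Fin n → ℝ) 1 := by
    intro x hx
    refine ⟨fun c => ?_, fun c => ?_⟩
    · simp only [g, Pi.zero_apply]; positivity
    · simp only [g, Pi.one_apply]
      rw [div_le_one hm0]; exact_mod_cast hx c
  have hlab : ∀ x : Fin n → ℕ, ∃ k : Fin (n+1), (∀ c, x c ≤ m) → g x ∈ C k := by
    intro x
    by_cases hx : ∀ c, x c ≤ m
    · obtain ⟨k, hk⟩ := mem_iUnion.1 (hcov (hg x hx))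
      exact ⟨k, fun _ => hk⟩
    · exact ⟨0, fun h => absurd h hx⟩
  choose lab hlab using hlab
  obtain ⟨a, ham, ha⟩ := sperner_exists n m (fun x => (lab x : ℕ)) (fun x _ => by have := (lab x).2; omega)
    (by
      intro x hx c hc heq
      have : lab x = c.succ := by ext; simpa using heq
      apply h1 (g x) (hg x hx) c (by simp [g, hc])
      rw [← this]; exact hlab x hx)
    (by
      intro x hx c hc heq
      have : lab x = 0 := by ext; simpa using heq
      apply h2 (g x) (hg x hx) c (by simp only [g, hc]; exact div_self hm0.ne')
      rw [← this]; exact hlab x hx)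
  obtain ⟨k, hk⟩ := hball (g a) (hg a fun c => (ham c).le)
  obtain ⟨x, hx, hxk⟩ := ha k (by have := k.2; omega)
  have hxm : ∀ c, x c ≤ m := fun c => by have := hx c; have := ham c; omega
  have hxC : g x ∈ C k := by
    have : lab x = k := by ext; exact hxk
    rw [← this]; exact hlab x hxm
  refine hk ?_ hxC
  rw [Metric.mem_ball]
  refine lt_of_le_of_lt ?_ hm'
  rw [dist_pi_le_iff (by positivity)]
  intro c
  have hc := hx c
  have h3 : (a c : ℝ) ≤ x c := by exact_mod_cast hc.1
  have h4 : (x c : ℝ) ≤ a c + 1 := by exact_mod_cast hc.2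
  simp only [g]
  rw [Real.dist_eq, ← sub_div, abs_of_nonneg (div_nonneg (by linarith) hm0.le)]
  have : (m : ℝ) = m' + 1 := by simp [hm]
  rw [← this]
  gcongr
  linarith

lemma clopen_sep {K : Type*} [TopologicalSpace K] [CompactSpace K] [T2Space K] (A B : Set K)
    (hA : IsClosed A) (hB : IsClosed B) (h : ∀ x ∈ A, ∀ z ∈ connectedComponent x, z ∉ B) :
    ∃ U : Set K, IsClopen U ∧ A ⊆ U ∧ ∀ z ∈ U, z ∉ B := by
  classical
  have hloc : ∀ x ∈ A, ∃ Z : Set K, IsClopen Z ∧ x ∈ Z ∧ ∀ z ∈ Z, z ∉ B := by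
    intro x hx
    have hsub : connectedComponent x ⊆ Bᶜ := fun z hz => h x hx z hz
    rw [connectedComponent_eq_iInter_isClopen] at hsub
    have : Nonempty { s : Set K // IsClopen s ∧ x ∈ s } := ⟨⟨univ, isClopen_univ, mem_univ x⟩⟩
    obtain ⟨Z, hZ⟩ := exists_subset_nhds_of_compactSpace (X := K)
      (V := fun s : { s : Set K // IsClopen s ∧ x ∈ s } => (s : Set K)) (by
        intro s t
        exact ⟨⟨s ∩ t, s.2.1.inter t.2.1, s.2.2, t.2.2⟩, inter_subset_left, inter_subset_right⟩)
      (fun s => s.2.1.1) (U := Bᶜ) (fun y hy => hB.isOpen_compl.mem_nhds (hsub hy))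
    exact ⟨Z, Z.2.1, Z.2.2, fun z hz => hZ hz⟩
  choose! Z hZ using hloc
  obtain ⟨t, htA, ht⟩ := hA.isCompact.elim_nhds_subcover Z
    (fun x hx => (hZ x hx).1.isOpen.mem_nhds (hZ x hx).2.1)
  refine ⟨⋃ x ∈ t, Z x, ?_, ht, ?_⟩
  · exact isClopen_biUnion_finset fun x hx => (hZ x (htA x hx)).1
  · intro z hz
    simp only [mem_iUnion] at hz
    obtain ⟨x, hx, hzx⟩ := hz
    exact (hZ x (htA x hx)).2.2 z hzx

end CL
namespace CL

variable {n : ℕ}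

lemma face_subset_hull (S : Finset (EuclideanSpace ℝ (Fin n)))
    (l : EuclideanSpace ℝ (Fin n) →L[ℝ] ℝ) (p : EuclideanSpace ℝ (Fin n))
    (hp : p ∈ convexHull ℝ (S : Set (EuclideanSpace ℝ (Fin n))))
    (hmax : ∀ s ∈ S, l s ≤ l p) :
    p ∈ convexHull ℝ {s | s ∈ S ∧ l s = l p} := by
  classical
  obtain ⟨w, hw0, hw1, hwp⟩ := Finset.mem_convexHull.1 hp
  have hsum : ∑ s ∈ S, w s * (l p - l s) = 0 := by
    have : l p = ∑ s ∈ S, w s * l s := by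
      conv_lhs => rw [← hwp, Finset.centerMass_eq_of_sum_1 _ _ hw1]
      simp
    simp_rw [mul_sub]
    rw [Finset.sum_sub_distrib, ← Finset.sum_mul, hw1, ← this]; ring
  have hz := (Finset.sum_eq_zero_iff_of_nonneg (fun s hs =>
    mul_nonneg (hw0 s hs) (sub_nonneg.2 (hmax s hs)))).1 hsum
  have hp2 : {i ∈ S | w i ≠ 0}.centerMass w id = p := by
    rw [Finset.centerMass_filter_ne_zero, hwp]
  suffices key : {i ∈ S | w i ≠ 0}.centerMass w id ∈ convexHull ℝ {s | s ∈ S ∧ l s = l p} by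
    rwa [hp2] at key
  apply Finset.centerMass_mem_convexHull
  · intro i hi; exact hw0 i (Finset.mem_filter.1 hi).1
  · rw [Finset.sum_filter_ne_zero, hw1]; norm_num
  · intro i hi
    obtain ⟨hi1, hi2⟩ := Finset.mem_filter.1 hi
    refine ⟨hi1, ?_⟩
    rcases mul_eq_zero.1 (hz i hi1) with h | h
    · exact absurd h hi2
    · simp; linarith

lemma interior_not_max {P : Set (EuclideanSpace ℝ (Fin n))}
    (l : EuclideanSpace ℝ (Fin n) →L[ℝ] ℝ) (hl : l ≠ 0) {z : EuclideanSpace ℝ (Fin n)}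
    (hz : z ∈ interior P) : ∃ y ∈ P, l z < l y := by
  obtain ⟨w, hw⟩ : ∃ w, l w ≠ 0 := by
    by_contra hcon
    push Not at hcon
    exact hl (ContinuousLinearMap.ext (by simpa using hcon))
  have hc : Continuous (fun t : ℝ => z + t • (l w • w)) := by fun_prop
  have : ∀ᶠ t : ℝ in nhds 0, z + t • (l w • w) ∈ P := by
    apply hc.continuousAt.eventually
    simp only [zero_smul, add_zero]
    exact mem_interior_iff_mem_nhds.1 hz
  have h2 : ∀ᶠ t : ℝ in nhdsWithin 0 (Ioi 0), z + t • (l w • w) ∈ P := this.filter_mono nhdsWithin_le_nhds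
  obtain ⟨t, ht, ht0⟩ := (h2.and self_mem_nhdsWithin).exists
  refine ⟨_, ht, ?_⟩
  simp only [map_add, map_smul, smul_eq_mul]
  have : 0 < t * (l w * l w) := mul_pos ht0 (mul_self_pos.2 hw)
  linarith

lemma facet_functional_ne {P F : Set (EuclideanSpace ℝ (Fin n))} (hn : 0 < n)
    (hint : (interior P).Nonempty) (hF : IsFacetOf P F)
    (l : EuclideanSpace ℝ (Fin n) →L[ℝ] ℝ) (hl : F = {x ∈ P | ∀ y ∈ P, l y ≤ l x}) : l ≠ 0 := by
  rintro rfl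
  have hFP : F = P := by rw [hl]; ext; simp
  have := hF.2
  unfold faceDim at this
  rw [hFP, affineSpan_eq_top_of_nonempty_interior (hint.mono (interior_mono (subset_convexHull ℝ P)))] at this
  rw [AffineSubspace.direction_top, finrank_top, finrank_euclideanSpace_fin] at this
  omega

lemma argmax_eq_hull (S : Finset (EuclideanSpace ℝ (Fin n))) {P F : Set (EuclideanSpace ℝ (Fin n))}
    (hS : P = convexHull ℝ (S : Set (EuclideanSpace ℝ (Fin n)))) (hF : IsFaceOf P F) :
    F ⊆ convexHull ℝ {s | s ∈ S ∧ s ∈ F} := by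
  obtain ⟨l, hl⟩ := hF
  intro p hp
  have hp' := hp
  rw [hl] at hp'
  obtain ⟨hpP, hmax⟩ := hp'
  have hSP : ∀ s ∈ S, s ∈ P := fun s hs => by rw [hS]; exact subset_convexHull ℝ _ hs
  have := face_subset_hull S l p (hS ▸ hpP) (fun s hs => hmax s (hSP s hs))
  refine convexHull_mono ?_ this
  rintro s ⟨hs, hls⟩
  refine ⟨hs, ?_⟩
  rw [hl]
  exact ⟨hSP s hs, fun y hy => by rw [hls]; exact hmax y hy⟩

lemma face_convex {P F : Set (EuclideanSpace ℝ (Fin n))} (hP : Convex ℝ P) (hF : IsFaceOf P F) :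
    Convex ℝ F := by
  obtain ⟨l, rfl⟩ := hF
  intro x hx y hy a b ha hb hab
  refine ⟨hP hx.1 hy.1 ha hb hab, fun z hz => ?_⟩
  simp only [map_add, map_smul, smul_eq_mul]
  have h1 := hx.2 z hz
  have h2 := hy.2 z hz
  have : l z = a * l z + b * l z := by rw [← add_mul, hab, one_mul]
  nlinarith

lemma facets_finite {P : Set (EuclideanSpace ℝ (Fin n))} (hP : IsPolytope P) :
    {F | IsFacetOf P F}.Finite := by
  classical
  obtain ⟨⟨S, hS⟩, -⟩ := hP
  have hconv : Convex ℝ P := by rw [hS]; exact convex_convexHull ℝ _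
  apply Set.Finite.of_injOn (f := fun F => ({s | s ∈ S ∧ s ∈ F} : Set (EuclideanSpace ℝ (Fin n))))
    (t := 𝒫 (S : Set (EuclideanSpace ℝ (Fin n)))) _ _ (S.finite_toSet.powerset)
  · intro F _ s hs; exact hs.1
  · have key : ∀ F, IsFacetOf P F → F = convexHull ℝ {s | s ∈ S ∧ s ∈ F} := fun F hF =>
      Subset.antisymm (argmax_eq_hull S hS hF.1)
        (convexHull_min (fun s hs => hs.2) (face_convex hconv hF.1))
    intro F hF G hG h
    rw [key F hF, key G hG]
    exact congrArg _ h

lemma hrep {P : Set (EuclideanSpace ℝ (Fin n))} (hn : 0 < n) (hP : IsPolytope P)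
    {x : EuclideanSpace ℝ (Fin n)} (hx : x ∉ P) :
    ∃ F, IsFacetOf P F ∧ ∀ l : EuclideanSpace ℝ (Fin n) →L[ℝ] ℝ,
      F = {x ∈ P | ∀ y ∈ P, l y ≤ l x} → ∀ p ∈ F, l p < l x := by
  classical
  have hP' := hP
  obtain ⟨⟨S, hS⟩, hint⟩ := hP
  have hconv : Convex ℝ P := by rw [hS]; exact convex_convexHull ℝ _
  have hcomp : IsCompact P := by rw [hS]; exact S.finite_toSet.isCompact_convexHull ℝ
  -- generic interior point
  obtain ⟨z, hz, hzT⟩ : ∃ z ∈ interior P, ∀ T ∈ S.powerset,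
      affineSpan ℝ (insert x (T : Set (EuclideanSpace ℝ (Fin n)))) ≠ ⊤ →
      z ∉ affineSpan ℝ (insert x (T : Set (EuclideanSpace ℝ (Fin n)))) := by
    by_contra hcon
    push Not at hcon
    have hsub : interior P ⊆ ⋃ T : Finset (EuclideanSpace ℝ (Fin n)), ⋃ _ : T ∈ S.powerset.filter
        (fun T : Finset (EuclideanSpace ℝ (Fin n)) => affineSpan ℝ (insert x (T : Set (EuclideanSpace ℝ (Fin n)))) ≠ ⊤),
        (affineSpan ℝ (insert x (T : Set (EuclideanSpace ℝ (Fin n)))) : Set (EuclideanSpace ℝ (Fin n))) := by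
      intro z hz
      obtain ⟨T, hT, h1, h2⟩ := hcon z hz
      simp only [mem_iUnion]
      exact ⟨T, Finset.mem_filter.2 ⟨hT, h1⟩, h2⟩
    have hnull : MeasureTheory.volume (interior P) = 0 := by
      refine MeasureTheory.measure_mono_null hsub ?_
      refine (MeasureTheory.measure_biUnion_null_iff (Finset.countable_toSet _)).2 ?_
      intro T hT
      exact MeasureTheory.Measure.addHaar_affineSubspace _ _ (Finset.mem_filter.1 hT).2
    exact (isOpen_interior.measure_pos MeasureTheory.volume hint).ne' hnull
  have hzP := interior_subset hz
  -- exit point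
  let γ : ℝ → EuclideanSpace ℝ (Fin n) := fun t => z + t • (x - z)
  have hγ : Continuous γ := by fun_prop
  have hK : IsCompact (Icc (0:ℝ) 1 ∩ γ ⁻¹' P) := isCompact_Icc.inter_right (hcomp.isClosed.preimage hγ)
  obtain ⟨t, ht, htmax⟩ := hK.exists_isMaxOn ⟨0, by simp [γ, hzP]⟩ continuousOn_id
  have ht1 : t < 1 := by
    refine lt_of_le_of_ne ht.1.2 ?_
    rintro rfl
    apply hx
    have := ht.2
    simpa [γ] using this
  have hpint : γ t ∉ interior P := by
    intro hp
    have h1 : ∀ᶠ s in nhds t, γ s ∈ P := hγ.continuousAt.eventually (mem_interior_iff_mem_nhds.1 hp)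
    have h2 : ∀ᶠ s in nhds t, s < 1 := eventually_lt_nhds ht1
    have h3 : ∀ᶠ s in nhdsWithin t (Ioi t), γ s ∈ P ∧ s < 1 :=
      (h1.and h2).filter_mono nhdsWithin_le_nhds
    obtain ⟨s, ⟨hs1, hs2⟩, hs3⟩ := (h3.and self_mem_nhdsWithin).exists
    have hs3' : t < s := hs3
    have := htmax (show s ∈ Icc (0:ℝ) 1 ∩ γ ⁻¹' P from ⟨⟨by linarith [ht.1.1], hs2.le⟩, hs1⟩)
    simp at this
    linarith
  obtain ⟨l, hl⟩ := geometric_hahn_banach_open_point hconv.interior isOpen_interior hpint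
  have hlP : ∀ y ∈ P, l y ≤ l (γ t) := by
    intro y hy
    have : y ∈ closure (interior P) := by
      rw [hconv.closure_interior_eq_closure_of_nonempty_interior hint]; exact subset_closure hy
    exact closure_minimal (fun a ha => (hl a ha).le) (isClosed_le l.continuous continuous_const) this
  have ht0 : 0 < t := by
    refine lt_of_le_of_ne ht.1.1 ?_
    rintro rfl
    have := hl z hz
    simp [γ] at this
  have hl0 : l ≠ 0 := by
    rintro rfl
    simpa using hl z hz
  let F : Set (EuclideanSpace ℝ (Fin n)) := {x ∈ P | ∀ y ∈ P, l y ≤ l x}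
  have hFface : IsFaceOf P F := ⟨l, rfl⟩
  have hpF : γ t ∈ F := ⟨ht.2, hlP⟩
  have hle : faceDim F ≤ n - 1 := by
    unfold faceDim
    rw [direction_affineSpan]
    have hsub : vectorSpan ℝ F ≤ LinearMap.ker (l : EuclideanSpace ℝ (Fin n) →ₗ[ℝ] ℝ) := by
      rw [vectorSpan_def, Submodule.span_le]
      rintro _ ⟨a, ha, b, hb, rfl⟩
      have h1 := ha.2 b hb.1
      have h2 := hb.2 a ha.1
      simp
      linarith
    have hk : Module.finrank ℝ (LinearMap.ker (l : EuclideanSpace ℝ (Fin n) →ₗ[ℝ] ℝ)) < n := by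
      have := Submodule.finrank_lt (s := LinearMap.ker (l : EuclideanSpace ℝ (Fin n) →ₗ[ℝ] ℝ)) (by
        intro h
        rw [LinearMap.ker_eq_top] at h
        apply hl0
        ext y
        exact congrArg (fun f => f y) h)
      rwa [finrank_euclideanSpace_fin] at this
    have := Submodule.finrank_mono hsub
    omega
  have hdim : faceDim F = n - 1 := by
    by_contra hne
    have hlt : faceDim F < n - 1 := lt_of_le_of_ne hle hne
    let T : Finset (EuclideanSpace ℝ (Fin n)) := S.filter (· ∈ F)
    have hTF : (T : Set (EuclideanSpace ℝ (Fin n))) = {s | s ∈ S ∧ s ∈ F} := by ext; simp [T]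
    have hsubF : (T : Set (EuclideanSpace ℝ (Fin n))) ⊆ F := by rw [hTF]; exact fun s hs => hs.2
    refine hzT T (by simp [T]) ?_ ?_
    · intro htop
      have h1 := finrank_vectorSpan_insert_le_set ℝ (T : Set (EuclideanSpace ℝ (Fin n))) x
      rw [← direction_affineSpan, htop, AffineSubspace.direction_top, finrank_top,
        finrank_euclideanSpace_fin] at h1
      have h2 := Submodule.finrank_mono (vectorSpan_mono ℝ hsubF)
      unfold faceDim at hlt
      rw [direction_affineSpan] at hlt
      omega
    · have h1 : γ t ∈ affineSpan ℝ (insert x (T : Set (EuclideanSpace ℝ (Fin n)))) := by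
        have := argmax_eq_hull S hS hFface hpF
        rw [← hTF] at this
        exact affineSpan_mono ℝ (subset_insert _ _) (convexHull_subset_affineSpan _ this)
      have h2 : x ∈ affineSpan ℝ (insert x (T : Set (EuclideanSpace ℝ (Fin n)))) :=
        subset_affineSpan ℝ _ (mem_insert _ _)
      have h3 := AffineMap.lineMap_mem ((1 - t)⁻¹) h2 h1
      convert h3 using 1
      have : (1 - t) ≠ 0 := by linarith
      simp only [AffineMap.lineMap_apply, vsub_eq_sub, vadd_eq_add, γ]
      have e : z + t • (x - z) - x = (1 - t) • (z - x) := by module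
      rw [e, smul_smul, inv_mul_cancel₀ this]
      simp
  have hfacet : IsFacetOf P F := ⟨hFface, hdim⟩
  refine ⟨F, hfacet, fun l' hl' p hp => ?_⟩
  have hl'0 := facet_functional_ne hn hint hfacet l' hl'
  obtain ⟨y, hy, hzy⟩ := interior_not_max l' hl'0 hz
  rw [hl'] at hp hpF
  have h1 := hp.2 _ hpF.1
  have h2 := hpF.2 _ hp.1
  have h3 := hpF.2 _ hy
  have h4 : l' (γ t) = l' z + t * (l' x - l' z) := by simp [γ]
  have h5 : 0 < l' x - l' z := by
    by_contra hc
    push Not at hc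
    nlinarith
  nlinarith

end CL
namespace CL

lemma exists_vertex {n : ℕ} {P : Set (EuclideanSpace ℝ (Fin n))} (hcomp : IsCompact P)
    (hne : P.Nonempty) : ∃ v, IsVertexOf P v := by
  obtain ⟨v, hv, hmax⟩ := hcomp.exists_isMaxOn hne continuous_norm.continuousOn
  refine ⟨v, innerSL ℝ v, ?_⟩
  have hle : ∀ y ∈ P, ‖y‖ ≤ ‖v‖ := fun y hy => hmax hy
  have h1 : ∀ y ∈ P, inner ℝ v y ≤ inner ℝ v v := by
    intro y hy
    have h2 := real_inner_le_norm v y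
    rw [real_inner_self_eq_norm_sq]
    nlinarith [hle y hy, norm_nonneg v]
  ext x
  simp only [mem_singleton_iff, mem_ofPred_eq, innerSL_apply_apply]
  constructor
  · rintro rfl; exact ⟨hv, h1⟩
  · rintro ⟨hx, hxm⟩
    have h3 := hxm v hv
    have h4 : ‖x - v‖ ^ 2 ≤ 0 := by
      rw [norm_sub_sq_real, real_inner_comm]
      rw [real_inner_self_eq_norm_sq] at h3
      nlinarith [hle x hx, norm_nonneg v, norm_nonneg x]
    have : ‖x - v‖ = 0 := by nlinarith [norm_nonneg (x - v)]
    exact sub_eq_zero.1 (norm_eq_zero.1 this)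

theorem geom {n : ℕ} (hn : 0 < n) (P : Set (EuclideanSpace ℝ (Fin n)))
    (hP : IsSimplePolytope P)
    (h : Set (EuclideanSpace ℝ (Fin n)) → Fin n)
    (hcol : IsProperColoring P h) :
    ∃ (Fc : Fin n → Set (EuclideanSpace ℝ (Fin n))) (r : (Fin n → ℝ) → EuclideanSpace ℝ (Fin n)),
      Continuous r ∧ (∀ c, IsFacetOf P (Fc c) ∧ h (Fc c) = c) ∧
      ∀ y ∈ Icc (0 : Fin n → ℝ) 1, r y ∈ P ∧ (∀ c, y c = 0 → r y ∈ Fc c) ∧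
        (∀ c, y c = 1 → ∃ G, IsFacetOf P G ∧ (∀ c, G ≠ Fc c) ∧ r y ∈ G) := by
  classical
  obtain ⟨hPoly, hsimple⟩ := hP
  have hfin := facets_finite hPoly
  have hPoly' := hPoly
  obtain ⟨⟨S, hS⟩, hint⟩ := hPoly
  have hcomp : IsCompact P := by rw [hS]; exact S.finite_toSet.isCompact_convexHull ℝ
  have hPne : P.Nonempty := hint.mono interior_subset
  obtain ⟨v, hv⟩ := exists_vertex hcomp hPne
  have hcard := hsimple v hv
  obtain ⟨l₀, hl₀⟩ := hv
  have hvP : v ∈ P := by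
    have : v ∈ ({v} : Set (EuclideanSpace ℝ (Fin n))) := rfl
    rw [hl₀] at this; exact this.1
  have hexp : ∀ x ∈ P, x ≠ v → l₀ x < l₀ v := by
    intro x hx hxv
    by_contra hcon
    push Not at hcon
    have hvm : v ∈ ({v} : Set (EuclideanSpace ℝ (Fin n))) := rfl
    rw [hl₀] at hvm
    have : x ∈ ({v} : Set (EuclideanSpace ℝ (Fin n))) := by
      rw [hl₀]; exact ⟨hx, fun y hy => (hvm.2 y hy).trans hcon⟩
    exact hxv this
  -- facets through v
  have hinj : Set.InjOn h {F | IsFacetOf P F ∧ v ∈ F} := by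
    intro F hF G hG hFG
    by_contra hne
    exact hcol F G hF.1 hG.1 hne ⟨v, hF.2, hG.2⟩ hFG
  have himg : h '' {F | IsFacetOf P F ∧ v ∈ F} = univ := by
    apply Set.eq_of_subset_of_ncard_le (subset_univ _)
    rw [hinj.ncard_image, hcard, Set.ncard_univ, Nat.card_eq_fintype_card, Fintype.card_fin]
  have hex : ∀ c : Fin n, ∃ F, (IsFacetOf P F ∧ v ∈ F) ∧ h F = c := by
    intro c
    have : c ∈ h '' {F | IsFacetOf P F ∧ v ∈ F} := by rw [himg]; trivial
    exact this
  choose Fc hFc hFcc using hex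
  have huniq : ∀ F, IsFacetOf P F → v ∈ F → F = Fc (h F) := fun F hF hvF =>
    hinj ⟨hF, hvF⟩ (hFc _) (hFcc _).symm
  -- functionals
  have hfun : ∀ F, ∃ l : EuclideanSpace ℝ (Fin n) →L[ℝ] ℝ, IsFacetOf P F →
      F = {x ∈ P | ∀ y ∈ P, l y ≤ l x} := by
    intro F
    by_cases hF : IsFacetOf P F
    · obtain ⟨l, hl⟩ := hF.1
      exact ⟨l, fun _ => hl⟩
    · exact ⟨0, fun h => absurd h hF⟩
  choose l hl using hfun
  have hpt : ∀ F, ∃ p, IsFacetOf P F → p ∈ F := by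
    intro F
    by_cases hF : IsFacetOf P F
    · obtain ⟨p, hp, hmax⟩ := hcomp.exists_isMaxOn hPne (l F).continuous.continuousOn
      refine ⟨p, fun _ => ?_⟩
      rw [hl F hF]
      exact ⟨hp, fun y hy => hmax hy⟩
    · exact ⟨0, fun h => absurd h hF⟩
  choose p hp using hpt
  have hle : ∀ F, IsFacetOf P F → ∀ x ∈ P, l F x ≤ l F (p F) := by
    intro F hF x hx
    have := (hl F hF).subset (hp F hF)
    exact this.2 x hx
  have hmemF : ∀ F, IsFacetOf P F → ∀ x ∈ P, l F (p F) ≤ l F x → x ∈ F := by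
    intro F hF x hx hge
    rw [hl F hF]
    exact ⟨hx, fun y hy => (hle F hF y hy).trans hge⟩
  have hmemP : ∀ x, (∀ F, IsFacetOf P F → l F x ≤ l F (p F)) → x ∈ P := by
    intro x hx
    by_contra hxP
    obtain ⟨F, hF, hsep⟩ := hrep hn hPoly' hxP
    have := hsep (l F) (hl F hF) (p F) (hp F hF)
    linarith [hx F hF]
  have hveq : ∀ F, IsFacetOf P F → v ∈ F → l F (p F) = l F v := by
    intro F hF hvF
    apply le_antisymm _ (hle F hF v hvP)
    have hvF' := (hl F hF).subset hvF
    have := (hl F hF).subset (hp F hF)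
    exact hvF'.2 _ this.1
  have hvlt : ∀ F, IsFacetOf P F → v ∉ F → 0 < l F (p F) - l F v := by
    intro F hF hvF
    by_contra hcon
    exact hvF (hmemF F hF v hvP (by linarith))
  -- coordinates
  let L : EuclideanSpace ℝ (Fin n) →ₗ[ℝ] (Fin n → ℝ) :=
    LinearMap.pi fun c => -(l (Fc c) : EuclideanSpace ℝ (Fin n) →ₗ[ℝ] ℝ)
  have hLap : ∀ w c, L w c = - l (Fc c) w := fun w c => by simp [L]
  have hLinj : Function.Injective L := by
    rw [injective_iff_map_eq_zero]
    intro w hw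
    by_contra hw0
    have hlw : ∀ c, l (Fc c) w = 0 := by
      intro c
      have := congrArg (fun f => f c) hw
      rw [hLap] at this
      simpa using this
    have hev : ∀ᶠ t : ℝ in nhds 0, ∀ F ∈ {F | IsFacetOf P F}, l F (v + t • w) ≤ l F (p F) := by
      rw [Filter.eventually_all_finite hfin]
      intro F hF
      by_cases hvF : v ∈ F
      · refine Filter.Eventually.of_forall fun t => ?_
        rw [hveq F hF hvF, huniq F hF hvF]
        simp [hlw]
      · have hc : Continuous fun t : ℝ => l F (v + t • w) := by fun_prop
        have := hc.continuousAt.eventually_lt (x₀ := 0) (g := fun _ => l F (p F)) continuousAt_const (by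
          simp; linarith [hvlt F hF hvF])
        exact this.mono fun t ht => ht.le
    have hev2 : ∀ᶠ t : ℝ in nhds 0, ∀ F ∈ {F | IsFacetOf P F}, l F (v + (-t) • w) ≤ l F (p F) := by
      have : Filter.Tendsto (fun t : ℝ => -t) (nhds 0) (nhds 0) := by
        simpa using (continuous_neg (G := ℝ)).tendsto 0
      exact this.eventually hev
    have h3 : ∀ᶠ t : ℝ in nhdsWithin 0 (Ioi 0), _ := (hev.and hev2).filter_mono nhdsWithin_le_nhds
    obtain ⟨t, ⟨ht1, ht2⟩, ht0⟩ := (h3.and self_mem_nhdsWithin).exists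
    have ht0' : (0:ℝ) < t := ht0
    have h4 := hexp _ (hmemP _ ht1) (by simp [ht0'.ne', hw0])
    have h5 := hexp _ (hmemP _ ht2) (by simp [ht0'.ne', hw0])
    simp at h4 h5
    linarith
  let Le : EuclideanSpace ℝ (Fin n) ≃ₗ[ℝ] (Fin n → ℝ) :=
    LinearEquiv.ofInjectiveOfFinrankEq L hLinj (by simp)
  have hLe : ∀ w, Le w = L w := fun w => rfl
  let M : (Fin n → ℝ) →ₗ[ℝ] EuclideanSpace ℝ (Fin n) := Le.symm
  have hM : ∀ y c, l (Fc c) (M y) = - y c := by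
    intro y c
    have : L (M y) = y := by rw [← hLe]; exact Le.apply_symm_apply y
    have h2 := congrArg (fun f => f c) this
    simp only [hLap] at h2
    linarith
  have hMc : Continuous M := LinearMap.continuous_of_finiteDimensional M
  -- scale
  obtain ⟨R, hR0, hR⟩ : ∃ R : ℝ, 0 < R ∧ ∀ x ∈ P, ∀ c, l (Fc c) v - l (Fc c) x < R := by
    have hc : Continuous fun x => L (v - x) :=
      (LinearMap.continuous_of_finiteDimensional L).comp (continuous_const.sub continuous_id)
    obtain ⟨B, hB⟩ := (hcomp.image hc).isBounded.exists_norm_le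
    refine ⟨max B 0 + 1, by positivity, fun x hx c => ?_⟩
    have h1 := hB _ (mem_image_of_mem _ hx)
    have h2 := (norm_le_pi_norm (L (v - x)) c).trans h1
    rw [hLap, Real.norm_eq_abs, abs_neg, map_sub] at h2
    have := le_abs_self (l (Fc c) v - l (Fc c) x)
    have := le_max_left B 0
    linarith
  let u : (Fin n → ℝ) → EuclideanSpace ℝ (Fin n) := fun y => M (R • y)
  have huc : Continuous u := hMc.comp (continuous_const_smul R)
  have hu : ∀ y c, l (Fc c) (u y) = -(R * y c) := fun y c => by simp [u, hM, -map_smul]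
  let 𝓕 : Finset (Set (EuclideanSpace ℝ (Fin n))) := hfin.toFinset
  have h𝓕 : ∀ F, F ∈ 𝓕 ↔ IsFacetOf P F := fun F => by simp [𝓕]
  have h𝓕ne : 𝓕.Nonempty := ⟨Fc ⟨0, hn⟩, (h𝓕 _).2 (hFc _).1⟩
  let φ : Set (EuclideanSpace ℝ (Fin n)) → (Fin n → ℝ) → ℝ := fun G y =>
    if v ∈ G then 1 else l G (u y) / (l G (p G) - l G v)
  have hφc : ∀ G, Continuous (φ G) := by
    intro G
    by_cases hvG : v ∈ G
    · simp only [φ, hvG, if_true]; exact continuous_const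
    · simp only [φ, hvG, if_false]
      exact ((l G).continuous.comp huc).div_const _
  let μ : (Fin n → ℝ) → ℝ := fun y => 𝓕.sup' h𝓕ne fun G => φ G y
  have hμc : Continuous μ := Continuous.finset_sup'_apply h𝓕ne fun G _ => hφc G
  have hφμ : ∀ G, IsFacetOf P G → ∀ y, φ G y ≤ μ y := fun G hG y =>
    Finset.le_sup' (fun G => φ G y) ((h𝓕 G).2 hG)
  have hμ1 : ∀ y, 1 ≤ μ y := by
    intro y
    have := hφμ (Fc ⟨0, hn⟩) (hFc _).1 y
    simpa [φ, (hFc ⟨0, hn⟩).2] using this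
  have hμ0 : ∀ y, 0 < μ y := fun y => lt_of_lt_of_le one_pos (hμ1 y)
  let r : (Fin n → ℝ) → EuclideanSpace ℝ (Fin n) := fun y => v + (μ y)⁻¹ • u y
  have hlr : ∀ F y, l F (r y) = l F v + (μ y)⁻¹ * l F (u y) := fun F y => by simp [r]
  refine ⟨Fc, r, ?_, fun c => ⟨(hFc c).1, hFcc c⟩, ?_⟩
  · exact continuous_const.add ((hμc.inv₀ fun y => (hμ0 y).ne').smul huc)
  intro y hy
  have hrP : r y ∈ P := by
    apply hmemP
    intro F hF
    rw [hlr]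
    by_cases hvF : v ∈ F
    · rw [hveq F hF hvF, huniq F hF hvF, hu]
      have : 0 ≤ (μ y)⁻¹ * (R * y (h F)) := 
        mul_nonneg (inv_nonneg.2 (hμ0 y).le) (mul_nonneg hR0.le (hy.1 _))
      linarith
    · have h1 := hφμ F hF y
      simp only [φ, hvF, if_false] at h1
      rw [div_le_iff₀ (hvlt F hF hvF)] at h1
      have h2 := mul_le_mul_of_nonneg_left h1 (inv_nonneg.2 (hμ0 y).le)
      rw [inv_mul_cancel_left₀ (hμ0 y).ne'] at h2
      linarith
  refine ⟨hrP, fun c hc => ?_, fun c hc => ?_⟩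
  · apply hmemF _ (hFc c).1 _ hrP
    rw [hveq _ (hFc c).1 (hFc c).2, hlr, hu, hc]
    simp
  · obtain ⟨G, hG𝓕, hG⟩ := Finset.exists_mem_eq_sup' h𝓕ne (fun G => φ G y)
    have hGμ : μ y = φ G y := hG
    have hGf := (h𝓕 G).1 hG𝓕
    have hμne : μ y ≠ 1 := by
      intro h1
      have := hR _ hrP c
      rw [hlr, h1, hu, hc] at this
      simp at this
    have hvG : v ∉ G := by
      intro hvG
      apply hμne
      rw [hGμ]; simp [φ, hvG]
    refine ⟨G, hGf, ?_, ?_⟩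
    · rintro c rfl
      exact hvG (hFc c).2
    · apply hmemF G hGf _ hrP
      simp only [φ, hvG, if_false] at hGμ
      rw [eq_div_iff (hvlt G hGf hvG).ne'] at hGμ
      rw [hlr, ← hGμ, inv_mul_cancel_left₀ (hμ0 y).ne']
      linarith

end CL
/-- **Colorful Lebesgue theorem.** Let `P ⊆ ℝ^n` be a full-dimensional simple polytope
with a proper coloring `h` of its facets by `n` colors. If `P` is covered by a finite
family of closed sets `X 1, …, X N` with covering multiplicity at most `n`, then for
some `i` a connected component of `X i` intersects at least two distinct facets of `P`
of the same color. -/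
theorem colorful_lebesgue {n N : ℕ} (P : Set (EuclideanSpace ℝ (Fin n)))
    (hP : IsSimplePolytope P)
    (h : Set (EuclideanSpace ℝ (Fin n)) → Fin n)
    (hcol : IsProperColoring P h)
    (X : Fin N → Set (EuclideanSpace ℝ (Fin n)))
    (hclosed : ∀ i, IsClosed (X i))
    (hcover : P ⊆ ⋃ i, X i)
    (hmult : ∀ p ∈ P, {i | p ∈ X i}.ncard ≤ n) :
    ∃ (i : Fin N) (y : EuclideanSpace ℝ (Fin n)) (F₁ F₂ : Set (EuclideanSpace ℝ (Fin n))),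
      y ∈ X i ∧ IsFacetOf P F₁ ∧ IsFacetOf P F₂ ∧ F₁ ≠ F₂ ∧ h F₁ = h F₂ ∧
      (connectedComponentIn (X i) y ∩ F₁).Nonempty ∧
      (connectedComponentIn (X i) y ∩ F₂).Nonempty := by
  classical
  rcases Nat.eq_zero_or_pos n with hn0 | hn
  · subst hn0; exact (h P).elim0
  by_contra hcon
  push Not at hcon
  obtain ⟨Fc, r, hr, hFc, hry⟩ := CL.geom hn P hP h hcol
  have hfin := CL.facets_finite hP.1
  have hcomp : IsCompact P := by
    obtain ⟨S, hS⟩ := hP.1.1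
    rw [hS]; exact S.finite_toSet.isCompact_convexHull ℝ
  have hFclosed : ∀ F, IsFacetOf P F → IsClosed F := by
    rintro F ⟨⟨l, rfl⟩, -⟩
    have : {x ∈ P | ∀ y ∈ P, l y ≤ l x} = P ∩ ⋂ y ∈ P, {x | l y ≤ l x} := by
      ext x; simp
    rw [this]
    exact hcomp.isClosed.inter
      (isClosed_biInter fun y _ => isClosed_le continuous_const l.continuous)
  have hsep : ∀ (i : Fin N) (c : Fin n), ∃ U : Set ↥(X i ∩ P), IsClopen U ∧
      (∀ x : ↥(X i ∩ P), (x : EuclideanSpace ℝ (Fin n)) ∈ Fc c → x ∈ U) ∧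
      (∀ x ∈ U, ∀ G, IsFacetOf P G → h G = c → G ≠ Fc c →
        (x : EuclideanSpace ℝ (Fin n)) ∉ G) := by
    intro i c
    have : CompactSpace ↥(X i ∩ P) := isCompact_iff_compactSpace.1 (hcomp.inter_left (hclosed i))
    let B : Set (EuclideanSpace ℝ (Fin n)) :=
      ⋃ G ∈ {G | IsFacetOf P G ∧ h G = c ∧ G ≠ Fc c}, G
    have hB : IsClosed B :=
      (hfin.subset fun G hG => hG.1).isClosed_biUnion fun G hG => hFclosed G hG.1
    obtain ⟨U, hU, hAU, hUB⟩ := CL.clopen_sep (K := ↥(X i ∩ P))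
      (Subtype.val ⁻¹' (Fc c)) (Subtype.val ⁻¹' B)
      ((hFclosed _ (hFc c).1).preimage continuous_subtype_val)
      (hB.preimage continuous_subtype_val) (by
        intro x hx z hz hzB
        obtain ⟨G, ⟨hG, hGc, hne⟩, hzG⟩ := mem_iUnion₂.1 hzB
        have hpre : IsPreconnected (Subtype.val '' connectedComponent x) :=
          isPreconnected_connectedComponent.image _ continuous_subtype_val.continuousOn
        have hsub := hpre.subset_connectedComponentIn (F := X i)
          (mem_image_of_mem _ mem_connectedComponent) (by
            rintro _ ⟨w, -, rfl⟩; exact w.2.1)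
        have := hcon i x (Fc c) G x.2.1 (hFc c).1 hG hne.symm (by rw [(hFc c).2, hGc])
          ⟨x, hsub (mem_image_of_mem _ mem_connectedComponent), hx⟩
        have hmem : (z : EuclideanSpace ℝ (Fin n)) ∈ connectedComponentIn (X i) x ∩ G :=
          ⟨hsub (mem_image_of_mem _ hz), hzG⟩
        rw [this] at hmem
        exact hmem)
    refine ⟨U, hU, fun x hx => hAU hx, fun x hx G hG hGc hne hxG => ?_⟩
    exact hUB x hx (mem_iUnion₂.2 ⟨G, ⟨hG, hGc, hne⟩, hxG⟩)
  choose U hU hAU hUB using hsep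
  let D : ∀ i : Fin N, Fin (n+1) → Set ↥(X i ∩ P) := fun i =>
    Fin.cases (⋂ c, U i c) (fun c => (U i c)ᶜ ∩ ⋂ c' ∈ {c' | c' < c}, U i c')
  have hD0 : ∀ i x, x ∈ D i 0 ↔ ∀ c, x ∈ U i c := fun i x => by simp [D]
  have hDs : ∀ i (c : Fin n) x, x ∈ D i c.succ ↔ x ∉ U i c ∧ ∀ c' < c, x ∈ U i c' :=
    fun i c x => by simp [D]
  have hDclosed : ∀ i k, IsClosed (D i k) := by
    intro i k
    refine Fin.cases ?_ (fun c => ?_) k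
    · exact isClosed_iInter fun c => (hU i c).1
    · exact (hU i c).2.isClosed_compl.inter (isClosed_biInter fun c' _ => (hU i c').1)
  have hDcov : ∀ i x, ∃ k, x ∈ D i k := by
    intro i x
    by_cases hx : ∀ c, x ∈ U i c
    · exact ⟨0, (hD0 i x).2 hx⟩
    · push Not at hx
      obtain ⟨c, hc, hmin⟩ := WellFounded.has_min (wellFounded_lt (α := Fin n)) {c | x ∉ U i c} hx
      refine ⟨c.succ, (hDs i c x).2 ⟨hc, fun c' hc' => ?_⟩⟩
      by_contra hx'
      exact hmin c' hx' hc'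
  have hDdisj : ∀ i x k k', x ∈ D i k → x ∈ D i k' → k = k' := by
    intro i x k k'
    refine Fin.cases ?_ (fun c => ?_) k <;> refine Fin.cases ?_ (fun c' => ?_) k'
    · intros; rfl
    · intro h1 h2
      exact absurd ((hD0 i x).1 h1 c') ((hDs i c' x).1 h2).1
    · intro h1 h2
      exact absurd ((hD0 i x).1 h2 c) ((hDs i c x).1 h1).1
    · intro h1 h2
      have h1' := (hDs i c x).1 h1
      have h2' := (hDs i c' x).1 h2
      rcases lt_trichotomy c c' with hlt | heq | hlt
      · exact absurd (h2'.2 c hlt) h1'.1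
      · rw [heq]
      · exact absurd (h1'.2 c' hlt) h2'.1
  obtain ⟨y, hy, hyC⟩ := CL.kkm n (fun k => r ⁻¹' (⋃ i, Subtype.val '' (D i k)))
    (fun k => IsClosed.preimage hr (isClosed_iUnion_of_finite fun i =>
      ((hclosed i).inter hcomp.isClosed).isClosedEmbedding_subtypeVal.isClosedMap _ (hDclosed i k)))
    (by
      intro y hy
      have hyP := (hry y hy).1
      obtain ⟨i, hi⟩ := mem_iUnion.1 (hcover hyP)
      obtain ⟨k, hk⟩ := hDcov i ⟨r y, hi, hyP⟩
      exact mem_iUnion.2 ⟨k, mem_iUnion.2 ⟨i, _, hk, rfl⟩⟩)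
    (by
      intro y hy c hc hmem
      obtain ⟨i, x, hx, hxy⟩ := mem_iUnion.1 hmem
      have h1 := (hry y hy).2.1 c hc
      rw [← hxy] at h1
      exact ((hDs i c x).1 hx).1 (hAU i c x h1))
    (by
      intro y hy c hc hmem
      obtain ⟨i, x, hx, hxy⟩ := mem_iUnion.1 hmem
      obtain ⟨G, hG, hne, hrG⟩ := (hry y hy).2.2 c hc
      rw [← hxy] at hrG
      exact hUB i (h G) x ((hD0 i x).1 hx _) G hG rfl (hne _) hrG)
  have hyP := (hry y hy).1
  have hsel : ∀ k, ∃ i, ∃ hi : r y ∈ X i, (⟨r y, hi, hyP⟩ : ↥(X i ∩ P)) ∈ D i k := by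
    intro k
    obtain ⟨i, x, hx, hxy⟩ := mem_iUnion.1 (hyC k)
    have hi : r y ∈ X i := by rw [← hxy]; exact x.2.1
    refine ⟨i, hi, ?_⟩
    have : x = ⟨r y, hi, hyP⟩ := Subtype.ext hxy
    rwa [← this]
  choose f hf hfD using hsel
  have hfinj : Function.Injective f := by
    have aux : ∀ k k' i i' (e : i = i') (hi : r y ∈ X i) (hi' : r y ∈ X i'),
        (⟨r y, hi, hyP⟩ : ↥(X i ∩ P)) ∈ D i k → (⟨r y, hi', hyP⟩ : ↥(X i' ∩ P)) ∈ D i' k' →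
        k = k' := by
      rintro k k' i i' rfl hi hi' h1 h2
      exact hDdisj i _ k k' h1 h2
    intro k k' hkk
    exact aux k k' _ _ hkk (hf k) (hf k') (hfD k) (hfD k')
  have h1 := hmult _ hyP
  have h2 : (range f).ncard ≤ {i | r y ∈ X i}.ncard :=
    Set.ncard_le_ncard (by rintro _ ⟨k, rfl⟩; exact hf k) (Set.toFinite _)
  have h3 : (range f).ncard = n + 1 := by
    rw [← image_univ, hfinj.injOn.ncard_image, Set.ncard_univ, Nat.card_eq_fintype_card,
      Fintype.card_fin]
  omega

end
end

section
/- Let P ⊆ ℝ^n be a full-dimensional simple convex polytope with a proper coloring h of its facets by n colors, and let V be any vertex of P. Let {X_i}_{i=1}^N be a finite family of closed subsets of P such that each X_i intersects at most one facet of each of the n color classes, and suppose the family has covering multiplicity at most k, where k ≤ n. Then the complement P \ (X_1 ∪ … ∪ X_N) has a connected component Z with the following property: there is a set I ⊆ {1,…,n} of n−k colors and a collection of at least 2^{n−k} distinct k-dimensional faces of P, all belonging to the I-color class, each of which has nonempty intersection with Z; moreover the vertex V is contained in at least one of these k-faces. -/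
open Set

noncomputable section

open MeasureTheory in
theorem aux_det_poly {E : Type*} [NormedAddCommGroup E] [NormedSpace ℝ E]
    [FiniteDimensional ℝ E] (A : E →L[ℝ] E) :
    ∃ p : Polynomial ℝ, p.natDegree ≤ Module.finrank ℝ E ∧
      ∀ t : ℝ, p.eval t = (ContinuousLinearMap.id ℝ E + t • A).det := by
  let b := Module.finBasis ℝ E
  let M := LinearMap.toMatrix b b (A : E →ₗ[ℝ] E)
  refine ⟨((Polynomial.X : Polynomial ℝ) • M.map Polynomial.C
    + (1 : Matrix _ _ ℝ).map Polynomial.C).det, ?_, ?_⟩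
  · simpa using Polynomial.natDegree_det_X_add_C_le M 1
  · intro t
    have h1 : (ContinuousLinearMap.id ℝ E + t • A).det
        = (LinearMap.toMatrix b b ((ContinuousLinearMap.id ℝ E + t • A : E →L[ℝ] E) : E →ₗ[ℝ] E)).det := by
      rw [LinearMap.det_toMatrix]
    rw [h1, ← Polynomial.coe_evalRingHom, RingHom.map_det]
    congr 1
    have h2 : ((ContinuousLinearMap.id ℝ E + t • A : E →L[ℝ] E) : E →ₗ[ℝ] E)
      = LinearMap.id + t • (A : E →ₗ[ℝ] E) := rfl
    rw [h2, map_add (LinearMap.toMatrix b b), map_smul (LinearMap.toMatrix b b), LinearMap.toMatrix_id]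
    ext i j
    by_cases hij : i = j
    · subst hij; simp [M]; ring
    · simp [M, hij]; ring

theorem aux_det_pos {E : Type*} [NormedAddCommGroup E] [NormedSpace ℝ E]
    [FiniteDimensional ℝ E] (A : E →L[ℝ] E) (L t : ℝ) (hA : ‖A‖ ≤ L) (ht : 0 ≤ t)
    (htL : t * L < 1) : 0 < (ContinuousLinearMap.id ℝ E + t • A).det := by
  obtain ⟨p, -, hp⟩ := aux_det_poly A
  have hne : ∀ s ∈ Set.Icc (0 : ℝ) t, p.eval s ≠ 0 := by
    intro s hs h0
    rw [hp] at h0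
    have h1 := LinearMap.bot_lt_ker_of_det_eq_zero (f := ((ContinuousLinearMap.id ℝ E + s • A : E →L[ℝ] E) : E →ₗ[ℝ] E)) h0
    obtain ⟨v, hv, hv0⟩ := Submodule.exists_mem_ne_zero_of_ne_bot h1.ne'
    have h2 : v + s • A v = 0 := by simpa using hv
    have h3 : ‖v‖ = s * ‖A v‖ := by
      have : v = -(s • A v) := eq_neg_of_add_eq_zero_left h2
      rw [this, norm_neg, norm_smul, Real.norm_of_nonneg hs.1, ← this]
    have h4 : ‖A v‖ ≤ L * ‖v‖ := (A.le_opNorm v).trans (by gcongr)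
    have h5 : 0 < ‖v‖ := norm_pos_iff.2 hv0
    have hL : 0 ≤ L := (norm_nonneg _).trans hA
    have h6 : s * ‖A v‖ ≤ t * (L * ‖v‖) := by gcongr; exact hs.2
    nlinarith
  have hp0 : p.eval 0 = 1 := by rw [hp]; simp [ContinuousLinearMap.det]
  rw [← hp]
  by_contra hcon
  push Not at hcon
  have := intermediate_value_Icc' ht (f := fun s => p.eval s) p.continuous.continuousOn
  obtain ⟨s, hs, hs0⟩ := this (show (0 : ℝ) ∈ Set.Icc (p.eval t) (p.eval 0) from ⟨hcon, by rw [hp0]; norm_num⟩)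
  exact hne s hs hs0

open MeasureTheory in
theorem aux_cov {E : Type*} [NormedAddCommGroup E] [NormedSpace ℝ E]
    [FiniteDimensional ℝ E] [MeasurableSpace E] [BorelSpace E] (μ : Measure E)
    [μ.IsAddHaarMeasure] (g : E → E) (hg : ContDiff ℝ 1 g) (L : NNReal) (hL : LipschitzWith L g)
    (R : ℝ) (hR : ∀ x, g x ≠ 0 → x ∈ Metric.closedBall 0 R) (t : ℝ) (ht : 0 ≤ t) (htL : t * L < 1)
    (q : E → ℝ) :
    ∫ x in Metric.closedBall 0 R, (ContinuousLinearMap.id ℝ E + t • fderiv ℝ g x).det * q (x + t • g x) ∂μ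
     = ∫ x in Metric.closedBall 0 R, q x ∂μ := by
  have happ : ApproximatesLinearOn (fun x => x + t • g x)
      ((ContinuousLinearEquiv.refl ℝ E : E ≃L[ℝ] E) : E →L[ℝ] E) Set.univ (t.toNNReal * L) := by
    intro x _ y _
    have h1 : (x + t • g x) - (y + t • g y) - (x - y) = t • (g x - g y) := by
      rw [smul_sub]; abel
    simp only [ContinuousLinearEquiv.coe_refl, ContinuousLinearMap.coe_id', id]
    rw [h1, norm_smul, Real.norm_of_nonneg ht]
    have := hL.norm_sub_le x y
    rw [NNReal.coe_mul, Real.coe_toNNReal t ht, mul_assoc]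
    exact mul_le_mul_of_nonneg_left this ht
  have hc : Subsingleton E ∨ (t.toNNReal * L : NNReal) <
      ‖((ContinuousLinearEquiv.refl ℝ E).symm : E →L[ℝ] E)‖₊⁻¹ := by
    rcases subsingleton_or_nontrivial E with h | h
    · exact Or.inl h
    · right
      have : ‖((ContinuousLinearEquiv.refl ℝ E).symm : E →L[ℝ] E)‖₊ = 1 := by
        simp
      rw [this, inv_one, ← NNReal.coe_lt_coe]
      rw [NNReal.coe_mul, Real.coe_toNNReal t ht]
      exact htL
  have hinj : Function.Injective (fun x => x + t • g x) :=
    (happ.toHomeomorph _ hc).injective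
  have hsurj := happ.surjective hc
  have himg : (fun x => x + t • g x) '' Metric.closedBall 0 R = Metric.closedBall 0 R := by
    have hout : ∀ x, x ∉ Metric.closedBall (0 : E) R → x + t • g x = x := by
      intro x hx
      have : g x = 0 := by
        by_contra h
        exact hx (hR x h)
      simp [this]
    apply Set.Subset.antisymm
    · rintro _ ⟨x, hx, rfl⟩
      by_contra hn
      have := hinj (a₁ := x + t • g x) (a₂ := x) (hout _ hn)
      dsimp only at hn
      rw [this] at hn
      exact hn hx
    · intro y hy
      obtain ⟨x, hx⟩ := hsurj y
      refine ⟨x, ?_, hx⟩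
      by_contra hn
      have := hout x hn
      dsimp only at hx
      rw [this] at hx
      rw [hx] at hn; exact hn hy
  have key := integral_image_eq_integral_abs_det_fderiv_smul μ (s := Metric.closedBall (0:E) R)
    (f := fun x => x + t • g x) (f' := fun x => ContinuousLinearMap.id ℝ E + t • fderiv ℝ g x)
    Metric.isClosed_closedBall.measurableSet
    (fun x _ => by
      have h1 : HasFDerivAt g (fderiv ℝ g x) x := (hg.differentiable (by norm_num) x).hasFDerivAt
      exact ((hasFDerivAt_id x).add (h1.const_smul t)).hasFDerivWithinAt)
    hinj.injOn q
  rw [himg] at key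
  rw [key]
  congr 1
  ext x
  rw [abs_of_pos, smul_eq_mul]
  exact aux_det_pos _ L t (norm_fderiv_le_of_lipschitz ℝ hL) ht htL

open MeasureTheory in
theorem aux_identity {E : Type*} [NormedAddCommGroup E] [InnerProductSpace ℝ E]
    [FiniteDimensional ℝ E] [MeasurableSpace E] [BorelSpace E] (μ : Measure E)
    [μ.IsAddHaarMeasure] (g : E → E) (hg : ContDiff ℝ 1 g) (L : NNReal) (hL : LipschitzWith L g)
    (R : ℝ) (hR : ∀ x, g x ≠ 0 → x ∈ Metric.closedBall 0 R) (c : ℝ) (m : ℕ) :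
    ∫ x in Metric.closedBall 0 R, (ContinuousLinearMap.id ℝ E + fderiv ℝ g x).det
        * (1 - c * ‖x + g x‖ ^ 2) ^ m ∂μ
     = ∫ x in Metric.closedBall 0 R, (1 - c * ‖x‖ ^ 2) ^ m ∂μ := by
  set D := m * 2 + Module.finrank ℝ E with hD
  let v : Fin (D + 1) → ℝ := fun i => (i : ℝ) / ((D + 1) * (L + 1))
  have hv0 : ∀ i, 0 ≤ v i := fun i => by positivity
  have hvL : ∀ i, v i * L < 1 := by
    intro i
    have h1 : ((i : ℕ) : ℝ) < D + 1 := by exact_mod_cast i.2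
    have hL0 : (0 : ℝ) ≤ L := L.2
    have h2 : v i * L = (i * L) / ((D + 1) * (L + 1)) := by simp only [v]; ring
    rw [h2, div_lt_one (by positivity)]
    nlinarith
  have hvinj : Set.InjOn v (Finset.univ : Finset (Fin (D + 1))) := by
    intro i _ j _ hij
    have hpos : (0 : ℝ) < (D + 1) * (L + 1) := by positivity
    have : ((i : ℕ) : ℝ) = j := by
      simpa [v, div_left_inj' hpos.ne'] using hij
    exact Fin.ext (by exact_mod_cast this)
  let G : ℝ → E → ℝ := fun t x => (ContinuousLinearMap.id ℝ E + t • fderiv ℝ g x).det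
        * (1 - c * ‖x + t • g x‖ ^ 2) ^ m
  have hGcont : ∀ t, Continuous (G t) := by
    intro t
    have h1 : Continuous (fderiv ℝ g) := hg.continuous_fderiv (by norm_num)
    have h2 : Continuous g := hg.continuous
    have h3 : Continuous fun x => (ContinuousLinearMap.id ℝ E + t • fderiv ℝ g x).det :=
      ContinuousLinearMap.continuous_det.comp (by fun_prop)
    exact h3.mul (by fun_prop)
  have hGpoly : ∀ x, ∃ p : Polynomial ℝ, p.natDegree ≤ D ∧ ∀ t, p.eval t = G t x := by
    intro x
    obtain ⟨p, hp, hp'⟩ := aux_det_poly (fderiv ℝ g x)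
    let q : Polynomial ℝ := Polynomial.C (-(c * ‖g x‖ ^ 2)) * Polynomial.X ^ 2
      + Polynomial.C (-(c * (2 * inner ℝ x (g x)))) * Polynomial.X + Polynomial.C (1 - c * ‖x‖ ^ 2)
    have hq : q.natDegree ≤ 2 := Polynomial.natDegree_quadratic_le
    refine ⟨p * q ^ m, ?_, ?_⟩
    · refine (Polynomial.natDegree_mul_le).trans ?_
      have h1 : (q ^ m).natDegree ≤ m * 2 :=
        (Polynomial.natDegree_pow_le).trans (Nat.mul_le_mul_left m hq)
      omega
    · intro t
      rw [Polynomial.eval_mul, Polynomial.eval_pow, hp']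
      simp only [G]
      congr 2
      rw [norm_add_sq_real, norm_smul, inner_smul_right, mul_pow, Real.norm_eq_abs, sq_abs]
      simp [q]
      ring
  have hinterp : ∀ x, G 1 x = ∑ i, G (v i) x * (Lagrange.basis Finset.univ v i).eval 1 := by
    intro x
    obtain ⟨p, hp, hp'⟩ := hGpoly x
    have hdeg : p.degree < ((Finset.univ : Finset (Fin (D + 1))).card : WithBot ℕ) := by
      refine (Polynomial.degree_le_natDegree).trans_lt ?_
      rw [Finset.card_univ, Fintype.card_fin]
      exact_mod_cast Nat.lt_succ_of_le hp
    have h1 := Lagrange.eq_interpolate hvinj hdeg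
    rw [← hp' 1]
    conv_lhs => rw [h1]
    rw [Lagrange.interpolate_apply, Polynomial.eval_finsetSum]
    simp [hp']
  have hsum1 : ∑ i, (Lagrange.basis Finset.univ v i).eval 1 = 1 := by
    rw [← Polynomial.eval_finsetSum, Lagrange.sum_basis hvinj Finset.univ_nonempty]
    simp
  have hintg : ∀ t, IntegrableOn (G t) (Metric.closedBall 0 R) μ := fun t =>
    (hGcont t).continuousOn.integrableOn_compact (isCompact_closedBall 0 R)
  have hnode : ∀ i, ∫ x in Metric.closedBall 0 R, G (v i) x ∂μ
      = ∫ x in Metric.closedBall 0 R, (1 - c * ‖x‖ ^ 2) ^ m ∂μ := fun i =>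
    aux_cov μ g hg L hL R hR (v i) (hv0 i) (hvL i) (fun y => (1 - c * ‖y‖ ^ 2) ^ m)
  have hG1 : (fun x => (ContinuousLinearMap.id ℝ E + fderiv ℝ g x).det
        * (1 - c * ‖x + g x‖ ^ 2) ^ m) = fun x => G 1 x := by
    ext x; simp [G]
  rw [hG1]
  simp_rw [hinterp]
  rw [integral_finsetSum _ (fun i _ => (hintg (v i)).mul_const _)]
  simp_rw [integral_mul_const, hnode]
  rw [← Finset.mul_sum, hsum1, mul_one]

open MeasureTheory in
theorem aux_smooth {E : Type*} [NormedAddCommGroup E] [InnerProductSpace ℝ E]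
    [FiniteDimensional ℝ E] (g : E → E) (hg : ContDiff ℝ 1 g) (hc : HasCompactSupport g)
    (δ : ℝ) (hδ : 0 < δ) (hne : ∀ x, δ ≤ ‖x + g x‖) : False := by
  let _ : MeasurableSpace E := borel E
  have : BorelSpace E := ⟨rfl⟩
  let μ : Measure E := MeasureTheory.Measure.addHaar
  obtain ⟨L, hL⟩ := ContDiff.lipschitzWith_of_hasCompactSupport hc hg (by norm_num)
  obtain ⟨R, hRpos, hR⟩ : ∃ R : ℝ, 0 < R ∧ ∀ x, g x ≠ 0 → x ∈ Metric.closedBall 0 R := by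
    obtain ⟨R, hR⟩ := hc.isCompact.isBounded.subset_closedBall (0 : E)
    exact ⟨max R 1, by positivity, fun x hx => Metric.closedBall_subset_closedBall (le_max_left _ _)
      (hR (subset_tsupport g hx))⟩
  set B := Metric.closedBall (0 : E) R with hB
  have hBc : IsCompact B := isCompact_closedBall 0 R
  have hgc : Continuous g := hg.continuous
  obtain ⟨C₀, hC₀⟩ := hBc.exists_bound_of_continuousOn (f := fun x => x + g x) (by fun_prop)
  have hdc : Continuous fun x => (ContinuousLinearMap.id ℝ E + fderiv ℝ g x).det := by
    have h1 : Continuous (fderiv ℝ g) := hg.continuous_fderiv (by norm_num)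
    exact ContinuousLinearMap.continuous_det.comp (by fun_prop)
  obtain ⟨K, hK⟩ := hBc.exists_bound_of_continuousOn hdc.continuousOn
  set C := max C₀ R with hC
  have hCpos : 0 < C := lt_of_lt_of_le hRpos (le_max_right _ _)
  have h0B : (0 : E) ∈ B := by simp [hB, hRpos.le]
  have hδC : δ ≤ C := (hne 0).trans ((hC₀ 0 h0B).trans (le_max_left _ _))
  have hK0 : 0 ≤ K := (norm_nonneg _).trans (hK 0 h0B)
  set c := (C ^ 2)⁻¹ with hcdef
  have hcpos : 0 < c := by positivity
  have hcC : c * C ^ 2 = 1 := inv_mul_cancel₀ (by positivity)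
  set a := 1 - c * δ ^ 2 with ha
  set b := 1 - c * (δ / 2) ^ 2 with hb
  have ha0 : 0 ≤ a := by
    have : c * δ ^ 2 ≤ c * C ^ 2 := by gcongr
    linarith
  have hab : a < b := by
    have : 0 < c * δ ^ 2 := by positivity
    rw [ha, hb]; nlinarith
  set ρ := min (δ / 2) R with hρ
  have hρpos : 0 < ρ := lt_min (by positivity) hRpos
  set v := μ.real (Metric.closedBall (0 : E) ρ) with hv
  have hvpos : 0 < v := by
    rw [hv, Measure.real]
    exact ENNReal.toReal_pos (Metric.measure_closedBall_pos μ 0 hρpos).ne'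
      (isCompact_closedBall 0 ρ).measure_lt_top.ne
  have hsubB : Metric.closedBall (0 : E) ρ ⊆ B := Metric.closedBall_subset_closedBall (min_le_right _ _)
  have main : ∀ m : ℕ, v * b ^ m ≤ K * μ.real B * a ^ m := by
    intro m
    have hid := aux_identity μ g hg L hL R hR c m
    have hup : ∫ x in B, (ContinuousLinearMap.id ℝ E + fderiv ℝ g x).det
        * (1 - c * ‖x + g x‖ ^ 2) ^ m ∂μ ≤ K * μ.real B * a ^ m := by
      have := norm_setIntegral_le_of_norm_le_const (μ := μ) (s := B) (C := K * a ^ m)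
        (f := fun x => (ContinuousLinearMap.id ℝ E + fderiv ℝ g x).det
        * (1 - c * ‖x + g x‖ ^ 2) ^ m) hBc.measure_lt_top (by
          intro x hx
          rw [norm_mul, norm_pow]
          have h1 : ‖x + g x‖ ≤ C := (hC₀ x hx).trans (le_max_left _ _)
          have h2 : c * ‖x + g x‖ ^ 2 ≤ c * C ^ 2 := by gcongr
          have h3 : c * δ ^ 2 ≤ c * ‖x + g x‖ ^ 2 := by gcongr; exact hne x
          have h4 : ‖1 - c * ‖x + g x‖ ^ 2‖ ≤ a := by
            rw [Real.norm_of_nonneg (by linarith)]; linarith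
          have h5 := hK x hx
          gcongr)
      calc _ ≤ _ := le_trans (le_abs_self _) this
        _ = _ := by ring
    have hlow : v * b ^ m ≤ ∫ x in B, (1 - c * ‖x‖ ^ 2) ^ m ∂μ := by
      have hnn : ∀ x ∈ B, 0 ≤ (1 - c * ‖x‖ ^ 2) ^ m := by
        intro x hx
        have h1 : ‖x‖ ≤ C := (mem_closedBall_zero_iff.1 hx).trans (le_max_right _ _)
        have h2 : c * ‖x‖ ^ 2 ≤ c * C ^ 2 := by gcongr
        exact pow_nonneg (by linarith) m
      have hcont : Continuous fun x : E => (1 - c * ‖x‖ ^ 2) ^ m := by fun_prop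
      have h1 : ∫ x in Metric.closedBall (0 : E) ρ, (1 - c * ‖x‖ ^ 2) ^ m ∂μ
          ≤ ∫ x in B, (1 - c * ‖x‖ ^ 2) ^ m ∂μ := by
        apply setIntegral_mono_set (hcont.continuousOn.integrableOn_compact hBc)
        · exact (ae_restrict_iff' hBc.measurableSet).2 (Filter.Eventually.of_forall hnn)
        · exact LE.le.eventuallyLE hsubB
      have h2 : ∫ x in Metric.closedBall (0 : E) ρ, b ^ m ∂μ
          ≤ ∫ x in Metric.closedBall (0 : E) ρ, (1 - c * ‖x‖ ^ 2) ^ m ∂μ := by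
        apply setIntegral_mono_on
        · exact continuous_const.continuousOn.integrableOn_compact (isCompact_closedBall 0 ρ)
        · exact hcont.continuousOn.integrableOn_compact (isCompact_closedBall 0 ρ)
        · exact (isCompact_closedBall 0 ρ).measurableSet
        · intro x hx
          have h3 : ‖x‖ ≤ δ / 2 := (mem_closedBall_zero_iff.1 hx).trans (min_le_left _ _)
          have h4 : c * ‖x‖ ^ 2 ≤ c * (δ / 2) ^ 2 := by gcongr
          have : 0 ≤ b := by linarith
          gcongr
          linarith
      rw [setIntegral_const, smul_eq_mul] at h2
      exact h2.trans h1
    linarith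
  have hbpos : 0 < b := by linarith
  set K' := K * μ.real B + 1 with hK'
  have hK'pos : 0 < K' := by positivity
  obtain ⟨m, hm⟩ := exists_pow_lt_of_lt_one (show 0 < v / K' by positivity) ((div_lt_one hbpos).2 hab)
  rw [div_pow, div_lt_div_iff₀ (by positivity) hK'pos] at hm
  have h1 := main m
  have h2 : 0 ≤ a ^ m := pow_nonneg ha0 m
  nlinarith

theorem aux_no_retract {E : Type*} [NormedAddCommGroup E] [InnerProductSpace ℝ E]
    [FiniteDimensional ℝ E] (Φ : E → E) (hΦ : Continuous Φ) (a : E) (R : ℝ)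
    (hout : ∀ x, R < ‖x‖ → Φ x = x - a) (hne : ∀ x, Φ x ≠ 0) : False := by
  let f : E → E := fun x => Φ (x + a) - x
  have hf : Continuous f := by fun_prop
  have hfs : HasCompactSupport f := by
    refine HasCompactSupport.of_support_subset_isCompact (isCompact_closedBall (0 : E) (R + ‖a‖)) ?_
    intro x hx
    by_contra hn
    rw [mem_closedBall_zero_iff, not_le] at hn
    apply hx
    have : R < ‖x + a‖ := by
      have := norm_sub_le (x + a) a
      simp at this
      linarith
    simp [f, hout _ this]
  -- positive lower bound
  obtain ⟨δ, hδ, hδ'⟩ : ∃ δ > 0, ∀ x, δ ≤ ‖x + f x‖ := by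
    have hcont : Continuous fun x => ‖x + f x‖ := by fun_prop
    have hpos : ∀ x, 0 < ‖x + f x‖ := fun x => by simpa [f] using hne (x + a)
    obtain ⟨r, hr⟩ := hfs.isCompact.isBounded.subset_closedBall (0 : E)
    obtain ⟨x₀, -, hx₀⟩ := (isCompact_closedBall (0 : E) (max r 1)).exists_isMinOn
      ⟨0, by simp⟩ hcont.continuousOn
    refine ⟨min ‖x₀ + f x₀‖ 1, lt_min (hpos _) one_pos, fun x => ?_⟩
    by_cases hx : x ∈ Metric.closedBall (0 : E) (max r 1)
    · exact (min_le_left _ _).trans (hx₀ hx)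
    · have hfx : f x = 0 := by
        by_contra h
        exact hx (Metric.closedBall_subset_closedBall (le_max_left _ _) (hr (subset_tsupport f h)))
      rw [mem_closedBall_zero_iff, not_le] at hx
      rw [hfx, add_zero]
      exact (min_le_right _ _).trans ((le_max_right _ _).trans hx.le)
  obtain ⟨g, hg, hgf, hgs⟩ := hf.exists_contDiff_approx (ε := fun _ => δ / 2) 1 continuous_const
    (fun _ => by positivity)
  refine aux_smooth g (by simpa using hg) (hfs.mono hgs) (δ / 2) (by positivity) (fun x => ?_)
  have h1 := hgf x
  have h2 := hδ' x
  have h3 : ‖x + f x‖ ≤ ‖x + g x‖ + ‖g x - f x‖ := by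
    have := norm_sub_le (x + g x) (g x - f x)
    rwa [show x + g x - (g x - f x) = x + f x by abel] at this
  rw [dist_eq_norm] at h1
  linarith


theorem aux_cover {n : ℕ} {E : Type*} [NormedAddCommGroup E] [InnerProductSpace ℝ E]
    [FiniteDimensional ℝ E] (P : Set E) (hP : IsCompact P)
    (T : E ≃L[ℝ] (Fin n → ℝ)) (a : E) (ha : a ∈ P) (S : Fin n → Bool → Set E)
    (hS : ∀ c b, IsClosed (S c b)) (hSd : ∀ c, Disjoint (S c false) (S c true))
    (hfr : ∀ x ∈ frontier P, ∃ c b, x ∈ S c b)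
    (hm : ∀ c, ∀ x ∈ S c false, T x c < T a c)
    (hp : ∀ c, ∀ x ∈ S c true, T a c < T x c)
    (O : Fin n → Bool → Set E) (hO : ∀ c b, IsOpen (O c b))
    (hOd : ∀ c, ∀ x ∈ P, x ∈ O c false → x ∈ O c true → False)
    (hOS : ∀ c b, ∀ x ∈ P, x ∈ O c b → x ∉ S c (!b))
    (hcov : ∀ x ∈ P, ∃ c b, x ∈ O c b) : False := by
  obtain ⟨v, hv, hvc, hvO⟩ := exists_subset_iUnion_closed_subset (u := fun i : Fin n × Bool => O i.1 i.2)
    hP.isClosed (fun i => hO i.1 i.2) (fun x _ => Set.toFinite _) (by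
      intro x hx
      obtain ⟨c, b, h⟩ := hcov x hx
      exact Set.mem_iUnion.2 ⟨(c, b), h⟩)
  have hU : ∀ c, ∃ f : C(E, ℝ), Set.EqOn f 0 (S c false ∪ (v (c, false) ∩ P)) ∧
      Set.EqOn f 1 (S c true ∪ (v (c, true) ∩ P)) := by
    intro c
    obtain ⟨f, h0, h1, -⟩ := exists_continuous_zero_one_of_isClosed
      ((hS c false).union ((hvc (c, false)).inter hP.isClosed))
      ((hS c true).union ((hvc (c, true)).inter hP.isClosed)) (by
        rw [Set.disjoint_left]
        rintro x (hx | hx) (hy | hy)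
        · exact Set.disjoint_left.1 (hSd c) hx hy
        · exact hOS c true x hy.2 (hvO _ hy.1) hx
        · exact hOS c false x hx.2 (hvO _ hx.1) hy
        · exact hOd c x hx.2 (hvO _ hx.1) (hvO _ hy.1))
    exact ⟨f, h0, h1⟩
  choose φ hφ0 hφ1 using hU
  let f : E → Fin n → ℝ := fun x c => φ c x - 1 / 2
  have hf : Continuous f := by
    refine continuous_pi fun c => ?_
    exact (φ c).continuous.sub continuous_const
  have hfm : ∀ c, ∀ x ∈ S c false, f x c < 0 := by
    intro c x hx
    have := hφ0 c (Or.inl hx : x ∈ _ ∪ _)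
    simp [f, this]
  have hfp : ∀ c, ∀ x ∈ S c true, 0 < f x c := by
    intro c x hx
    have := hφ1 c (Or.inl hx : x ∈ _ ∪ _)
    simp [f, this]; norm_num
  have hfne : ∀ x ∈ P, f x ≠ 0 := by
    intro x hx h0
    obtain ⟨⟨c, b⟩, hcb⟩ := Set.mem_iUnion.1 (hv hx)
    have h1 : f x c = 0 := by rw [h0]; rfl
    cases b
    · have := hφ0 c (Or.inr ⟨hcb, hx⟩ : x ∈ _ ∪ _)
      simp [f, this] at h1
    · have := hφ1 c (Or.inr ⟨hcb, hx⟩ : x ∈ _ ∪ _)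
      simp [f, this] at h1; norm_num at h1
  -- the good set
  let G : Set E := {x | ∃ c, 0 < f x c * (T (x - a)) c}
  have hG : IsOpen G := by
    have : G = ⋃ c, {x | 0 < f x c * (T (x - a)) c} := by ext x; simp [G]
    rw [this]
    refine isOpen_iUnion fun c => ?_
    refine isOpen_lt continuous_const ?_
    have h1 : Continuous fun x => f x c := (continuous_apply c).comp hf
    have h2 : Continuous fun x => T (x - a) c :=
      (continuous_apply c).comp (T.continuous.comp (by fun_prop))
    exact h1.mul h2
  have hfrG : frontier P ⊆ G := by
    intro x hx
    obtain ⟨c, b, h⟩ := hfr x hx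
    refine ⟨c, ?_⟩
    rw [map_sub, Pi.sub_apply]
    cases b
    · exact mul_pos_of_neg_of_neg (hfm c x h) (sub_neg.2 (hm c x h))
    · exact mul_pos (hfp c x h) (sub_pos.2 (hp c x h))
  obtain ⟨R, hR⟩ := hP.isBounded.subset_ball (0 : E)
  let W : Set E := (G ∪ interior P) ∩ Metric.ball 0 R
  have hW : IsOpen W := (hG.union isOpen_interior).inter Metric.isOpen_ball
  have hPW : P ⊆ W := by
    intro x hx
    refine ⟨?_, hR hx⟩
    by_cases h : x ∈ interior P
    · exact Or.inr h
    · exact Or.inl (hfrG ⟨subset_closure hx, h⟩)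
  obtain ⟨lam, hl0, hl1, hl⟩ := exists_continuous_zero_one_of_isClosed hP.isClosed hW.isClosed_compl
    (Set.disjoint_left.2 fun x hx hx' => hx' (hPW hx))
  let Φ : E → E := fun x => (1 - lam x) • T.symm (f x) + lam x • (x - a)
  have hΦc : Continuous Φ := by
    have h1 : Continuous fun x => T.symm (f x) := T.symm.continuous.comp hf
    have h2 : Continuous fun x => lam x := lam.continuous
    fun_prop
  refine aux_no_retract Φ hΦc a R ?_ ?_
  · intro x hx
    have : x ∈ Wᶜ := by
      intro h
      have := mem_ball_zero_iff.1 h.2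
      linarith
    simp [Φ, hl1 this]
  · intro x h0
    by_cases hxP : x ∈ P
    · have h1 : T.symm (f x) = 0 := by simpa [Φ, hl0 hxP] using h0
      exact hfne x hxP (by simpa using h1)
    · by_cases hxW : x ∈ W
      · have hxG : x ∈ G := by
          rcases hxW.1 with h | h
          · exact h
          · exact absurd (interior_subset h) hxP
        obtain ⟨c, hc⟩ := hxG
        have h1 : T (Φ x) c = 0 := by rw [h0]; simp
        have h2 : T (Φ x) c = (1 - lam x) * f x c + lam x * T (x - a) c := by
          simp only [Φ, map_add, map_smul, ContinuousLinearEquiv.apply_symm_apply, Pi.add_apply,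
            Pi.smul_apply, smul_eq_mul]
        rw [h2] at h1
        obtain ⟨hl0', hl1'⟩ := hl x
        rcases pos_and_pos_or_neg_and_neg_of_mul_pos hc with ⟨hA, hB⟩ | ⟨hA, hB⟩
        · rcases lt_or_ge (lam x) 1 with h | h
          · have := mul_pos (sub_pos.2 h) hA
            have := mul_nonneg hl0' hB.le
            linarith
          · have h3 : lam x = 1 := le_antisymm hl1' h
            rw [h3] at h1; linarith
        · rcases lt_or_ge (lam x) 1 with h | h
          · have := mul_neg_of_pos_of_neg (sub_pos.2 h) hA
            have := mul_nonpos_of_nonneg_of_nonpos hl0' hB.le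
            linarith
          · have h3 : lam x = 1 := le_antisymm hl1' h
            rw [h3] at h1; linarith
      · have h1 : x - a = 0 := by simpa [Φ, hl1 hxW] using h0
        rw [sub_eq_zero] at h1
        exact hxP (h1 ▸ ha)

theorem aux_topo {n N k : ℕ} (hk : k ≤ n) {E : Type*} [NormedAddCommGroup E] [InnerProductSpace ℝ E]
    [FiniteDimensional ℝ E] (P : Set E) (hP : IsCompact P) (hconv : Convex ℝ P)
    (T : E ≃L[ℝ] (Fin n → ℝ)) (a : E) (ha : a ∈ P) (S : Fin n → Bool → Set E)
    (hS : ∀ c b, IsClosed (S c b)) (hSd : ∀ c, Disjoint (S c false) (S c true))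
    (hfr : ∀ x ∈ frontier P, ∃ c b, x ∈ S c b)
    (hm : ∀ c, ∀ x ∈ S c false, T x c < T a c)
    (hp : ∀ c, ∀ x ∈ S c true, T a c < T x c)
    (X : Fin N → Set E) (hX : ∀ i, IsClosed (X i))
    (hone : ∀ i c, ∃ b, ∀ x ∈ X i, x ∉ S c (!b))
    (hmult : ∀ p ∈ P, {i | p ∈ X i}.ncard ≤ k)
    (I : Finset (Fin n)) (hI : I.card = n - k) :
    ∃ z ∈ P \ (⋃ i, X i), ∀ ε : Fin n → Bool,
      ∃ y ∈ connectedComponentIn (P \ (⋃ i, X i)) z, ∀ c ∈ I, y ∈ S c (ε c) := by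
  classical
  by_contra hcon
  push Not at hcon
  set U := P \ (⋃ i, X i) with hU
  -- sign patterns constant on components
  have h1 : ∀ C : Set E, ∃ ε : Fin n → Bool, ∀ z ∈ U, C = connectedComponentIn U z →
      ∀ y ∈ C, ∃ c ∈ I, y ∉ S c (ε c) := by
    intro C
    by_cases h : ∃ z ∈ U, C = connectedComponentIn U z
    · obtain ⟨z, hz, rfl⟩ := h
      obtain ⟨ε, hε⟩ := hcon z hz
      exact ⟨ε, fun _ _ _ => hε⟩
    · exact ⟨fun _ => true, fun z hz hC => absurd ⟨z, hz, hC⟩ h⟩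
  choose e he using h1
  have hr : ∀ x ∈ U, ∃ r > 0, ∀ y ∈ Metric.ball x r, y ∈ P → y ∈ connectedComponentIn U x := by
    intro x hx
    have hcl : IsClosed (⋃ i, X i) := isClosed_iUnion_of_finite hX
    obtain ⟨r, hr, hr'⟩ := Metric.isOpen_iff.1 hcl.isOpen_compl x hx.2
    refine ⟨r, hr, fun y hy hyP => ?_⟩
    have hpre : IsPreconnected (Metric.ball x r ∩ P) :=
      ((convex_ball x r).inter hconv).isPreconnected
    have hx' : x ∈ Metric.ball x r ∩ P := ⟨Metric.mem_ball_self hr, hx.1⟩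
    have hsub : Metric.ball x r ∩ P ⊆ U := fun w hw => ⟨hw.2, hr' hw.1⟩
    exact hpre.subset_connectedComponentIn hx' hsub ⟨hy, hyP⟩
  have hA : ∀ c b, ∃ Q : Set E, IsOpen Q ∧ ∀ x ∈ P, x ∈ Q ↔
      (x ∈ U ∧ e (connectedComponentIn U x) c = b) := by
    intro c b
    choose! r hr hr' using hr
    refine ⟨⋃ x ∈ {x | x ∈ U ∧ e (connectedComponentIn U x) c = b}, Metric.ball x (r x),
      isOpen_biUnion fun x _ => Metric.isOpen_ball, fun y hy => ?_⟩
    constructor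
    · intro h
      simp only [Set.mem_iUnion] at h
      obtain ⟨x, hx, hyx⟩ := h
      have h2 := hr' x hx.1 y hyx hy
      refine ⟨connectedComponentIn_subset U x h2, ?_⟩
      rw [← connectedComponentIn_eq h2]
      exact hx.2
    · intro h
      simp only [Set.mem_iUnion]
      exact ⟨y, h, Metric.mem_ball_self (hr y h.1)⟩
  choose Q hQ hQ' using hA
  have hJ : (Iᶜ : Finset (Fin n)).card = k := by
    rw [Finset.card_compl, Fintype.card_fin, hI]; omega
  let eq := Finset.equivFinOfCardEq hJ
  let ord : Fin n → ℕ := fun c => if h : c ∈ Iᶜ then (eq ⟨c, h⟩ : ℕ) + 1 else 0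
  have hord : ∀ m, 1 ≤ m → m ≤ k → ∃ c ∉ I, ord c = m := by
    intro m hm1 hmk
    let c := eq.symm ⟨m - 1, by omega⟩
    refine ⟨c.1, Finset.mem_compl.1 c.2, ?_⟩
    have : ord c.1 = (eq c : ℕ) + 1 := dif_pos c.2
    rw [this]
    simp only [c, Equiv.apply_symm_apply]
    omega
  choose sgn hsgn using hone
  have hsT : ∀ (A : Finset (Fin N)) (c : Fin n), ∃ b : Bool, A.Nonempty → ∃ i ∈ A, b = sgn i c := by
    intro A c
    by_cases h : A.Nonempty
    · obtain ⟨i, hi⟩ := h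
      exact ⟨sgn i c, fun _ => ⟨i, hi, rfl⟩⟩
    · exact ⟨true, fun h' => absurd h' h⟩
  choose sT hsT using hsT
  let W : Finset (Fin N) → Set E := fun A =>
    {x | ∀ i ∈ A, ∀ j, j ∉ A → Metric.infEDist x (X i) < Metric.infEDist x (X j)}
  have hW : ∀ A, IsOpen (W A) := by
    intro A
    have : W A = ⋂ i, ⋂ j, {x | i ∈ A → j ∉ A → Metric.infEDist x (X i) < Metric.infEDist x (X j)} := by
      ext x; simp only [W, Set.mem_ofPred_eq, Set.mem_iInter]
      exact ⟨fun h i j hi hj => h i hi j hj, fun h i hi j hj => h i j hi hj⟩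
    rw [this]
    refine isOpen_iInter_of_finite fun i => isOpen_iInter_of_finite fun j => ?_
    by_cases hi : i ∈ A
    · by_cases hj : j ∈ A
      · simp [hj]
      · simp only [hi, hj, not_false_eq_true, true_imp_iff]
        exact isOpen_lt Metric.continuous_infEDist Metric.continuous_infEDist
    · simp [hi]
  have hWd : ∀ A B : Finset (Fin N), A.card = B.card → ∀ x, x ∈ W A → x ∈ W B → A = B := by
    intro A B hAB x hxA hxB
    by_contra hne
    have h1 : ¬ A ⊆ B := fun h => hne (Finset.eq_of_subset_of_card_le h hAB.ge)
    have h2 : ¬ B ⊆ A := fun h => hne (Finset.eq_of_subset_of_card_le h hAB.le).symm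
    obtain ⟨i, hiA, hiB⟩ := Finset.not_subset.1 h1
    obtain ⟨j, hjB, hjA⟩ := Finset.not_subset.1 h2
    exact lt_asymm (hxA i hiA j hjA) (hxB j hjB i hiB)
  let O : Fin n → Bool → Set E := fun c b =>
    if c ∈ I then Q c (!b) \ S c (!b)
    else ⋃ A ∈ {A : Finset (Fin N) | A.card = ord c ∧ sT A c = b}, W A \ S c (!b)
  refine aux_cover P hP T a ha S hS hSd hfr hm hp O ?_ ?_ ?_ ?_
  · intro c b
    by_cases hc : c ∈ I
    · simp only [O, hc, if_true]
      exact (hQ c _).sdiff (hS c _)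
    · simp only [O, hc, if_false]
      exact isOpen_biUnion fun A _ => (hW A).sdiff (hS c _)
  · intro c x hx h0 h1
    by_cases hc : c ∈ I
    · simp only [O, hc, if_true] at h0 h1
      have a0 := ((hQ' c _ x hx).1 h0.1).2
      have a1 := ((hQ' c _ x hx).1 h1.1).2
      rw [a0] at a1
      simp at a1
    · simp only [O, hc, if_false, Set.mem_iUnion] at h0 h1
      obtain ⟨A, hA, hxA⟩ := h0
      obtain ⟨B, hB, hxB⟩ := h1
      have hAB := hWd A B (hA.1.trans hB.1.symm) x hxA.1 hxB.1
      subst hAB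
      have := hA.2.symm.trans hB.2
      simp at this
  · intro c b x hx h0
    by_cases hc : c ∈ I
    · simp only [O, hc, if_true] at h0
      exact h0.2
    · simp only [O, hc, if_false, Set.mem_iUnion] at h0
      obtain ⟨A, hA, hxA⟩ := h0
      exact hxA.2
  · intro x hx
    by_cases hxU : x ∈ U
    · obtain ⟨c, hc, hcS⟩ := he (connectedComponentIn U x) x hxU rfl x (mem_connectedComponentIn hxU)
      refine ⟨c, !(e (connectedComponentIn U x) c), ?_⟩
      simp only [O, hc, if_true, Bool.not_not]
      exact ⟨(hQ' c _ x hx).2 ⟨hxU, rfl⟩, hcS⟩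
    · have hxX : ∃ i, x ∈ X i := by
        by_contra h
        push Not at h
        exact hxU ⟨hx, by simpa using h⟩
      let A : Finset (Fin N) := Finset.univ.filter fun i => x ∈ X i
      have hAne : A.Nonempty := by
        obtain ⟨i, hi⟩ := hxX
        exact ⟨i, by simp [A, hi]⟩
      have hAc : A.card ≤ k := by
        have := hmult x hx
        rwa [Set.ncard_eq_toFinset_card', Set.toFinset_ofPred] at this
      obtain ⟨c, hc, hcA⟩ := hord A.card hAne.card_pos hAc
      refine ⟨c, sT A c, ?_⟩
      simp only [O, hc, if_false, Set.mem_iUnion]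
      refine ⟨A, ⟨hcA.symm, rfl⟩, ?_, ?_⟩
      · intro i hi j hj
        have hxi : x ∈ X i := by simpa [A] using hi
        have hxj : x ∉ X j := by simpa [A] using hj
        rw [Metric.infEDist_zero_of_mem hxi]
        rw [pos_iff_ne_zero]
        intro h0
        exact hxj (by
          have := Metric.mem_closure_iff_infEDist_zero.2 h0
          rwa [(hX j).closure_eq] at this)
      · obtain ⟨i, hi, hi'⟩ := hsT A c hAne
        rw [hi']
        exact hsgn i c x (by simpa [A] using hi)


/-- The exposed face of `P` in direction `l`. -/
def auxFace {n : ℕ} (P : Set (EuclideanSpace ℝ (Fin n))) (l : EuclideanSpace ℝ (Fin n) →L[ℝ] ℝ) :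
    Set (EuclideanSpace ℝ (Fin n)) := {x ∈ P | ∀ y ∈ P, l y ≤ l x}

theorem aux_poly_compact {n : ℕ} {P : Set (EuclideanSpace ℝ (Fin n))} (hP : IsPolytope P) :
    IsCompact P := by
  obtain ⟨⟨S, rfl⟩, -⟩ := hP
  exact S.finite_toSet.isCompact_convexHull ℝ

theorem aux_poly_convex {n : ℕ} {P : Set (EuclideanSpace ℝ (Fin n))} (hP : IsPolytope P) :
    Convex ℝ P := by
  obtain ⟨⟨S, rfl⟩, -⟩ := hP
  exact convex_convexHull ℝ _

theorem aux_face_nonempty {n : ℕ} {P : Set (EuclideanSpace ℝ (Fin n))} (hP : IsPolytope P)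
    (l : EuclideanSpace ℝ (Fin n) →L[ℝ] ℝ) : (auxFace P l).Nonempty := by
  obtain ⟨x, hx, hm⟩ := (aux_poly_compact hP).exists_isMaxOn
    (hP.2.mono interior_subset) l.continuous.continuousOn
  exact ⟨x, hx, fun y hy => hm hy⟩

theorem aux_const_zero {n : ℕ} {P : Set (EuclideanSpace ℝ (Fin n))} (hP : (interior P).Nonempty)
    (l : EuclideanSpace ℝ (Fin n) →L[ℝ] ℝ) (c : ℝ) (hl : ∀ x ∈ P, l x ≤ c)
    (hi : ∃ x ∈ interior P, l x = c) : l = 0 := by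
  obtain ⟨x, hx, hxc⟩ := hi
  ext u
  have hc : ContinuousAt (fun t : ℝ => x + t • u) 0 := by fun_prop
  have hn : ∀ᶠ t : ℝ in nhds 0, x + t • u ∈ P := by
    apply hc
    simpa using mem_interior_iff_mem_nhds.1 hx
  obtain ⟨e, he, hb⟩ := Metric.eventually_nhds_iff.1 hn
  have h1 := hl _ (hb (y := e/2) (by simp [abs_of_pos he]; linarith))
  have h2 := hl _ (hb (y := -(e/2)) (by simp [abs_of_pos he]; linarith))
  simp only [map_add, map_smul, smul_eq_mul, hxc] at h1 h2
  simp only [zero_apply]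
  nlinarith

theorem aux_span_top {n : ℕ} {P : Set (EuclideanSpace ℝ (Fin n))} (hP : (interior P).Nonempty) :
    affineSpan ℝ P = ⊤ := by
  have := isOpen_interior.affineSpan_eq_top hP
  exact top_unique (this ▸ affineSpan_mono ℝ interior_subset)

theorem aux_facet_ne {n : ℕ} (hn : 0 < n) {P : Set (EuclideanSpace ℝ (Fin n))} (hP : IsPolytope P)
    {F} (hF : IsFacetOf P F) : ∃ l, l ≠ 0 ∧ F = auxFace P l := by
  obtain ⟨⟨l, rfl⟩, hd⟩ := hF
  refine ⟨l, ?_, rfl⟩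
  rintro rfl
  have he : {x ∈ P | ∀ y ∈ P, (0 : EuclideanSpace ℝ (Fin n) →L[ℝ] ℝ) y ≤
      (0 : EuclideanSpace ℝ (Fin n) →L[ℝ] ℝ) x} = P := by
    ext x
    exact ⟨fun hx => hx.1, fun hx => ⟨hx, fun y _ => le_refl _⟩⟩
  rw [he, faceDim, aux_span_top hP.2, AffineSubspace.direction_top, finrank_top,
    finrank_euclideanSpace, Fintype.card_fin] at hd
  omega

theorem aux_face_sub {n : ℕ} {P : Set (EuclideanSpace ℝ (Fin n))}
    (l : EuclideanSpace ℝ (Fin n) →L[ℝ] ℝ) {x y} (hx : x ∈ auxFace P l) (hy : y ∈ auxFace P l) :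
    l x = l y := le_antisymm (hy.2 x hx.1) (hx.2 y hy.1)

theorem aux_dir_le_ker {n : ℕ} {F : Set (EuclideanSpace ℝ (Fin n))}
    (l : EuclideanSpace ℝ (Fin n) →L[ℝ] ℝ) (h : ∀ x ∈ F, ∀ y ∈ F, l x = l y) :
    (affineSpan ℝ F).direction ≤ LinearMap.ker l.toLinearMap := by
  rw [direction_affineSpan, vectorSpan_def, Submodule.span_le]
  rintro _ ⟨x, hx, y, hy, rfl⟩
  simp [h x hx y hy]

theorem aux_facet_above {n : ℕ} {P : Set (EuclideanSpace ℝ (Fin n))} (hP : IsPolytope P) :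
    ∀ (m : ℕ) (l : EuclideanSpace ℝ (Fin n) →L[ℝ] ℝ), l ≠ 0 → n ≤ m + faceDim (auxFace P l) →
      ∃ F, IsFacetOf P F ∧ auxFace P l ⊆ F := by
  have hker : ∀ l : EuclideanSpace ℝ (Fin n) →L[ℝ] ℝ, l ≠ 0 →
      Module.finrank ℝ (LinearMap.ker l.toLinearMap) + 1 = n := by
    intro l hl
    have h1 : LinearMap.range l.toLinearMap = ⊤ := by
      apply LinearMap.range_eq_top.2
      exact l.toLinearMap.surjective (fun h => hl (by ext x; exact congrArg (fun f => f x) h))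
    have h2 := LinearMap.finrank_range_add_finrank_ker l.toLinearMap
    rw [h1, finrank_top, finrank_euclideanSpace, Fintype.card_fin, Module.finrank_self] at h2
    omega
  intro m
  induction m with
  | zero =>
    intro l hl h
    have h1 := Submodule.finrank_mono
      (aux_dir_le_ker (F := auxFace P l) l (fun x hx y hy => aux_face_sub l hx hy))
    have h2 := hker l hl
    simp only [faceDim] at h
    omega
  | succ m ih =>
    intro l hl h
    have hle := aux_dir_le_ker (F := auxFace P l) l (fun x hx y hy => aux_face_sub l hx hy)
    by_cases hdim : faceDim (auxFace P l) = n - 1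
    · exact ⟨auxFace P l, ⟨⟨l, rfl⟩, hdim⟩, subset_rfl⟩
    have hlt : (affineSpan ℝ (auxFace P l)).direction < LinearMap.ker l.toLinearMap := by
      refine lt_of_le_of_ne hle fun he => hdim ?_
      have h2 := hker l hl
      rw [faceDim, he]; omega
    obtain ⟨w, hw, hwD⟩ := SetLike.exists_of_lt hlt
    obtain ⟨f, hfw, hfD⟩ := Submodule.exists_le_ker_of_notMem hwD
    obtain ⟨x0, hx0⟩ := aux_face_nonempty hP l
    obtain ⟨S, hS⟩ := hP.1
    have hSP : ∀ s ∈ S, s ∈ P := fun s hs => by rw [hS]; exact subset_convexHull ℝ _ hs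
    have hbd : ∀ (g : EuclideanSpace ℝ (Fin n) →L[ℝ] ℝ) (c : ℝ), (∀ s ∈ S, g s ≤ c) →
        ∀ x ∈ P, g x ≤ c := by
      intro g c hg x hx
      rw [hS] at hx
      exact convexHull_min (fun s hs => hg s hs)
        (convex_halfSpace_le g.toLinearMap.isLinear c) hx
    -- choose the sign
    have hsg : ∃ l' : EuclideanSpace ℝ (Fin n) →L[ℝ] ℝ, l' w ≠ 0 ∧
        (affineSpan ℝ (auxFace P l)).direction ≤ LinearMap.ker l'.toLinearMap ∧
        ∃ s ∈ S, l' x0 < l' s := by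
      by_contra hno
      push Not at hno
      let g := LinearMap.toContinuousLinearMap f
      have hg1 := hno g hfw hfD
      have hg2 := hno (-g) (by simpa [g] using hfw) (by
        intro z hz
        have := hfD hz
        simp only [LinearMap.mem_ker] at this
        simp [g, this])
      have h1 := hbd g _ hg1
      have h2 := hbd (-g) _ hg2
      obtain ⟨p, hp⟩ := hP.2
      have hg0 := aux_const_zero hP.2 g (g x0) h1 ⟨p, hp, le_antisymm (h1 p (interior_subset hp)) (by
        have := h2 p (interior_subset hp)
        simpa using this)⟩
      exact hfw (by simpa [g] using congrArg (fun q => q w) hg0)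
    obtain ⟨l', hl'w, hl'D, s0, hs0, hs0l⟩ := hsg
    have hdir : ∀ x ∈ auxFace P l, l' x = l' x0 := by
      intro x hx
      have h1 : x -ᵥ x0 ∈ (affineSpan ℝ (auxFace P l)).direction := by
        rw [direction_affineSpan]; exact vsub_mem_vectorSpan ℝ hx hx0
      have := hl'D h1
      simp only [LinearMap.mem_ker, vsub_eq_sub, ContinuousLinearMap.coe_coe, map_sub] at this
      linarith
    obtain ⟨s1, hs1, hmin⟩ := Finset.exists_min_image (S.filter fun s => l' x0 < l' s)
      (fun s => (l x0 - l s) / (l' s - l' x0)) ⟨s0, by simp [hs0, hs0l]⟩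
    simp only [Finset.mem_filter] at hs1 hmin
    set t := (l x0 - l s1) / (l' s1 - l' x0) with ht
    have hslack : l s1 < l x0 := by
      refine lt_of_le_of_ne (hx0.2 s1 (hSP s1 hs1.1)) fun he => ?_
      have : s1 ∈ auxFace P l := ⟨hSP s1 hs1.1, fun y hy => he ▸ hx0.2 y hy⟩
      have := hdir s1 this
      linarith [hs1.2]
    have htpos : 0 < t := div_pos (by linarith) (by linarith [hs1.2])
    have hteq : t * (l' s1 - l' x0) = l x0 - l s1 := by
      rw [ht]; field_simp [(by linarith [hs1.2] : l' s1 - l' x0 ≠ 0)]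
    let L := l + t • l'
    have hL : ∀ x, L x = l x + t * l' x := fun x => by simp [L]
    have hLP : ∀ x ∈ P, L x ≤ L x0 := by
      apply hbd
      intro s hs
      rw [hL, hL]
      have hl0 := hx0.2 s (hSP s hs)
      by_cases hm : l' x0 < l' s
      · have := hmin s ⟨hs, hm⟩
        rw [le_div_iff₀ (by linarith)] at this
        linarith
      · nlinarith
    have hsub : auxFace P l ⊆ auxFace P L := by
      intro x hx
      refine ⟨hx.1, fun y hy => ?_⟩
      have := hLP y hy
      rw [hL x, hdir x hx, aux_face_sub l hx hx0, ← hL]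
      exact this
    have hs1L : s1 ∈ auxFace P L := by
      refine ⟨hSP s1 hs1.1, fun y hy => (hLP y hy).trans (le_of_eq ?_)⟩
      rw [hL, hL]; linarith
    have hL0 : L ≠ 0 := by
      intro h0
      have : L w = 0 := by rw [h0]; rfl
      rw [hL] at this
      simp only [LinearMap.mem_ker, ContinuousLinearMap.coe_coe] at hw
      rw [hw, zero_add] at this
      exact (mul_ne_zero htpos.ne' hl'w) this
    have hDlt : (affineSpan ℝ (auxFace P l)).direction < (affineSpan ℝ (auxFace P L)).direction := by
      refine lt_of_le_of_ne (AffineSubspace.direction_le (affineSpan_mono ℝ hsub)) fun he => ?_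
      have h1 : s1 -ᵥ x0 ∈ (affineSpan ℝ (auxFace P L)).direction := by
        rw [direction_affineSpan]; exact vsub_mem_vectorSpan ℝ hs1L (hsub hx0)
      rw [← he] at h1
      have := hl'D h1
      simp only [LinearMap.mem_ker, vsub_eq_sub, ContinuousLinearMap.coe_coe, map_sub] at this
      linarith [hs1.2]
    have hfl := Submodule.finrank_lt_finrank_of_lt hDlt
    obtain ⟨F, hF, hFs⟩ := ih L hL0 (by simp only [faceDim] at h ⊢; omega)
    exact ⟨F, hF, hsub.trans hFs⟩

theorem aux_frontier_facet {n : ℕ} {P : Set (EuclideanSpace ℝ (Fin n))} (hP : IsPolytope P)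
    {x} (hx : x ∈ frontier P) : ∃ F, IsFacetOf P F ∧ x ∈ F := by
  have hc := aux_poly_convex hP
  have hcl := (aux_poly_compact hP).isClosed
  have hxP : x ∈ P := hcl.frontier_subset hx
  obtain ⟨l, hl⟩ := geometric_hahn_banach_open_point hc.interior isOpen_interior hx.2
  have hlP : ∀ y ∈ P, l y ≤ l x := by
    intro y hy
    have : y ∈ closure (interior P) := by
      rw [hc.closure_interior_eq_closure_of_nonempty_interior hP.2]; exact subset_closure hy
    exact closure_minimal (t := {z | l z ≤ l x}) (fun z hz => (hl z hz).le)
      (isClosed_le l.continuous continuous_const) this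
  have hl0 : l ≠ 0 := by
    rintro rfl
    obtain ⟨p, hp⟩ := hP.2
    simpa using hl p hp
  obtain ⟨F, hF, hs⟩ := aux_facet_above hP n l hl0 (by omega)
  exact ⟨F, hF, hs ⟨hxP, hlP⟩⟩

theorem aux_hrep {n : ℕ} {P : Set (EuclideanSpace ℝ (Fin n))} (hP : IsPolytope P)
    {x} (hx : x ∉ P) : ∃ F, IsFacetOf P F ∧
      ∀ l, l ≠ 0 → F = auxFace P l → ∀ p ∈ F, l p < l x := by
  have hcl := (aux_poly_compact hP).isClosed
  obtain ⟨y, hy⟩ := hP.2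
  have hex : ∃ z ∈ segment ℝ y x, z ∈ frontier P := by
    by_contra hno
    push Not at hno
    have hpre := (convex_segment y x : Convex ℝ (segment ℝ y x)).isPreconnected
    obtain ⟨z, hz, hz1, hz2⟩ := hpre (interior P) Pᶜ isOpen_interior hcl.isOpen_compl
      (by
        intro z hz
        by_cases hzP : z ∈ P
        · left
          by_contra hzi
          exact hno z hz ⟨subset_closure hzP, hzi⟩
        · right; exact hzP)
      ⟨y, left_mem_segment ℝ y x, hy⟩ ⟨x, right_mem_segment ℝ y x, hx⟩
    exact hz2 (interior_subset hz1)
  obtain ⟨z, hz, hzf⟩ := hex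
  obtain ⟨F, hF, hzF⟩ := aux_frontier_facet hP hzf
  refine ⟨F, hF, ?_⟩
  rintro l hl rfl p hp
  have hpz := aux_face_sub l hp hzF
  have hly : l y < l z := by
    refine lt_of_le_of_ne (hzF.2 y (interior_subset hy)) fun he => hl ?_
    exact aux_const_zero hP.2 l (l z) hzF.2 ⟨y, hy, he⟩
  obtain ⟨a, b, ha, hb, hab, rfl⟩ := hz
  simp only [map_add, map_smul, smul_eq_mul] at hly hpz
  rw [hpz]
  have hb1 : b ≠ 0 := by
    rintro rfl
    have : a = 1 := by linarith
    subst this; simp at hly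
  have hb0 : 0 < b := lt_of_le_of_ne hb hb1.symm
  have ha' : a = 1 - b := by linarith
  subst ha'
  have h1 : l y < l x := by
    by_contra hcon
    push Not at hcon
    nlinarith
  by_contra hcon
  push Not at hcon
  have hzx : (1 - b) = 0 := by nlinarith
  have : b = 1 := by linarith
  subst this
  have : x ∈ frontier P := by simpa using hzf
  exact hx (hcl.frontier_subset this)

theorem aux_face_hull {n : ℕ} {P : Set (EuclideanSpace ℝ (Fin n))}
    {S : Finset (EuclideanSpace ℝ (Fin n))}
    (hS : P = convexHull ℝ (S : Set (EuclideanSpace ℝ (Fin n))))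
    (f : EuclideanSpace ℝ (Fin n) →L[ℝ] ℝ) {x} (hx : x ∈ auxFace P f) :
    x ∈ convexHull ℝ {s | s ∈ S ∧ s ∈ auxFace P f} := by
  have hSP : ∀ s ∈ S, s ∈ P := fun s hs => by rw [hS]; exact subset_convexHull ℝ _ hs
  have hxP := hx.1
  rw [hS, Finset.mem_convexHull'] at hxP
  obtain ⟨w, hw0, hw1, hwx⟩ := hxP
  have hz : ∑ s ∈ S, w s * (f x - f s) = 0 := by
    have h1 : f x = ∑ s ∈ S, w s * f s := by
      conv_lhs => rw [← hwx]
      simp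
    simp only [mul_sub, Finset.sum_sub_distrib, ← Finset.sum_mul, hw1, one_mul]
    rw [h1]; ring
  rw [Finset.sum_eq_zero_iff_of_nonneg (fun s hs =>
    mul_nonneg (hw0 s hs) (sub_nonneg.2 (hx.2 s (hSP s hs))))] at hz
  have hmem : ∀ s ∈ S, w s ≠ 0 → s ∈ auxFace P f := by
    intro s hs hws
    have h1 := (mul_eq_zero.1 (hz s hs)).resolve_left hws
    refine ⟨hSP s hs, fun y hy => ?_⟩
    have := hx.2 y hy
    linarith
  classical
  have e1 : ∑ s ∈ S.filter (fun s => w s ≠ 0), w s = 1 := by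
    rw [Finset.sum_filter_ne_zero, hw1]
  have e2 : ∑ s ∈ S.filter (fun s => w s ≠ 0), w s • s = x := by
    rw [Finset.sum_filter_of_ne, hwx]
    intro s _ hne h0
    exact hne (by rw [h0, zero_smul])
  rw [← e2]
  apply (convex_convexHull ℝ _).sum_mem
  · intro s hs; exact hw0 s (Finset.mem_filter.1 hs).1
  · exact e1
  · intro s hs
    have := Finset.mem_filter.1 hs
    exact subset_convexHull ℝ _ ⟨this.1, hmem s this.1 this.2⟩

theorem aux_faces_finite {n : ℕ} {P : Set (EuclideanSpace ℝ (Fin n))} (hP : IsPolytope P) :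
    {F | IsFaceOf P F}.Finite := by
  classical
  obtain ⟨S, hS⟩ := hP.1
  apply Set.Finite.of_finite_image (f := fun F => S.filter (fun s => s ∈ F))
  · exact (S.powerset.finite_toSet).subset (by
      rintro _ ⟨F, -, rfl⟩
      exact Finset.mem_coe.2 (Finset.mem_powerset.2 (Finset.filter_subset _ _)))
  have key : ∀ l l' : EuclideanSpace ℝ (Fin n) →L[ℝ] ℝ,
      S.filter (fun s => s ∈ auxFace P l) = S.filter (fun s => s ∈ auxFace P l') →
      auxFace P l ⊆ auxFace P l' := by
    intro l l' h x hx
    obtain ⟨q, hq⟩ := aux_face_nonempty hP l'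
    have h1 := aux_face_hull hS l hx
    have h2 : l' q ≤ l' x := by
      refine convexHull_min (t := {z | l' q ≤ l' z}) ?_
        (convex_halfSpace_ge l'.toLinearMap.isLinear _) h1
      rintro s ⟨hs, hs2⟩
      have : s ∈ S.filter (fun s => s ∈ auxFace P l') := by
        rw [← h]; simp [hs, hs2]
      exact (Finset.mem_filter.1 this).2.2 q hq.1
    exact ⟨hx.1, fun y hy => (hq.2 y hy).trans h2⟩
  rintro _ ⟨l, rfl⟩ _ ⟨l', rfl⟩ h
  exact (key l l' h).antisymm (key l' l h.symm)

theorem aux_face_vertex {n : ℕ} {P : Set (EuclideanSpace ℝ (Fin n))} (hP : IsPolytope P)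
    {K} (hK : IsFaceOf P K) : ∃ v ∈ K, IsVertexOf P v := by
  obtain ⟨l, rfl⟩ := hK
  have hexp : IsExposed ℝ P (auxFace P l) := fun _ => ⟨l, rfl⟩
  have hKc : IsCompact (auxFace P l) := hexp.isCompact (aux_poly_compact hP)
  obtain ⟨v, hv⟩ := hKc.extremePoints_nonempty (aux_face_nonempty hP l)
  have hvP := hexp.isExtreme.extremePoints_subset_extremePoints hv
  refine ⟨v, hv.1, ?_⟩
  obtain ⟨S, hS⟩ := hP.1
  have hvS : v ∈ S := by
    rw [hS] at hvP
    exact extremePoints_convexHull_subset hvP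
  have hSP : ∀ s ∈ S, s ∈ P := fun s hs => by rw [hS]; exact subset_convexHull ℝ _ hs
  rw [(aux_poly_convex hP).mem_extremePoints_iff_mem_sdiff_convexHull_sdiff] at hvP
  have hfin : ((S : Set (EuclideanSpace ℝ (Fin n))) \ {v}).Finite :=
    S.finite_toSet.subset sdiff_subset
  have hvn : v ∉ convexHull ℝ ((S : Set (EuclideanSpace ℝ (Fin n))) \ {v}) := fun h =>
    hvP.2 (convexHull_mono (sdiff_subset_sdiff_left (fun s hs => hSP s hs)) h)
  obtain ⟨f, u, hf1, hf2⟩ := geometric_hahn_banach_closed_point (convex_convexHull ℝ _)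
    (hfin.isCompact_convexHull ℝ).isClosed hvn
  have hlt : ∀ s ∈ S, s ≠ v → f s < f v := fun s hs hne =>
    (hf1 s (subset_convexHull ℝ _ ⟨hs, hne⟩)).trans hf2
  have hvf : v ∈ auxFace P f := by
    refine ⟨hvP.1, fun y hy => ?_⟩
    rw [hS] at hy
    refine convexHull_min (t := {z | f z ≤ f v}) ?_
        (convex_halfSpace_le f.toLinearMap.isLinear _) hy
    intro s hs
    by_cases h : s = v
    · subst h; exact le_refl (f s)
    · exact (hlt s hs h).le
  refine ⟨f, Subset.antisymm (singleton_subset_iff.2 hvf) fun x hx => ?_⟩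
  have h1 := aux_face_hull hS f hx
  have h2 : {s | s ∈ S ∧ s ∈ auxFace P f} ⊆ {v} := by
    rintro s ⟨hs, hsf⟩
    by_contra hne
    exact absurd (aux_face_sub f hsf hvf) (hlt s hs hne).ne
  have := convexHull_mono h2 h1
  rwa [convexHull_singleton] at this

theorem aux_cone {n : ℕ} (hn : 0 < n) {P : Set (EuclideanSpace ℝ (Fin n))} (hP : IsPolytope P)
    {v u : EuclideanSpace ℝ (Fin n)} (hv : v ∈ P)
    (hu : ∀ F, IsFacetOf P F → v ∈ F → ∃ l, l ≠ 0 ∧ F = auxFace P l ∧ l u ≤ 0) :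
    ∃ t > 0, ∀ s : ℝ, 0 ≤ s → s ≤ t → v + s • u ∈ P := by
  have hfin : {F | IsFacetOf P F}.Finite := (aux_faces_finite hP).subset fun F hF => hF.1
  have hev : ∀ᶠ s : ℝ in nhds 0, ∀ F ∈ {F | IsFacetOf P F}, v ∉ F →
      ∃ l, l ≠ 0 ∧ F = auxFace P l ∧ ∃ p ∈ F, l (v + s • u) < l p := by
    rw [Filter.eventually_all_finite hfin]
    intro F hF
    by_cases hvF : v ∈ F
    · exact Filter.Eventually.of_forall fun s h => absurd hvF h
    obtain ⟨l, hl0, hl⟩ := aux_facet_ne hn hP hF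
    obtain ⟨p, hp⟩ := aux_face_nonempty hP l
    have hlt : l v < l p := by
      by_contra hcon
      push Not at hcon
      exact hvF (hl ▸ ⟨hv, fun y hy => (hp.2 y hy).trans hcon⟩)
    have hc : ContinuousAt (fun s : ℝ => l (v + s • u)) 0 := by fun_prop
    have : ∀ᶠ s : ℝ in nhds 0, l (v + s • u) < l p :=
      hc.eventually_lt continuousAt_const (by simpa using hlt)
    filter_upwards [this] with s hs _
    exact ⟨l, hl0, hl, p, hl ▸ hp, hs⟩
  obtain ⟨e, he, hb⟩ := Metric.eventually_nhds_iff.1 hev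
  refine ⟨e / 2, by positivity, fun s hs0 hs => ?_⟩
  by_contra hout
  obtain ⟨F, hF, hFl⟩ := aux_hrep hP hout
  by_cases hvF : v ∈ F
  · obtain ⟨l, hl0, hl, hlu⟩ := hu F hF hvF
    have := hFl l hl0 hl v hvF
    simp only [map_add, map_smul, smul_eq_mul] at this
    nlinarith
  · obtain ⟨l, hl0, hl, p, hp, hlt⟩ := hb (y := s) (by
      rw [Real.dist_eq, sub_zero, abs_of_nonneg hs0]; linarith) F hF hvF
    exact absurd (hFl l hl0 hl p hp) (not_lt.2 hlt.le)

/-- Local structure of a simple colored polytope at a vertex. -/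
structure AuxVS {n : ℕ} (P : Set (EuclideanSpace ℝ (Fin n)))
    (h : Set (EuclideanSpace ℝ (Fin n)) → Fin n) (v : EuclideanSpace ℝ (Fin n))
    (F : Fin n → Set (EuclideanSpace ℝ (Fin n)))
    (l : Fin n → EuclideanSpace ℝ (Fin n) →L[ℝ] ℝ)
    (T : EuclideanSpace ℝ (Fin n) ≃L[ℝ] (Fin n → ℝ)) : Prop where
  facet : ∀ c, IsFacetOf P (F c)
  mem : ∀ c, v ∈ F c
  col : ∀ c, h (F c) = c
  ne : ∀ c, l c ≠ 0
  exp : ∀ c, F c = auxFace P (l c)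
  coord : ∀ x c, T x c = - l c x
  all : ∀ G, IsFacetOf P G → v ∈ G → G = F (h G)

theorem aux_vertex_struct {n : ℕ} (hn : 0 < n) {P : Set (EuclideanSpace ℝ (Fin n))}
    (hP : IsSimplePolytope P) {h : Set (EuclideanSpace ℝ (Fin n)) → Fin n}
    (hcol : IsProperColoring P h) {v} (hv : IsVertexOf P v) : ∃ F l T, AuxVS P h v F l T := by
  have hinj : InjOn h {F | IsFacetOf P F ∧ v ∈ F} := by
    rintro F ⟨hF, hvF⟩ G ⟨hG, hvG⟩ hFG
    by_contra hne
    exact hcol F G hF hG hne ⟨v, hvF, hvG⟩ hFG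
  have himg : h '' {F | IsFacetOf P F ∧ v ∈ F} = univ := by
    apply Set.eq_of_subset_of_ncard_le (subset_univ _)
    rw [hinj.ncard_image, hP.2 v hv]
    simp [Set.ncard_univ]
  have hex : ∀ c, ∃ F, (IsFacetOf P F ∧ v ∈ F) ∧ h F = c := fun c => by
    have : c ∈ h '' {F | IsFacetOf P F ∧ v ∈ F} := himg ▸ mem_univ c
    exact this
  choose F hF hFc using hex
  choose l hl0 hl using fun c => aux_facet_ne hn hP.1 (hF c).1
  have hall : ∀ G, IsFacetOf P G → v ∈ G → G = F (h G) := fun G hG hvG =>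
    hinj ⟨hG, hvG⟩ (hF (h G)) (hFc (h G)).symm
  let T0 : EuclideanSpace ℝ (Fin n) →ₗ[ℝ] (Fin n → ℝ) :=
    LinearMap.pi fun c => -(l c).toLinearMap
  have hT0 : ∀ x c, T0 x c = - l c x := fun x c => by simp [T0]
  have hTinj : Function.Injective T0 := by
    rw [← LinearMap.ker_eq_bot, LinearMap.ker_eq_bot']
    intro u hu
    have hlu : ∀ c, l c u = 0 := fun c => by
      have := hT0 u c
      rw [hu] at this
      simpa using this.symm
    obtain ⟨f, hf⟩ := hv
    have hvf : v ∈ auxFace P f := by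
      have : v ∈ ({v} : Set _) := rfl
      rw [hf] at this
      exact this
    obtain ⟨t, ht, h1⟩ := aux_cone hn hP.1 (u := u) hvf.1 fun G hG hvG =>
      ⟨l (h G), hl0 _, (hall G hG hvG).trans (hl _), by rw [hlu]⟩
    obtain ⟨t', ht', h2⟩ := aux_cone hn hP.1 (u := -u) hvf.1 fun G hG hvG =>
      ⟨l (h G), hl0 _, (hall G hG hvG).trans (hl _), by rw [map_neg, hlu, neg_zero]⟩
    have h1 := h1 t ht.le le_rfl
    have h2 := h2 t' ht'.le le_rfl
    have e1 := hvf.2 _ h1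
    have e2 := hvf.2 _ h2
    simp only [map_add, map_smul, smul_eq_mul, map_neg] at e1 e2
    have hfu : f u = 0 := by nlinarith
    have hm : v + t • u ∈ ({v} : Set (EuclideanSpace ℝ (Fin n))) := by
      rw [hf]
      refine ⟨h1, fun y hy => ?_⟩
      simpa [hfu] using hvf.2 y hy
    have : t • u = 0 := by simpa using hm
    exact (smul_eq_zero.1 this).resolve_left ht.ne'
  let T := (LinearMap.linearEquivOfInjective T0 hTinj (by simp)).toContinuousLinearEquiv
  exact ⟨F, l, T, fun c => (hF c).1, fun c => (hF c).2, hFc, hl0, hl, fun x c => hT0 x c, hall⟩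

theorem AuxVS.memP {n : ℕ} (hn : 0 < n) {P : Set (EuclideanSpace ℝ (Fin n))}
    {h : Set (EuclideanSpace ℝ (Fin n)) → Fin n} {v F l T} (hs : AuxVS P h v F l T) : v ∈ P := by
  have := hs.mem ⟨0, hn⟩
  rw [hs.exp] at this
  exact this.1

theorem AuxVS.dir {n : ℕ} (hn : 0 < n) {P : Set (EuclideanSpace ℝ (Fin n))} (hP : IsPolytope P)
    {h : Set (EuclideanSpace ℝ (Fin n)) → Fin n} {v F l T} (hs : AuxVS P h v F l T)
    (w : Fin n → ℝ) (hw : ∀ c, 0 ≤ w c) :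
    ∃ t > 0, ∀ s : ℝ, 0 ≤ s → s ≤ t → v + s • T.symm w ∈ P := by
  apply aux_cone hn hP (hs.memP hn)
  intro G hG hvG
  refine ⟨l (h G), hs.ne _, (hs.all G hG hvG).trans (hs.exp _), ?_⟩
  have := hs.coord (T.symm w) (h G)
  rw [T.apply_symm_apply] at this
  linarith [hw (h G)]

theorem AuxVS.face {n : ℕ} (hn : 0 < n) {P : Set (EuclideanSpace ℝ (Fin n))} (hP : IsPolytope P)
    {h : Set (EuclideanSpace ℝ (Fin n)) → Fin n} {v F l T} (hs : AuxVS P h v F l T)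
    (I : Finset (Fin n)) :
    faceDim {x ∈ P | ∀ c ∈ I, x ∈ F c} = n - I.card ∧
    {c | ∃ G, IsFacetOf P G ∧ {x ∈ P | ∀ c ∈ I, x ∈ F c} ⊆ G ∧ h G = c} = (I : Set (Fin n)) := by
  classical
  set K := {x ∈ P | ∀ c ∈ I, x ∈ F c} with hKdef
  have hvP := hs.memP hn
  have hvK : v ∈ K := ⟨hvP, fun c _ => hs.mem c⟩
  have hmemF : ∀ x ∈ P, ∀ c, x ∈ F c ↔ l c x = l c v := by
    intro x hx c
    have hv := hs.mem c
    rw [hs.exp] at hv ⊢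
    exact ⟨fun hxc => aux_face_sub _ hxc hv, fun he => ⟨hx, fun y hy => he ▸ hv.2 y hy⟩⟩
  let e : Fin n → EuclideanSpace ℝ (Fin n) := fun c => T.symm (Pi.single c 1)
  have hle : ∀ c c', l c' (e c) = if c' = c then -1 else 0 := by
    intro c c'
    have := hs.coord (e c) c'
    simp only [e, T.apply_symm_apply, Pi.single_apply] at this
    split_ifs at this ⊢ <;> simp only [e] <;> linarith
  have hstep : ∀ c ∉ I, ∃ t : ℝ, t > 0 ∧ v + t • e c ∈ K := by
    intro c hc
    obtain ⟨t, ht, hm⟩ := hs.dir hn hP (Pi.single c 1) (fun c' => by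
      rw [Pi.single_apply]; split_ifs <;> norm_num)
    have hm := hm t ht.le le_rfl
    refine ⟨t, ht, hm, fun c' hc' => ?_⟩
    rw [hmemF _ hm]
    have hne : c' ≠ c := fun h => hc (h ▸ hc')
    change l c' (v + t • e c) = _
    rw [map_add, map_smul, hle, if_neg hne]; simp
  constructor
  · have hspan : (affineSpan ℝ K).direction =
        Submodule.span ℝ (Set.range fun c : {c // c ∉ I} => e c) := by
      rw [direction_affineSpan]
      apply le_antisymm
      · rw [vectorSpan_def, Submodule.span_le]
        rintro _ ⟨x, hx, y, hy, rfl⟩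
        have hz : ∀ c ∈ I, T (x - y) c = 0 := by
          intro c hc
          rw [hs.coord, map_sub, (hmemF x hx.1 c).1 (hx.2 c hc), (hmemF y hy.1 c).1 (hy.2 c hc)]
          simp
        have hdec : x - y = ∑ c, T (x - y) c • e c := by
          apply T.injective
          rw [map_sum]
          ext c'
          simp [e, Pi.single_apply]
        simp only [vsub_eq_sub, SetLike.mem_coe]
        rw [hdec]
        refine Submodule.sum_mem _ fun c _ => ?_
        by_cases hc : c ∈ I
        · rw [hz c hc, zero_smul]; exact Submodule.zero_mem _
        · exact Submodule.smul_mem _ _ (Submodule.subset_span ⟨⟨c, hc⟩, rfl⟩)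
      · rw [Submodule.span_le]
        rintro _ ⟨⟨c, hc⟩, rfl⟩
        obtain ⟨t, ht, hm⟩ := hstep c hc
        have h1 := vsub_mem_vectorSpan ℝ hm hvK
        have h2 := Submodule.smul_mem _ t⁻¹ h1
        simpa [smul_smul, inv_mul_cancel₀ ht.ne'] using h2
    rw [faceDim, hspan, finrank_span_eq_card]
    · rw [Fintype.card_subtype_compl]; simp
    · have hb := ((Pi.basisFun ℝ (Fin n)).map T.symm.toLinearEquiv).linearIndependent
      have := hb.comp (fun c : {c // c ∉ I} => (c : Fin n)) Subtype.val_injective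
      convert this using 1
      ext c : 1
      simp [e]
  · ext c
    simp only [Finset.mem_coe]
    constructor
    · rintro ⟨G, hG, hKG, rfl⟩
      by_contra hc
      obtain ⟨t, ht, hm⟩ := hstep _ hc
      have h1 : v + t • e (h G) ∈ F (h G) := hs.all G hG (hKG hvK) ▸ hKG hm
      rw [hmemF _ hm.1, map_add, map_smul, hle, if_pos rfl] at h1
      simp at h1
      linarith
    · intro hc
      exact ⟨F c, hs.facet c, fun x hx => hx.2 c hc, hs.col c⟩

/-- Intersections of facets are faces. -/
theorem aux_inter_face {n : ℕ} (hn : 0 < n) {P : Set (EuclideanSpace ℝ (Fin n))}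
    (hP : IsPolytope P) (I : Finset (Fin n)) (G : Fin n → Set (EuclideanSpace ℝ (Fin n)))
    (hG : ∀ c ∈ I, IsFacetOf P (G c)) (hne : {x ∈ P | ∀ c ∈ I, x ∈ G c}.Nonempty) :
    IsFaceOf P {x ∈ P | ∀ c ∈ I, x ∈ G c} := by
  obtain ⟨v, hvP, hv⟩ := hne
  have : ∀ c, ∃ l, c ∈ I → G c = auxFace P l := fun c => by
    by_cases hc : c ∈ I
    · obtain ⟨l, -, hl⟩ := aux_facet_ne hn hP (hG c hc)
      exact ⟨l, fun _ => hl⟩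
    · exact ⟨0, fun h => absurd h hc⟩
  choose l hl using this
  have hle : ∀ c ∈ I, ∀ x ∈ P, l c x ≤ l c v := fun c hc x hx => by
    have := hv c hc
    rw [hl c hc] at this
    exact this.2 x hx
  refine ⟨∑ c ∈ I, l c, ?_⟩
  ext x
  constructor
  · rintro ⟨hx, hxG⟩
    refine ⟨hx, fun y hy => ?_⟩
    simp only [sum_apply]
    refine Finset.sum_le_sum fun c hc => ?_
    have := hxG c hc
    rw [hl c hc] at this
    exact this.2 y hy
  · rintro ⟨hx, hmax⟩
    refine ⟨hx, fun c hc => ?_⟩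
    have h1 := hmax v hvP
    simp only [sum_apply] at h1
    have h2 := (Finset.sum_eq_sum_iff_of_le (fun c hc => hle c hc x hx)).1
      (le_antisymm (Finset.sum_le_sum fun c hc => hle c hc x hx) h1) c hc
    rw [hl c hc]
    exact ⟨hx, fun y hy => h2 ▸ hle c hc y hy⟩

theorem aux_inter_props {n : ℕ} (hn : 0 < n) {P : Set (EuclideanSpace ℝ (Fin n))}
    (hP : IsSimplePolytope P) {h : Set (EuclideanSpace ℝ (Fin n)) → Fin n}
    (hcol : IsProperColoring P h) (I : Finset (Fin n))
    (G : Fin n → Set (EuclideanSpace ℝ (Fin n)))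
    (hG : ∀ c ∈ I, IsFacetOf P (G c)) (hGc : ∀ c ∈ I, h (G c) = c)
    (hne : {x ∈ P | ∀ c ∈ I, x ∈ G c}.Nonempty) :
    IsFaceOf P {x ∈ P | ∀ c ∈ I, x ∈ G c} ∧
    faceDim {x ∈ P | ∀ c ∈ I, x ∈ G c} = n - I.card ∧
    {c | ∃ F, IsFacetOf P F ∧ {x ∈ P | ∀ c ∈ I, x ∈ G c} ⊆ F ∧ h F = c} = (I : Set (Fin n)) := by
  have hface := aux_inter_face hn hP.1 I G hG hne
  refine ⟨hface, ?_⟩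
  obtain ⟨v, hvK, hv⟩ := aux_face_vertex hP.1 hface
  obtain ⟨F, l, T, hs⟩ := aux_vertex_struct hn hP hcol hv
  have he : {x ∈ P | ∀ c ∈ I, x ∈ G c} = {x ∈ P | ∀ c ∈ I, x ∈ F c} := by
    have : ∀ c ∈ I, G c = F c := fun c hc => by
      have := hs.all (G c) (hG c hc) (hvK.2 c hc)
      rwa [hGc c hc] at this
    ext x
    exact ⟨fun hx => ⟨hx.1, fun c hc => this c hc ▸ hx.2 c hc⟩,
      fun hx => ⟨hx.1, fun c hc => (this c hc).symm ▸ hx.2 c hc⟩⟩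
  rw [he]
  exact hs.face hn hP.1 I

/-- **Quantitative colorful Lebesgue theorem.** Let `P ⊆ ℝ^n` be a full-dimensional
simple polytope with a proper coloring `h` of its facets by `n` colors and let `V` be
a vertex of `P`. Let `X 1, …, X N` be closed subsets of `P`, each intersecting at most
one facet of each color class, with covering multiplicity at most `k ≤ n`. Then the
complement of their union has a connected component `Z` (the component of some point
`z`) such that: for some set `I` of `n - k` colors there are at least `2 ^ (n - k)`
distinct `k`-dimensional faces of `P`, all in the `I`-color class, each meeting `Z`;
moreover `V` lies in one of these `k`-faces. -/
theorem quantitative_colorful_lebesgue {n N k : ℕ} (hk : k ≤ n)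
    (P : Set (EuclideanSpace ℝ (Fin n)))
    (hP : IsSimplePolytope P)
    (h : Set (EuclideanSpace ℝ (Fin n)) → Fin n)
    (hcol : IsProperColoring P h)
    (V : EuclideanSpace ℝ (Fin n)) (hV : IsVertexOf P V)
    (X : Fin N → Set (EuclideanSpace ℝ (Fin n)))
    (hclosed : ∀ i, IsClosed (X i))
    (hsub : ∀ i, X i ⊆ P)
    (hone : ∀ (i : Fin N) (c : Fin n),
      {F | IsFacetOf P F ∧ h F = c ∧ (X i ∩ F).Nonempty}.Subsingleton)
    (hmult : ∀ p ∈ P, {i | p ∈ X i}.ncard ≤ k) :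
    ∃ z ∈ P \ (⋃ i, X i), ∃ I : Finset (Fin n), I.card = n - k ∧
      ∃ 𝒦 : Set (Set (EuclideanSpace ℝ (Fin n))),
        2 ^ (n - k) ≤ 𝒦.ncard ∧
        (∀ K ∈ 𝒦, IsFaceOf P K ∧ faceDim K = k ∧
          {c | ∃ F, IsFacetOf P F ∧ K ⊆ F ∧ h F = c} = (I : Set (Fin n)) ∧
          (connectedComponentIn (P \ (⋃ i, X i)) z ∩ K).Nonempty) ∧
        ∃ K ∈ 𝒦, V ∈ K := by
  classical
  have hn : 0 < n := Fin.pos (h ∅)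
  obtain ⟨F, l, T, hs⟩ := aux_vertex_struct hn hP hcol hV
  have hPc := aux_poly_compact hP.1
  have hVP := hs.memP hn
  have huniq : ∀ G G', IsFacetOf P G → IsFacetOf P G' → h G = h G' → ∀ x, x ∈ G → x ∈ G' →
      G = G' := by
    intro G G' hG hG' he x hx hx'
    by_contra hne
    exact hcol G G' hG hG' hne ⟨x, hx, hx'⟩ he
  have hfin : {F | IsFacetOf P F}.Finite := (aux_faces_finite hP.1).subset fun F hF => hF.1
  have hFP : ∀ G, IsFacetOf P G → G ⊆ P := by
    rintro G ⟨⟨f, rfl⟩, -⟩ x hx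
    exact hx.1
  have hFcl : ∀ G, IsFacetOf P G → IsClosed G := by
    rintro G ⟨⟨f, rfl⟩, -⟩
    have hexp : IsExposed ℝ P (auxFace P f) := fun _ => ⟨f, rfl⟩
    exact hexp.isClosed hPc.isClosed
  let S : Fin n → Bool → Set (EuclideanSpace ℝ (Fin n)) := fun c b =>
    ⋃ G ∈ {G | IsFacetOf P G ∧ h G = c ∧ (b = false ↔ G = F c)}, G
  have hSmem : ∀ c b x, x ∈ S c b ↔
      ∃ G, IsFacetOf P G ∧ h G = c ∧ (b = false ↔ G = F c) ∧ x ∈ G := by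
    intro c b x
    simp only [S, Set.mem_iUnion, exists_prop]
    constructor
    · rintro ⟨G, ⟨h1, h2, h3⟩, h4⟩; exact ⟨G, h1, h2, h3, h4⟩
    · rintro ⟨G, h1, h2, h3, h4⟩; exact ⟨G, ⟨h1, h2, h3⟩, h4⟩
  have hScl : ∀ c b, IsClosed (S c b) := fun c b =>
    (hfin.subset fun G hG => hG.1).isClosed_biUnion fun G hG => hFcl G hG.1
  have hSd : ∀ c, Disjoint (S c false) (S c true) := by
    intro c
    rw [Set.disjoint_left]
    intro x hx hx'
    obtain ⟨G, hG, hGc, hGi, hxG⟩ := (hSmem _ _ _).1 hx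
    obtain ⟨G', hG', hGc', hGi', hxG'⟩ := (hSmem _ _ _).1 hx'
    have h1 := hGi.1 rfl
    have h2 := huniq G G' hG hG' (hGc.trans hGc'.symm) x hxG hxG'
    have h3 := hGi'.2 (h2 ▸ h1)
    simp at h3
  have hfr : ∀ x ∈ frontier P, ∃ c b, x ∈ S c b := by
    intro x hx
    obtain ⟨G, hG, hxG⟩ := aux_frontier_facet hP.1 hx
    refine ⟨h G, decide (G ≠ F (h G)), (hSmem _ _ _).2 ⟨G, hG, rfl, ?_, hxG⟩⟩
    simp
  have hgap : ∀ c, ∃ δ > 0, ∀ x ∈ S c true, T V c + δ ≤ T x c := by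
    intro c
    have hlt : ∀ x ∈ S c true, T V c < T x c := by
      intro x hx
      obtain ⟨G, hG, hGc, hGi, hxG⟩ := (hSmem _ _ _).1 hx
      rw [hs.coord, hs.coord, neg_lt_neg_iff]
      have hv := hs.mem c
      rw [hs.exp] at hv
      refine lt_of_le_of_ne (hv.2 x (hFP G hG hxG)) fun he => ?_
      have hxF : x ∈ F c := by
        rw [hs.exp]
        exact ⟨hFP G hG hxG, fun y hy => he ▸ hv.2 y hy⟩
      have h2 := huniq G (F c) hG (hs.facet c) (hGc.trans (hs.col c).symm) x hxG hxF
      have h3 := hGi.2 h2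
      simp at h3
    rcases (S c true).eq_empty_or_nonempty with he | hne
    · exact ⟨1, one_pos, fun x hx => by rw [he] at hx; exact absurd hx (Set.notMem_empty x)⟩
    have hcomp : IsCompact (S c true) := hPc.of_isClosed_subset (hScl c true) fun x hx => by
      obtain ⟨G, hG, -, -, hxG⟩ := (hSmem _ _ _).1 hx
      exact hFP G hG hxG
    have hcont : ContinuousOn (fun x => T x c) (S c true) :=
      ((continuous_apply c).comp T.continuous).continuousOn
    obtain ⟨x, hx, hmin⟩ := hcomp.exists_isMinOn hne hcont
    refine ⟨T x c - T V c, sub_pos.2 (hlt x hx), fun y hy => ?_⟩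
    have : T x c ≤ T y c := hmin hy
    linarith
  choose δ hδ hδS using hgap
  obtain ⟨t, ht, htP⟩ := hs.dir hn hP.1 (fun _ => 1) (fun _ => zero_le_one)
  have hev : ∀ᶠ e in nhdsWithin (0 : ℝ) (Set.Ioi 0), (∀ c, e < δ c) ∧ e < t ∧ 0 < e := by
    refine (Filter.eventually_all.2 fun c => ?_).and (Filter.Eventually.and ?_ ?_)
    · filter_upwards [Ioo_mem_nhdsGT (hδ c)] with e he using he.2
    · filter_upwards [Ioo_mem_nhdsGT ht] with e he using he.2
    · filter_upwards [Ioo_mem_nhdsGT ht] with e he using he.1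
  obtain ⟨e, heδ, het, he0⟩ := hev.exists
  set a := V + e • T.symm (fun _ => 1) with ha
  have hTa : ∀ c, T a c = T V c + e := by
    intro c
    simp [ha]
  have haP : a ∈ P := htP e he0.le het.le
  have hm : ∀ c, ∀ x ∈ S c false, T x c < T a c := by
    intro c x hx
    obtain ⟨G, hG, hGc, hGi, hxG⟩ := (hSmem _ _ _).1 hx
    rw [hGi.1 rfl] at hxG
    have hv := hs.mem c
    rw [hs.exp] at hv hxG
    rw [hTa, hs.coord, hs.coord, aux_face_sub _ hxG hv]
    linarith
  have hp : ∀ c, ∀ x ∈ S c true, T a c < T x c := by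
    intro c x hx
    rw [hTa]
    linarith [hδS c x hx, heδ c]
  have hone' : ∀ i c, ∃ b, ∀ x ∈ X i, x ∉ S c (!b) := by
    intro i c
    by_cases hne : ∃ x ∈ X i, x ∈ S c true
    · obtain ⟨x, hx, hxS⟩ := hne
      refine ⟨true, fun y hy hyS => ?_⟩
      obtain ⟨G, hG, hGc, hGi, hxG⟩ := (hSmem _ _ _).1 hxS
      obtain ⟨G', hG', hGc', hGi', hyG⟩ := (hSmem _ _ _).1 hyS
      have he : G = G' := hone i c ⟨hG, hGc, x, hx, hxG⟩ ⟨hG', hGc', y, hy, hyG⟩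
      have h3 := hGi.2 (he ▸ hGi'.1 rfl)
      simp at h3
    · push Not at hne
      exact ⟨false, hne⟩
  obtain ⟨I, -, hI⟩ := Finset.exists_subset_card_eq (s := (Finset.univ : Finset (Fin n)))
    (n := n - k) (by simp)
  obtain ⟨z, hz, hcomp⟩ := aux_topo hk P hPc (aux_poly_convex hP.1) T a haP S hScl hSd hfr hm hp X
    hclosed hone' hmult I hI
  refine ⟨z, hz, I, hI, ?_⟩
  choose y hy hyS using hcomp
  have hyP : ∀ ε, y ε ∈ P := fun ε => (connectedComponentIn_subset _ _ (hy ε)).1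
  have hex : ∀ (ε : Fin n → Bool) (c : Fin n), ∃ G, c ∈ I →
      IsFacetOf P G ∧ h G = c ∧ (ε c = false ↔ G = F c) ∧ y ε ∈ G := by
    intro ε c
    by_cases hc : c ∈ I
    · obtain ⟨G, hG⟩ := (hSmem _ _ _).1 (hyS ε c hc)
      exact ⟨G, fun _ => hG⟩
    · exact ⟨∅, fun h => absurd h hc⟩
  choose G hG using hex
  let ext : (I → Bool) → (Fin n → Bool) := fun ε c => if hc : c ∈ I then ε ⟨c, hc⟩ else false
  let K : (I → Bool) → Set (EuclideanSpace ℝ (Fin n)) := fun ε =>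
    {x ∈ P | ∀ c ∈ I, x ∈ G (ext ε) c}
  have hyK : ∀ ε, y (ext ε) ∈ K ε := fun ε => ⟨hyP _, fun c hc => (hG (ext ε) c hc).2.2.2⟩
  have hKinj : Function.Injective K := by
    intro ε ε' he
    funext ⟨c, hc⟩
    have h1 : y (ext ε) ∈ K ε' := he ▸ hyK ε
    obtain ⟨g1, g2, g3, g4⟩ := hG (ext ε) c hc
    obtain ⟨g1', g2', g3', g4'⟩ := hG (ext ε') c hc
    have h2 := huniq _ _ g1 g1' (g2.trans g2'.symm) _ g4 (h1.2 c hc)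
    rw [← h2, ← g3] at g3'
    simp only [ext, dif_pos hc] at g3'
    cases h3 : ε ⟨c, hc⟩ <;> cases h4 : ε' ⟨c, hc⟩ <;> simp_all
  refine ⟨Set.range K, ?_, ?_, K (fun _ => false), ⟨fun _ => false, rfl⟩, ?_⟩
  · rw [← Set.image_univ, Set.ncard_image_of_injective _ hKinj, Set.ncard_univ]
    simp [hI]
  · rintro _ ⟨ε, rfl⟩
    obtain ⟨h1, h2, h3⟩ := aux_inter_props hn hP hcol I (G (ext ε))
      (fun c hc => (hG (ext ε) c hc).1) (fun c hc => (hG (ext ε) c hc).2.1) ⟨_, hyK ε⟩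
    refine ⟨h1, ?_, h3, y (ext ε), hy _, hyK ε⟩
    rw [h2, hI]
    omega
  · refine ⟨hVP, fun c hc => ?_⟩
    have h1 := (hG (ext fun _ => false) c hc).2.2.1.1 (by simp [ext])
    rw [h1]
    exact hs.mem c

end
end

section
/- (Colorful Hex theorem) Let P ⊆ ℝ^n be a full-dimensional simple convex polytope with a proper coloring h of its facets by n colors, let V be a vertex of P, and for each i ∈ {1,…,n} let F_{ν_i} be the unique facet containing V with h(F_{ν_i}) = i. Suppose P is covered by n closed sets X_1, …, X_n (indexed by the colors). Then for some i, a connected component of X_i intersects both F_{ν_i} and some other facet F ≠ F_{ν_i} of P with h(F) = i. -/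
open Set

noncomputable section

theorem det_interp {n : ℕ} (v : ℕ → ℝ) (hv : Function.Injective v)
    (A : EuclideanSpace ℝ (Fin n) →L[ℝ] EuclideanSpace ℝ (Fin n)) :
    (1 + A).det = ∑ k ∈ Finset.range (n + 1),
      (Lagrange.basis (Finset.range (n + 1)) v k).eval 1 * (1 + v k • A).det := by
  classical
  let b := (EuclideanSpace.basisFun (Fin n) ℝ).toBasis
  let M := LinearMap.toMatrix b b (A : EuclideanSpace ℝ (Fin n) →ₗ[ℝ] EuclideanSpace ℝ (Fin n))
  let q : Polynomial ℝ := Matrix.det ((Polynomial.X : Polynomial ℝ) • M.map Polynomial.C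
    + (1 : Matrix (Fin n) (Fin n) ℝ).map Polynomial.C)
  have hq : ∀ t : ℝ, q.eval t = (1 + t • A).det := by
    intro t
    have h1 : (1 + t • A).det = LinearMap.det (1 + t •
        (A : EuclideanSpace ℝ (Fin n) →ₗ[ℝ] EuclideanSpace ℝ (Fin n))) := rfl
    rw [h1, ← LinearMap.det_toMatrix b, map_add, map_smul]
    have h2 : LinearMap.toMatrix b b (1 : EuclideanSpace ℝ (Fin n) →ₗ[ℝ] EuclideanSpace ℝ (Fin n)) = 1 :=
      LinearMap.toMatrix_one b
    rw [h2]
    change (Polynomial.evalRingHom t) q = _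
    simp only [q]
    rw [RingHom.map_det]
    congr 1
    ext i j
    by_cases hij : i = j
    · simp [M, hij]; ring
    · simp [M, hij]; ring
  have hdeg : q.degree < (Finset.range (n + 1)).card := by
    have := Polynomial.natDegree_det_X_add_C_le M 1
    simp only [Fintype.card_fin] at this
    refine lt_of_le_of_lt Polynomial.degree_le_natDegree ?_
    rw [Finset.card_range]
    exact_mod_cast Nat.lt_succ_of_le this
  have h3 := Lagrange.eq_interpolate (f := q) (s := Finset.range (n+1)) (v := v) hv.injOn hdeg
  have h4 := congrArg (Polynomial.eval 1) h3
  rw [Lagrange.interpolate_apply, Polynomial.eval_finsetSum, hq, one_smul] at h4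
  rw [h4]
  refine Finset.sum_congr rfl fun k _ => ?_
  rw [Polynomial.eval_mul, Polynomial.eval_C, hq, mul_comm]

theorem basis_sum_one {n : ℕ} (v : ℕ → ℝ) (hv : Function.Injective v) :
    ∑ k ∈ Finset.range (n + 1), (Lagrange.basis (Finset.range (n + 1)) v k).eval 1 = 1 := by
  have := congrArg (Polynomial.eval 1)
    (Lagrange.sum_basis (s := Finset.range (n+1)) (v := v) hv.injOn ⟨0, by simp⟩)
  simpa [Polynomial.eval_finsetSum] using this

theorem ball_bij {n : ℕ} {R : ℝ}
    (φ : EuclideanSpace ℝ (Fin n) → EuclideanSpace ℝ (Fin n)) (M : NNReal)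
    (hL : LipschitzOnWith M φ (Metric.closedBall 0 R))
    (h0 : ∀ x, ‖x‖ = R → φ x = 0) (t : ℝ) (ht : 0 ≤ t) (htM : t * M < 1) :
    InjOn (fun x => x + t • φ x) (Metric.closedBall 0 R) ∧
      (fun x => x + t • φ x) '' (Metric.closedBall 0 R) = Metric.closedBall 0 R := by
  classical
  set B := Metric.closedBall (0 : EuclideanSpace ℝ (Fin n)) R with hB
  let ψ := B.indicator φ
  have key : ∀ x ∈ B, ∀ y ∉ B, ‖φ x‖ ≤ M * ‖x - y‖ := by
    intro x hx y hy
    have hx' : ‖x‖ ≤ R := by simpa [hB] using hx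
    have hy' : R < ‖y‖ := by simpa [hB] using hy
    have hc : ContinuousOn (fun s : ℝ => ‖x + s • (y - x)‖) (Icc 0 1) := by fun_prop
    obtain ⟨s, hs, hse⟩ := intermediate_value_Icc zero_le_one hc
      (show R ∈ Icc _ _ by simp only [zero_smul, add_zero, one_smul, add_sub_cancel]; exact ⟨hx', hy'.le⟩)
    simp only at hse
    have h1 := hL.dist_le_mul x hx (x + s • (y - x)) (by simp [hB, hse])
    rw [h0 _ hse, dist_zero_right, dist_self_add_right, norm_smul, Real.norm_of_nonneg hs.1] at h1
    refine h1.trans ?_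
    rw [norm_sub_rev]
    gcongr
    exact mul_le_of_le_one_left (norm_nonneg _) hs.2
  have hψ : LipschitzWith M ψ := by
    refine LipschitzWith.of_dist_le_mul fun x y => ?_
    by_cases hx : x ∈ B <;> by_cases hy : y ∈ B
    · simpa [ψ, hx, hy] using hL.dist_le_mul x hx y hy
    · simpa [ψ, hx, hy, dist_eq_norm] using key x hx y hy
    · have := key y hy x hx
      rw [norm_sub_rev] at this
      simpa [ψ, hx, hy, dist_eq_norm] using this
    · simp [ψ, hx, hy]; positivity
  let F := fun x => x + t • ψ x
  have hFo : ∀ x ∉ B, F x = x := fun x hx => by simp [F, ψ, hx]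
  have hFi : EqOn (fun x => x + t • φ x) F B := fun x hx => by simp [F, ψ, hx]
  obtain ⟨c, hcc⟩ : ∃ c : NNReal, (c : ℝ) = t * M := ⟨⟨t * M, by positivity⟩, rfl⟩
  have hap : ApproximatesLinearOn F ((ContinuousLinearEquiv.refl ℝ (EuclideanSpace ℝ (Fin n)) :
      EuclideanSpace ℝ (Fin n) ≃L[ℝ] EuclideanSpace ℝ (Fin n)) : 
      EuclideanSpace ℝ (Fin n) →L[ℝ] EuclideanSpace ℝ (Fin n)) univ c := by
    intro x _ y _
    have : F x - F y - (x - y) = t • (ψ x - ψ y) := by simp only [F, smul_sub]; abel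
    simp only [ContinuousLinearEquiv.coe_refl, ContinuousLinearMap.coe_id', id]
    rw [this, norm_smul, Real.norm_of_nonneg ht]
    have := hψ.dist_le_mul x y
    rw [dist_eq_norm, dist_eq_norm] at this
    calc t * _ ≤ t * (M * ‖x - y‖) := by gcongr
      _ = (c : ℝ) * ‖x - y‖ := by rw [hcc]; ring
  have hbij : Function.Bijective F := by
    rcases subsingleton_or_nontrivial (EuclideanSpace ℝ (Fin n)) with hs | hs
    · exact ⟨Function.injective_of_subsingleton F, fun y => ⟨y, Subsingleton.elim _ _⟩⟩
    have hc : Subsingleton (EuclideanSpace ℝ (Fin n)) ∨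
        c < ‖((ContinuousLinearEquiv.refl ℝ (EuclideanSpace ℝ (Fin n))).symm :
          EuclideanSpace ℝ (Fin n) →L[ℝ] EuclideanSpace ℝ (Fin n))‖₊⁻¹ := by
      right
      rw [← NNReal.coe_lt_coe]
      rw [NNReal.coe_inv, hcc]
      simpa using htM
    refine ⟨fun x y h => ?_, hap.surjective hc⟩
    exact hap.injOn hc (mem_univ _) (mem_univ _) h
  refine ⟨fun x hx y hy h => hbij.1 (by rw [← hFi hx, ← hFi hy]; exact h), ?_⟩
  rw [hFi.image_eq]
  ext y
  constructor
  · rintro ⟨x, hx, rfl⟩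
    by_contra hn
    have := hbij.1 (hFo _ hn)
    rw [this] at hn
    exact hn hx
  · intro hy
    obtain ⟨x, rfl⟩ := hbij.2 y
    refine ⟨x, ?_, rfl⟩
    by_contra hn
    rw [hFo _ hn] at hy
    exact hn hy

theorem no_retraction {n : ℕ} {R : ℝ} (hR : 0 < R)
    (f : EuclideanSpace ℝ (Fin n) → EuclideanSpace ℝ (Fin n)) (hf : ContDiff ℝ 1 f)
    (h0 : ∀ x, ‖x‖ = R → f x = x) (h1 : ∀ x, ‖f x‖ = R) : False := by
  classical
  set B := Metric.closedBall (0 : EuclideanSpace ℝ (Fin n)) R with hB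
  have hBc : IsCompact B := isCompact_closedBall _ _
  let φ := fun x => f x - x
  have hφ : ContDiff ℝ 1 φ := hf.sub contDiff_id
  have hφ' : Continuous (fderiv ℝ φ) := hφ.continuous_fderiv (by norm_num)
  obtain ⟨M0, hM0⟩ := hBc.exists_bound_of_continuousOn hφ'.continuousOn
  let M : NNReal := ⟨max M0 0, le_max_right _ _⟩
  have hM : ∀ x ∈ B, ‖fderiv ℝ φ x‖ ≤ M := fun x hx => (hM0 x hx).trans (le_max_left _ _)
  have hL : LipschitzOnWith M φ B := by
    refine (convex_closedBall _ _).lipschitzOnWith_of_nnnorm_fderiv_le (𝕜 := ℝ) ?_ ?_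
    · intro x _; exact (hφ.differentiable (by norm_num)) x
    · intro x hx; exact hM x hx
  have hφ0 : ∀ x, ‖x‖ = R → φ x = 0 := fun x hx => by simp [φ, h0 x hx]
  -- positivity of determinants near the identity
  have hdet : ∀ᶠ A in nhds (1 : EuclideanSpace ℝ (Fin n) →L[ℝ] EuclideanSpace ℝ (Fin n)),
      0 < A.det := by
    have hc : Continuous (fun A : EuclideanSpace ℝ (Fin n) →L[ℝ] EuclideanSpace ℝ (Fin n) => A.det) :=
      ContinuousLinearMap.continuous_det
    refine hc.continuousAt.eventually (lt_mem_nhds ?_)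
    have : (1 : EuclideanSpace ℝ (Fin n) →L[ℝ] EuclideanSpace ℝ (Fin n)).det = 1 := by
      change LinearMap.det (LinearMap.id) = 1
      simp
    simp only [this]; norm_num
  obtain ⟨δ, hδ, hdet⟩ := Metric.eventually_nhds_iff.1 hdet
  obtain ⟨τ, hτ, hτM, hτδ⟩ : ∃ τ : ℝ, 0 < τ ∧ τ * M < 1 ∧ τ * M < δ := by
    refine ⟨min 1 δ / (M + 1), by positivity, ?_, ?_⟩
    · have h2 : min 1 δ / ((M : ℝ) + 1) * M < min 1 δ := by
        rw [div_mul_eq_mul_div, div_lt_iff₀ (by positivity)]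
        nlinarith [lt_min zero_lt_one hδ]
      exact h2.trans_le (min_le_left _ _)
    · have h2 : min 1 δ / ((M : ℝ) + 1) * M < min 1 δ := by
        rw [div_mul_eq_mul_div, div_lt_iff₀ (by positivity)]
        nlinarith [lt_min zero_lt_one hδ]
      exact h2.trans_le (min_le_right _ _)
  have hcont : ∀ t : ℝ, Continuous (fun x => (1 + t • fderiv ℝ φ x).det) := fun t =>
    ContinuousLinearMap.continuous_det.comp (continuous_const.add (hφ'.const_smul t))
  have hint : ∀ t : ℝ, 0 ≤ t → t ≤ τ →
      ∫ x in B, (1 + t • fderiv ℝ φ x).det = MeasureTheory.volume.real B := by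
    intro t ht htτ
    have htM : t * M ≤ τ * M := by gcongr
    obtain ⟨hi, him⟩ := ball_bij φ M hL hφ0 t ht (by linarith)
    have hd : ∀ x ∈ B, HasFDerivWithinAt (fun x => x + t • φ x) (1 + t • fderiv ℝ φ x) B x := by
      intro x _
      have h2 : HasFDerivAt φ (fderiv ℝ φ x) x :=
        ((hφ.differentiable (by norm_num)) x).hasFDerivAt
      exact ((hasFDerivAt_id x).add (h2.const_smul t)).hasFDerivWithinAt
    have h3 := MeasureTheory.integral_image_eq_integral_abs_det_fderiv_smul
      MeasureTheory.volume hBc.measurableSet hd hi (fun _ => (1 : ℝ))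
    rw [him] at h3
    simp only [smul_eq_mul, mul_one] at h3
    rw [MeasureTheory.setIntegral_const, smul_eq_mul, mul_one] at h3
    rw [h3]
    refine MeasureTheory.setIntegral_congr_fun hBc.measurableSet fun x hx => ?_
    rw [abs_of_pos]
    apply hdet
    rw [dist_self_add_left, norm_smul, Real.norm_of_nonneg ht]
    have := hM x hx
    calc t * ‖fderiv ℝ φ x‖ ≤ t * M := by gcongr
      _ < δ := by linarith
  let v : ℕ → ℝ := fun k => τ / (k + 1)
  have hv : Function.Injective v := by
    intro a b hab
    simp only [v] at hab
    rw [div_eq_div_iff (by positivity) (by positivity)] at hab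
    have := mul_left_cancel₀ hτ.ne' hab
    exact_mod_cast (add_right_cancel this).symm
  have hzero : ∀ x, (1 + fderiv ℝ φ x).det = 0 := by
    intro x
    have hfx : HasFDerivAt f (1 + fderiv ℝ φ x) x := by
      have h2 : HasFDerivAt φ (fderiv ℝ φ x) x :=
        ((hφ.differentiable (by norm_num)) x).hasFDerivAt
      have h3 := (hasFDerivAt_id x).add h2
      convert! h3 using 1
      ext1 y; simp [φ]
    have h4 := hfx.norm_sq
    have h5 : (fun y => ‖f y‖ ^ 2) = fun _ => R ^ 2 := by ext y; rw [h1]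
    rw [h5] at h4
    have h6 := h4.unique (hasFDerivAt_const _ _)
    by_contra hne
    have hu : IsUnit (LinearMap.det ((1 + fderiv ℝ φ x : EuclideanSpace ℝ (Fin n) →L[ℝ] EuclideanSpace ℝ (Fin n)) :
        EuclideanSpace ℝ (Fin n) →ₗ[ℝ] EuclideanSpace ℝ (Fin n))) := isUnit_iff_ne_zero.2 hne
    let e := LinearMap.equivOfDetNeZero _ hne
    obtain ⟨w, hw⟩ := e.surjective (f x)
    have hw' : (1 + fderiv ℝ φ x) w = f x := hw
    have h7 := congrArg (fun T => T w) h6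
    simp only [smul_apply, ContinuousLinearMap.comp_apply, hw', innerSL_apply_apply,
      real_inner_self_eq_norm_sq, h1, zero_apply] at h7
    simp at h7
    exact hR.ne' h7
  have hfin : ∫ x in B, (1 + fderiv ℝ φ x).det = MeasureTheory.volume.real B := by
    have h8 : (fun x => (1 + fderiv ℝ φ x).det) = _ := funext fun x => det_interp v hv (fderiv ℝ φ x)
    rw [h8]
    rw [MeasureTheory.integral_finsetSum]
    · have : ∀ k ∈ Finset.range (n+1), ∫ x in B, (Lagrange.basis (Finset.range (n + 1)) v k).eval 1 *
          (1 + v k • fderiv ℝ φ x).det =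
          (Lagrange.basis (Finset.range (n + 1)) v k).eval 1 * MeasureTheory.volume.real B := by
        intro k _
        rw [MeasureTheory.integral_const_mul, hint]
        · positivity
        · exact div_le_self hτ.le (by linarith [(Nat.cast_nonneg k : (0:ℝ) ≤ k)])
      rw [Finset.sum_congr rfl this, ← Finset.sum_mul, basis_sum_one v hv, one_mul]
    · intro k _
      exact ((continuous_const.mul (hcont _)).continuousOn.integrableOn_compact hBc)
  simp_rw [hzero] at hfin
  rw [MeasureTheory.integral_zero] at hfin
  have hpos : 0 < MeasureTheory.volume.real B := by
    refine ENNReal.toReal_pos ?_ hBc.measure_ne_top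
    exact (Metric.measure_closedBall_pos _ _ hR).ne'
  linarith

/-- A continuous self-map of Euclidean space that is the identity far away has a zero. -/
theorem exists_zero {n : ℕ} {R : ℝ}
    (F : EuclideanSpace ℝ (Fin n) → EuclideanSpace ℝ (Fin n)) (hF : Continuous F)
    (h0 : ∀ x, R ≤ ‖x‖ → F x = x) : ∃ x, F x = 0 := by
  by_contra! hne
  let R' := |R| + 1
  have hR' : 0 < R' := by positivity
  have hopen : IsOpen {x : EuclideanSpace ℝ (Fin n) | R < ‖x‖} := isOpen_lt continuous_const continuous_norm
  obtain ⟨g, hg, hgd, hgS, -⟩ := hF.exists_contDiff_approx_and_eqOn 1 (ε := fun x => ‖F x‖)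
    (S := {x | R' ≤ ‖x‖}) (U := {x | R < ‖x‖})
    hF.norm (fun x => norm_pos_iff.2 (hne x)) (isClosed_le continuous_const continuous_norm)
    (hopen.mem_nhdsSet.2 (fun x hx => by
      have : R' ≤ ‖x‖ := hx
      have := le_abs_self R
      simp only [mem_ofPred_eq]; linarith [show R' = |R| + 1 from rfl]))
    (contDiffOn_id.congr (fun x hx => h0 x (le_of_lt hx)))
  have hgne : ∀ x, g x ≠ 0 := by
    intro x hx
    have := hgd x
    rw [hx, dist_zero_left] at this
    exact lt_irrefl _ this
  refine no_retraction hR' (fun x => (R' * ‖g x‖⁻¹) • g x) ?_ ?_ ?_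
  · refine ContDiff.smul (contDiff_const.mul (ContDiff.inv ?_ fun x => norm_ne_zero_iff.2 (hgne x))) (by exact_mod_cast hg)
    exact ContDiff.norm ℝ (by exact_mod_cast hg) hgne
  · intro x hx
    have h2 : g x = x := by
      rw [hgS (show R' ≤ ‖x‖ from hx.ge)]
      apply h0
      have := le_abs_self R
      linarith [show R' = |R| + 1 from rfl]
    simp only [h2, hx]
    rw [mul_inv_cancel₀ hR'.ne', one_smul]
  · intro x
    have := norm_pos_iff.2 (hgne x)
    rw [norm_smul, norm_mul, norm_inv, norm_norm, Real.norm_of_nonneg hR'.le]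
    field_simp

theorem poly_compact {d : ℕ} {P : Set (EuclideanSpace ℝ (Fin d))} (hP : IsPolytope P) :
    IsCompact P := by
  obtain ⟨⟨S, rfl⟩, -⟩ := hP
  exact S.finite_toSet.isCompact_convexHull (𝕜 := ℝ)

theorem poly_convex {d : ℕ} {P : Set (EuclideanSpace ℝ (Fin d))} (hP : IsPolytope P) :
    Convex ℝ P := by
  obtain ⟨⟨S, rfl⟩, -⟩ := hP
  exact convex_convexHull _ _

theorem poly_closure {d : ℕ} {P : Set (EuclideanSpace ℝ (Fin d))} (hP : IsPolytope P) :
    closure (interior P) = P := by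
  rw [Convex.closure_interior_eq_closure_of_nonempty_interior (𝕜 := ℝ) (poly_convex hP) hP.2,
    (poly_compact hP).isClosed.closure_eq]

theorem face_compact {d : ℕ} {P F : Set (EuclideanSpace ℝ (Fin d))} (hP : IsPolytope P)
    (hF : IsFaceOf P F) : IsCompact F := by
  have h1 : IsExposed ℝ P F := fun _ => hF
  exact h1.isCompact (poly_compact hP)

theorem face_subset {d : ℕ} {P F : Set (EuclideanSpace ℝ (Fin d))}
    (hF : IsFaceOf P F) : F ⊆ P := by
  obtain ⟨l, rfl⟩ := hF
  exact fun x hx => hx.1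

theorem faces_finite {d : ℕ} {P : Set (EuclideanSpace ℝ (Fin d))} (hP : IsPolytope P) :
    {F | IsFaceOf P F}.Finite := by
  obtain ⟨S, hS⟩ := hP.1
  refine ((S.finite_toSet.powerset).image (fun T => closure (convexHull ℝ T))).subset ?_
  intro F hF
  have h1 : IsExposed ℝ P F := fun _ => hF
  refine ⟨F.extremePoints ℝ, ?_, ?_⟩
  · refine (h1.isExtreme.extremePoints_subset_extremePoints).trans ?_
    rw [hS]
    exact extremePoints_convexHull_subset
  · exact closure_convexHull_extremePoints (face_compact hP hF) (h1.convex (poly_convex hP))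

theorem functional_lt {d : ℕ} {P : Set (EuclideanSpace ℝ (Fin d))}
    {l : EuclideanSpace ℝ (Fin d) →L[ℝ] ℝ} (hl : l ≠ 0) {v p : EuclideanSpace ℝ (Fin d)}
    (hv : ∀ y ∈ P, l y ≤ l v) (hp : p ∈ interior P) : l p < l v := by
  refine lt_of_le_of_ne (hv p (interior_subset hp)) fun heq => hl ?_
  have h1 : IsLocalMax l p := by
    filter_upwards [mem_interior_iff_mem_nhds.1 hp] with y hy
    rw [heq]; exact hv y hy
  have := h1.fderiv_eq_zero
  rwa [ContinuousLinearMap.fderiv] at this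

theorem facet_functional {d : ℕ} (hd : 0 < d) {P F : Set (EuclideanSpace ℝ (Fin d))}
    (hP : IsPolytope P) (hF : IsFacetOf P F) :
    ∃ l : EuclideanSpace ℝ (Fin d) →L[ℝ] ℝ, F = {x ∈ P | ∀ y ∈ P, l y ≤ l x} ∧ l ≠ 0 := by
  obtain ⟨⟨l, hl⟩, hdim⟩ := hF
  refine ⟨l, hl, ?_⟩
  rintro rfl
  have h1 : F = P := by rw [hl]; ext x; simp
  have h2 : affineSpan ℝ P = ⊤ :=
    (poly_convex hP).interior_nonempty_iff_affineSpan_eq_top.1 hP.2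
  unfold faceDim at hdim
  rw [h1, h2, AffineSubspace.direction_top, finrank_top, finrank_euclideanSpace_fin] at hdim
  omega

theorem dim_le {d : ℕ} {P : Set (EuclideanSpace ℝ (Fin d))}
    {l : EuclideanSpace ℝ (Fin d) →L[ℝ] ℝ} (hl : l ≠ 0) :
    faceDim {x ∈ P | ∀ y ∈ P, l y ≤ l x} < d := by
  unfold faceDim
  rw [direction_affineSpan]
  have h1 : vectorSpan ℝ {x ∈ P | ∀ y ∈ P, l y ≤ l x} ≤
      LinearMap.ker (l : EuclideanSpace ℝ (Fin d) →ₗ[ℝ] ℝ) := by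
    rw [vectorSpan_def, Submodule.span_le]
    rintro _ ⟨x, hx, y, hy, rfl⟩
    have := le_antisymm (hx.2 y hy.1) (hy.2 x hx.1)
    simp [this]
  have h2 : LinearMap.ker (l : EuclideanSpace ℝ (Fin d) →ₗ[ℝ] ℝ) < ⊤ := by
    rw [lt_top_iff_ne_top]
    intro h
    apply hl
    ext1 x
    have : x ∈ LinearMap.ker (l : EuclideanSpace ℝ (Fin d) →ₗ[ℝ] ℝ) := by rw [h]; trivial
    simpa using this
  have h3 := Submodule.finrank_lt h2.ne
  rw [finrank_euclideanSpace_fin] at h3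
  exact lt_of_le_of_lt (Submodule.finrank_mono h1) h3

/-- A segment from an interior point of `P` to a point outside crosses the frontier. -/
theorem cross {d : ℕ} {P : Set (EuclideanSpace ℝ (Fin d))} {p y : EuclideanSpace ℝ (Fin d)}
    (hp : p ∈ interior P) (hy : y ∉ P) :
    ∃ z ∈ frontier P, ∃ s : ℝ, 0 < s ∧ s ≤ 1 ∧ z = p + s • (y - p) ∧ z ∈ segment ℝ p y := by
  have h1 : IsPreconnected (segment ℝ p y) := (convex_segment p y).isPreconnected
  obtain ⟨z, hz, hzf⟩ : ∃ z ∈ segment ℝ p y, z ∈ frontier P := by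
    by_contra! hno
    have hyc : y ∈ (closure P)ᶜ := fun hyc =>
      hno y (right_mem_segment ℝ p y) ⟨hyc, fun hyi => hy (interior_subset hyi)⟩
    obtain ⟨z, -, hz1, hz2⟩ := h1 (interior P) (closure P)ᶜ isOpen_interior
      isClosed_closure.isOpen_compl (fun z hz => by
        by_cases hzi : z ∈ interior P
        · exact Or.inl hzi
        · exact Or.inr fun hzc => hno z hz ⟨hzc, hzi⟩)
      ⟨p, left_mem_segment ℝ p y, hp⟩ ⟨y, right_mem_segment ℝ p y, hyc⟩
    exact hz2 (subset_closure (interior_subset hz1))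
  have hz0 := hz
  rw [segment_eq_image'] at hz
  obtain ⟨s, hs, rfl⟩ := hz
  refine ⟨_, hzf, s, lt_of_le_of_ne hs.1 ?_, hs.2, rfl, hz0⟩
  rintro rfl
  simp only [zero_smul, add_zero] at hzf
  exact hzf.2 hp

theorem frontier_facet {d : ℕ} {P : Set (EuclideanSpace ℝ (Fin d))}
    (hP : IsPolytope P) {x : EuclideanSpace ℝ (Fin d)} (hx : x ∈ frontier P) :
    ∃ F, IsFacetOf P F ∧ x ∈ F := by
  classical
  by_contra! hne
  have hPc := (poly_compact hP).isClosed
  have hfin : {F | IsFacetOf P F}.Finite := (faces_finite hP).subset fun F hF => hF.1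
  have hcl : IsClosed (⋃ F ∈ {F | IsFacetOf P F}, F) :=
    hfin.isClosed_biUnion fun F hF => (face_compact hP hF.1).isClosed
  have hxU : x ∉ (⋃ F ∈ {F | IsFacetOf P F}, F) := by
    simp only [mem_iUnion, not_exists]
    intro F hF; exact hne F hF
  obtain ⟨ε, hε, hball⟩ := Metric.isOpen_iff.1 hcl.isOpen_compl x hxU
  have hxcl : x ∈ closure (interior P) := by
    rw [poly_closure hP]; exact hPc.frontier_subset hx
  obtain ⟨p, hp, hpx⟩ := Metric.mem_closure_iff.1 hxcl ε hε
  have hxc : x ∈ closure Pᶜ := by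
    rw [frontier_eq_closure_inter_closure] at hx; exact hx.2
  obtain ⟨y₀, hy₀, hy₀x⟩ := Metric.mem_closure_iff.1 hxc ε hε
  let W := Metric.ball x ε ∩ Pᶜ
  have hWo : IsOpen W := Metric.isOpen_ball.inter hPc.isOpen_compl
  have hWn : W.Nonempty := ⟨y₀, by rw [Metric.mem_ball, dist_comm]; exact hy₀x, hy₀⟩
  let 𝓔 := {E | IsFaceOf P E ∧ faceDim E + 1 < d}
  have h𝓔 : 𝓔.Finite := (faces_finite hP).subset fun F hF => hF.1
  have hnull : MeasureTheory.volume (⋃ E ∈ 𝓔, (affineSpan ℝ (insert p E) :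
      Set (EuclideanSpace ℝ (Fin d)))) = 0 := by
    rw [MeasureTheory.measure_biUnion_null_iff h𝓔.countable]
    intro E hE
    apply MeasureTheory.Measure.addHaar_affineSubspace
    intro htop
    have h2 := finrank_vectorSpan_insert_le_set ℝ E p
    rw [← direction_affineSpan, htop, AffineSubspace.direction_top, finrank_top,
      finrank_euclideanSpace_fin] at h2
    have h3 := hE.2
    unfold faceDim at h3
    rw [direction_affineSpan] at h3
    omega
  obtain ⟨y, hyW, hyE⟩ : ∃ y ∈ W, y ∉ ⋃ E ∈ 𝓔, (affineSpan ℝ (insert p E) :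
      Set (EuclideanSpace ℝ (Fin d))) := by
    by_contra! hcon
    have h3 := MeasureTheory.measure_mono_null (μ := MeasureTheory.volume)
      (show W ⊆ ⋃ E ∈ 𝓔, (affineSpan ℝ (insert p E) :
        Set (EuclideanSpace ℝ (Fin d))) from hcon) hnull
    exact (hWo.measure_pos MeasureTheory.volume hWn).ne' h3
  obtain ⟨z, hzf, s, hs0, hs1, hzs, hzseg⟩ := cross hp hyW.2
  have hzb : z ∈ Metric.ball x ε := by
    refine (convex_ball x ε).segment_subset ?_ hyW.1 hzseg
    rw [Metric.mem_ball, dist_comm]; exact hpx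
  obtain ⟨l, hl⟩ := geometric_hahn_banach_open_point (poly_convex hP).interior isOpen_interior hzf.2
  have hl0 : l ≠ 0 := by
    rintro rfl
    simpa using hl p hp
  have hmax : ∀ a ∈ P, l a ≤ l z := by
    intro a ha
    rw [← poly_closure hP] at ha
    have hcl2 : IsClosed {a | l a ≤ l z} := isClosed_le l.continuous continuous_const
    exact closure_minimal (fun b hb => (hl b hb).le) hcl2 ha
  have hzP : z ∈ P := hPc.frontier_subset hzf
  let E := {x ∈ P | ∀ y ∈ P, l y ≤ l x}
  have hzE : z ∈ E := ⟨hzP, hmax⟩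
  have hEf : IsFaceOf P E := ⟨l, rfl⟩
  have hEd : faceDim E < d := dim_le hl0
  have hEn : ¬ IsFacetOf P E := by
    intro hF
    apply hball hzb
    simp only [mem_iUnion]
    exact ⟨E, hF, hzE⟩
  have hE𝓔 : E ∈ 𝓔 := by
    refine ⟨hEf, ?_⟩
    have : faceDim E ≠ d - 1 := fun h => hEn ⟨hEf, h⟩
    omega
  apply hyE
  simp only [mem_iUnion]
  refine ⟨E, hE𝓔, ?_⟩
  have hpA : p ∈ affineSpan ℝ (insert p E) := subset_affineSpan ℝ _ (mem_insert _ _)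
  have hzA : z ∈ affineSpan ℝ (insert p E) := subset_affineSpan ℝ _ (mem_insert_of_mem _ hzE)
  have h5 := AffineMap.lineMap_mem (s⁻¹) hpA hzA
  have h6 : AffineMap.lineMap p z s⁻¹ = y := by
    rw [AffineMap.lineMap_apply, hzs]
    simp [smul_smul, inv_mul_cancel₀ hs0.ne']
  rw [h6] at h5
  exact h5

theorem normals_injective {d : ℕ} {P : Set (EuclideanSpace ℝ (Fin d))}
    (hP : IsPolytope P) {V : EuclideanSpace ℝ (Fin d)} (hV : IsVertexOf P V)
    (Fν : Fin d → Set (EuclideanSpace ℝ (Fin d)))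
    (hall : ∀ F, IsFacetOf P F → V ∈ F → ∃ i, F = Fν i)
    (l : Fin d → EuclideanSpace ℝ (Fin d) →L[ℝ] ℝ)
    (hl : ∀ i, Fν i = {x ∈ P | ∀ y ∈ P, l i y ≤ l i x}) (hl0 : ∀ i, l i ≠ 0)
    (hVF : ∀ i, V ∈ Fν i)
    (w : EuclideanSpace ℝ (Fin d)) (hw : ∀ i, l i w = 0) : w = 0 := by
  classical
  by_contra hw0
  have hPc := (poly_compact hP).isClosed
  have hVP : V ∈ P := face_subset hV rfl
  have hfin : {F | IsFacetOf P F ∧ V ∉ F}.Finite := (faces_finite hP).subset fun F hF => hF.1.1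
  have hcl : IsClosed (⋃ F ∈ {F | IsFacetOf P F ∧ V ∉ F}, F) :=
    hfin.isClosed_biUnion fun F hF => (face_compact hP hF.1.1).isClosed
  have hxU : V ∉ (⋃ F ∈ {F | IsFacetOf P F ∧ V ∉ F}, F) := by
    simp only [mem_iUnion, not_exists]
    intro F hF; exact hF.2
  obtain ⟨ε, hε, hball⟩ := Metric.isOpen_iff.1 hcl.isOpen_compl V hxU
  have hVcl : V ∈ closure (interior P) := by rw [poly_closure hP]; exact hVP
  obtain ⟨p, hp, hpV⟩ := Metric.mem_closure_iff.1 hVcl ε hε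
  have claim : ∀ t : ℝ, ‖t • w‖ < ε → V + t • w ∈ P := by
    intro t ht
    by_contra hy
    obtain ⟨z, hzf, s, hs0, hs1, hzs, hzseg⟩ := cross hp hy
    have hzb : z ∈ Metric.ball V ε := by
      refine (convex_ball V ε).segment_subset ?_ ?_ hzseg
      · rw [Metric.mem_ball, dist_comm]; exact hpV
      · rw [Metric.mem_ball, dist_self_add_left]; exact ht
    obtain ⟨F, hF, hzF⟩ := frontier_facet hP hzf
    have hVinF : V ∈ F := by
      by_contra hn
      apply hball hzb
      simp only [mem_iUnion]
      exact ⟨F, ⟨hF, hn⟩, hzF⟩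
    obtain ⟨i, rfl⟩ := hall F hF hVinF
    have hVi := hVF i
    rw [hl i] at hzF hVi
    have h1 : l i z = l i V := le_antisymm (hVi.2 z hzF.1) (hzF.2 V hVP)
    have h2 : l i p < l i V := functional_lt (hl0 i) hVi.2 hp
    rw [hzs] at h1
    simp only [map_add, map_smul, map_sub, hw i, smul_eq_mul] at h1
    have h3 : s = 1 := by
      have : (1 - s) * (l i p - l i V) = 0 := by linarith
      rcases mul_eq_zero.1 this with h | h <;> linarith
    apply hy
    have : z = V + t • w := by rw [hzs, h3, one_smul, add_sub_cancel]
    rw [← this]; exact hzF.1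
  obtain ⟨m, hm⟩ := hV
  have hwn : 0 < ‖w‖ := norm_pos_iff.2 hw0
  let t : ℝ := ε / (2 * ‖w‖)
  have ht : 0 < t := by positivity
  have htw : ‖t • w‖ < ε := by
    rw [norm_smul, Real.norm_of_nonneg ht.le]
    have : t * ‖w‖ = ε / 2 := by simp only [t]; field_simp
    linarith
  have h1 := claim t htw
  have h2 := claim (-t) (by rwa [neg_smul, norm_neg])
  have hVm : V ∈ {x ∈ P | ∀ y ∈ P, m y ≤ m x} := by rw [← hm]; rfl
  have h3 := hVm.2 _ h1
  have h4 := hVm.2 _ h2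
  simp only [map_add, map_smul, smul_eq_mul] at h3 h4
  have h5 : V + t • w ∈ {x ∈ P | ∀ y ∈ P, m y ≤ m x} := by
    refine ⟨h1, fun y hy => ?_⟩
    have := hVm.2 y hy
    simp only [map_add, map_smul, smul_eq_mul]
    linarith
  rw [← hm, mem_singleton_iff, add_eq_left, smul_eq_zero] at h5
  rcases h5 with h5 | h5
  · exact ht.ne' h5
  · exact hw0 h5

theorem separate {E : Type*} [TopologicalSpace E] [T2Space E] {K C₁ C₂ : Set E}
    (hK : IsCompact K) (h1 : IsClosed C₁) (h2 : IsClosed C₂)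
    (hno : ∀ y ∈ K, (connectedComponentIn K y ∩ C₁).Nonempty →
      (connectedComponentIn K y ∩ C₂).Nonempty → False) :
    ∃ A B : Set E, IsClosed A ∧ IsClosed B ∧ A ∪ B = K ∧ Disjoint A B ∧
      K ∩ C₁ ⊆ A ∧ K ∩ C₂ ⊆ B := by
  have : CompactSpace K := isCompact_iff_compactSpace.1 hK
  let mk : K → ConnectedComponents K := ConnectedComponents.mk
  have hmk : Continuous mk := ConnectedComponents.continuous_coe
  let Z₁ := mk '' ((↑) ⁻¹' C₁)
  let Z₂ := mk '' ((↑) ⁻¹' C₂)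
  have hZ₁ : IsClosed Z₁ :=
    ((h1.preimage continuous_subtype_val).isCompact.image hmk).isClosed
  have hZ₂ : IsClosed Z₂ :=
    ((h2.preimage continuous_subtype_val).isCompact.image hmk).isClosed
  have hsub : Z₁ ⊆ Z₂ᶜ := by
    rintro _ ⟨a, ha, rfl⟩ ⟨b, hb, hab⟩
    have hab' : connectedComponent b = connectedComponent a := ConnectedComponents.coe_eq_coe.1 hab
    have hin : connectedComponentIn K (a : E) = (↑) '' connectedComponent a := by
      rw [connectedComponentIn_eq_image a.2]
    refine hno a a.2 ⟨a, ?_, ha⟩ ⟨b, ?_, hb⟩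
    · exact mem_connectedComponentIn a.2
    · rw [hin, ← hab']
      exact ⟨b, mem_connectedComponent, rfl⟩
  obtain ⟨D, hD, hZD, hDZ⟩ := exists_clopen_of_closed_subset_open hZ₁ hZ₂.isOpen_compl hsub
  have hD' : IsClopen (mk ⁻¹' D) := hD.preimage hmk
  refine ⟨(↑) '' (mk ⁻¹' D), (↑) '' (mk ⁻¹' D)ᶜ, ?_, ?_, ?_, ?_, ?_, ?_⟩
  · exact (hD'.1.isCompact.image continuous_subtype_val).isClosed
  · exact (hD'.compl.1.isCompact.image continuous_subtype_val).isClosed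
  · rw [← image_union, union_compl_self, image_univ, Subtype.range_coe]
  · exact (disjoint_image_iff Subtype.val_injective).2 disjoint_compl_right
  · rintro x ⟨hx, hxC⟩
    exact ⟨⟨x, hx⟩, hZD ⟨⟨x, hx⟩, hxC, rfl⟩, rfl⟩
  · rintro x ⟨hx, hxC⟩
    exact ⟨⟨x, hx⟩, fun hd => hDZ hd ⟨⟨x, hx⟩, hxC, rfl⟩, rfl⟩

/-- **Colorful Hex theorem.** Let `P ⊆ ℝ^n` be a full-dimensional simple polytope with
a proper coloring `h` of its facets by `n` colors, let `V` be a vertex of `P`, and for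
each color `i` let `Fν i` be the (unique) facet containing `V` of color `i`. If `P` is
covered by `n` closed sets `X 1, …, X n` (one per color), then for some `i` a connected
component of `X i` intersects both `Fν i` and some other facet of `P` of color `i`. -/
theorem colorful_hex {n : ℕ} (P : Set (EuclideanSpace ℝ (Fin n)))
    (hP : IsSimplePolytope P)
    (h : Set (EuclideanSpace ℝ (Fin n)) → Fin n)
    (hcol : IsProperColoring P h)
    (V : EuclideanSpace ℝ (Fin n)) (hV : IsVertexOf P V)
    (Fν : Fin n → Set (EuclideanSpace ℝ (Fin n)))
    (hFν : ∀ i, IsFacetOf P (Fν i) ∧ V ∈ Fν i ∧ h (Fν i) = i)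
    (X : Fin n → Set (EuclideanSpace ℝ (Fin n)))
    (hclosed : ∀ i, IsClosed (X i))
    (hcover : P ⊆ ⋃ i, X i) :
    ∃ (i : Fin n) (y : EuclideanSpace ℝ (Fin n)), y ∈ X i ∧
      (connectedComponentIn (X i) y ∩ Fν i).Nonempty ∧
      ∃ F, IsFacetOf P F ∧ F ≠ Fν i ∧ h F = i ∧
        (connectedComponentIn (X i) y ∩ F).Nonempty := by
  classical
  by_contra! hcon
  have hPol := hP.1
  have hPcpt := poly_compact hPol
  have hVP : V ∈ P := face_subset hV rfl
  have hn : 0 < n := (Nat.zero_le _).trans_lt (h P).2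
  -- the facets at `V` are exactly the `Fν i`
  have hfin : {F | IsFacetOf P F}.Finite := (faces_finite hPol).subset fun F hF => hF.1
  have hFinj : Function.Injective Fν := fun i j hij => by
    rw [← (hFν i).2.2, ← (hFν j).2.2, hij]
  have hrange : range Fν = {F | IsFacetOf P F ∧ V ∈ F} := by
    refine Set.eq_of_subset_of_ncard_le ?_ ?_ (hfin.subset fun F hF => hF.1)
    · rintro _ ⟨i, rfl⟩
      exact ⟨(hFν i).1, (hFν i).2.1⟩
    · rw [hP.2 V hV, ← Set.image_univ, Set.ncard_image_of_injective _ hFinj, Set.ncard_univ]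
      simp
  have hall : ∀ F, IsFacetOf P F → V ∈ F → ∃ i, F = Fν i := by
    intro F hF hVF
    have : F ∈ range Fν := by rw [hrange]; exact ⟨hF, hVF⟩
    obtain ⟨i, hi⟩ := this
    exact ⟨i, hi.symm⟩
  choose l hl hl0 using fun i => facet_functional hn hPol (hFν i).1
  have hVmax : ∀ i, ∀ y ∈ P, l i y ≤ l i V := fun i => by
    have := (hFν i).2.1
    rw [hl i] at this
    exact this.2
  have hFeq : ∀ i, ∀ x ∈ Fν i, l i x = l i V := by
    intro i x hx
    rw [hl i] at hx
    exact le_antisymm (hVmax i x hx.1) (hx.2 V hVP)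
  -- the other facets
  let G : Fin n → Set (EuclideanSpace ℝ (Fin n)) := fun i =>
    ⋃ F ∈ {F | IsFacetOf P F ∧ F ≠ Fν i ∧ h F = i}, F
  have hGc : ∀ i, IsCompact (G i) := fun i =>
    (hfin.subset fun F hF => hF.1).isCompact_biUnion fun F hF => face_compact hPol hF.1.1
  have hGmem : ∀ i x, x ∈ G i ↔ ∃ F, IsFacetOf P F ∧ F ≠ Fν i ∧ h F = i ∧ x ∈ F := by
    intro i x
    simp only [G, mem_iUnion]
    constructor
    · rintro ⟨F, hF, hx⟩; exact ⟨F, hF.1, hF.2.1, hF.2.2, hx⟩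
    · rintro ⟨F, h1, h2, h3, hx⟩; exact ⟨F, ⟨h1, h2, h3⟩, hx⟩
  have hGP : ∀ i, G i ⊆ P := by
    intro i x hx
    obtain ⟨F, hF, -, -, hxF⟩ := (hGmem i x).1 hx
    exact face_subset hF.1 hxF
  have hGF : ∀ i, Disjoint (Fν i) (G i) := by
    intro i
    rw [Set.disjoint_left]
    intro x hx hxG
    obtain ⟨F, hF, hne, hc, hxF⟩ := (hGmem i x).1 hxG
    exact hcol F (Fν i) hF (hFν i).1 hne ⟨x, hxF, hx⟩ (by rw [hc, (hFν i).2.2])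
  have hFc : ∀ i, IsClosed (Fν i) := fun i => (face_compact hPol (hFν i).1.1).isClosed
  -- an interior point close to `V`
  obtain ⟨p, hpI, hpG⟩ : ∃ p ∈ interior P, ∀ i, ∀ x ∈ G i, l i x < l i p := by
    have hnear : ∀ᶠ q in nhds V, ∀ i, ∀ x ∈ G i, l i x < l i q := by
      rw [Filter.eventually_all]
      intro i
      rcases (G i).eq_empty_or_nonempty with he | he
      · simp [he]
      obtain ⟨x₀, hx₀, hmax⟩ := (hGc i).exists_isMaxOn he (l i).continuous.continuousOn
      have hlt : l i x₀ < l i V := by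
        refine lt_of_le_of_ne (hVmax i x₀ (hGP i hx₀)) fun heq => ?_
        refine Set.disjoint_left.1 (hGF i) ?_ hx₀
        rw [hl i]
        exact ⟨hGP i hx₀, fun y hy => heq ▸ hVmax i y hy⟩
      filter_upwards [(l i).continuous.continuousAt.eventually (lt_mem_nhds hlt)] with q hq x hx
      exact lt_of_le_of_lt (hmax hx) hq
    have hVcl : V ∈ closure (interior P) := by rw [poly_closure hPol]; exact hVP
    obtain ⟨q, hq1, hq2⟩ := ((mem_closure_iff_frequently.1 hVcl).and_eventually hnear).exists
    exact ⟨q, hq1, hq2⟩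
  have hpV : ∀ i, l i p < l i V := fun i => functional_lt (hl0 i) (hVmax i) hpI
  -- the linear coordinates
  let T₀ : EuclideanSpace ℝ (Fin n) →ₗ[ℝ] EuclideanSpace ℝ (Fin n) :=
    (WithLp.linearEquiv 2 ℝ (Fin n → ℝ)).symm.toLinearMap ∘ₗ
      LinearMap.pi (fun i => (l i : EuclideanSpace ℝ (Fin n) →ₗ[ℝ] ℝ))
  have hT₀ : ∀ x i, T₀ x i = l i x := fun x i => rfl
  have hT₀inj : Function.Injective T₀ := by
    rw [← LinearMap.ker_eq_bot, LinearMap.ker_eq_bot']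
    intro w hw
    refine normals_injective hPol hV Fν hall l hl hl0 (fun i => (hFν i).2.1) w fun i => ?_
    rw [← hT₀, hw]; rfl
  let T : EuclideanSpace ℝ (Fin n) ≃L[ℝ] EuclideanSpace ℝ (Fin n) :=
    (LinearEquiv.ofInjectiveEndo T₀ hT₀inj).toContinuousLinearEquiv
  have hT : ∀ x i, T x i = l i x := fun x i => rfl
  -- separating the covering sets
  have hsep : ∀ i, ∃ g : C(EuclideanSpace ℝ (Fin n), ℝ),
      (∀ x ∈ P, x ∈ X i → g x ≠ 0) ∧ (∀ x ∈ Fν i, 0 < g x) ∧ (∀ x ∈ G i, g x < 0) := by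
    intro i
    obtain ⟨A, B, hA, hB, hAB, hdis, hA1, hB1⟩ := separate (K := X i ∩ P)
      (hPcpt.inter_left (hclosed i)) (hFc i) (hGc i).isClosed (by
        rintro y hy ⟨a, ha, haF⟩ ⟨b, hb, hbG⟩
        obtain ⟨F, hF, hne, hc, hbF⟩ := (hGmem i b).1 hbG
        have hmono := connectedComponentIn_mono y (show X i ∩ P ⊆ X i from inter_subset_left)
        have := hcon i y hy.1 ⟨a, hmono ha, haF⟩ F hF hne hc
        rw [Set.eq_empty_iff_forall_notMem] at this
        exact this b ⟨hmono hb, hbF⟩)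
    have hAs : A ⊆ X i ∩ P := hAB ▸ subset_union_left
    have hBs : B ⊆ X i ∩ P := hAB ▸ subset_union_right
    have hd : Disjoint (A ∪ Fν i) (B ∪ G i) := by
      rw [Set.disjoint_left]
      rintro x (hx | hx) (hx' | hx')
      · exact Set.disjoint_left.1 hdis hx hx'
      · exact Set.disjoint_left.1 hdis hx (hB1 ⟨hAs hx, hx'⟩)
      · exact Set.disjoint_left.1 hdis (hA1 ⟨hBs hx', hx⟩) hx'
      · exact Set.disjoint_left.1 (hGF i) hx hx'
    obtain ⟨f, hf0, hf1, -⟩ := exists_continuous_zero_one_of_isClosed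
      (hA.union (hFc i)) (hB.union (hGc i).isClosed) hd
    refine ⟨⟨fun x => 1 / 2 - f x, by fun_prop⟩, ?_, ?_, ?_⟩
    · intro x hxP hxX
      have : x ∈ A ∪ B := by rw [hAB]; exact ⟨hxX, hxP⟩
      rcases this with hx | hx
      · have := hf0 (Or.inl hx); simp at this; simp [this]
      · have := hf1 (Or.inl hx); simp at this; simp [this]; norm_num
    · intro x hx
      have := hf0 (Or.inr hx); simp at this; simp [this]
    · intro x hx
      have := hf1 (Or.inr hx); simp at this; simp [this]; norm_num
  choose g hgX hgF hgG using hsep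
  let g₁ : EuclideanSpace ℝ (Fin n) → EuclideanSpace ℝ (Fin n) := fun x =>
    WithLp.toLp 2 (fun i => g i x)
  have hg₁ : Continuous g₁ :=
    (PiLp.continuous_toLp 2 _).comp (continuous_pi fun i => (g i).continuous)
  have hg₁i : ∀ x i, g₁ x i = g i x := fun x i => rfl
  let H : EuclideanSpace ℝ (Fin n) × ℝ → EuclideanSpace ℝ (Fin n) := fun q =>
    (1 - q.2) • g₁ q.1 + q.2 • T (q.1 - p)
  have hH : Continuous H := by fun_prop
  let K : Set (EuclideanSpace ℝ (Fin n)) := Prod.fst '' ((P ×ˢ Icc (0 : ℝ) 1) ∩ H ⁻¹' {0})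
  have hK : IsClosed K :=
    (((hPcpt.prod isCompact_Icc).inter_right (isClosed_singleton.preimage hH)).image
      continuous_fst).isClosed
  have hKI : Disjoint K (interior P)ᶜ := by
    rw [Set.disjoint_left]
    rintro _ ⟨⟨x, t⟩, ⟨⟨hxP, ht⟩, hz⟩, rfl⟩ hxI
    simp only at hxP hxI ht
    have hxf : x ∈ frontier P := ⟨subset_closure hxP, hxI⟩
    obtain ⟨F, hF, hxF⟩ := frontier_facet hPol hxf
    have hz' : H (x, t) = 0 := hz
    have hzi : (1 - t) * g (h F) x + t * (l (h F) x - l (h F) p) = 0 := by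
      have h1 := congrArg (fun u : EuclideanSpace ℝ (Fin n) => u (h F)) hz'
      simpa [H, hT, hg₁i] using h1
    have ht0 : 0 ≤ t := ht.1
    have ht1 : t ≤ 1 := ht.2
    by_cases hFe : F = Fν (h F)
    · have h2 := hgF (h F) x (hFe ▸ hxF)
      have h3 := hFeq (h F) x (hFe ▸ hxF)
      have h4 := hpV (h F)
      rcases eq_or_lt_of_le ht0 with h5 | h5
      · rw [← h5] at hzi; linarith
      · have : 0 < t * (l (h F) x - l (h F) p) := mul_pos h5 (by linarith)
        have : 0 ≤ (1 - t) * g (h F) x := mul_nonneg (by linarith) h2.le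
        linarith
    · have hxG : x ∈ G (h F) := (hGmem _ _).2 ⟨F, hF, hFe, rfl, hxF⟩
      have h2 := hgG (h F) x hxG
      have h3 := hpG (h F) x hxG
      rcases eq_or_lt_of_le ht0 with h5 | h5
      · rw [← h5] at hzi; linarith
      · have : t * (l (h F) x - l (h F) p) < 0 := mul_neg_of_pos_of_neg h5 (by linarith)
        have : (1 - t) * g (h F) x ≤ 0 := mul_nonpos_of_nonneg_of_nonpos (by linarith) h2.le
        linarith
  obtain ⟨τ, hτ0, hτ1, hτ⟩ := exists_continuous_zero_one_of_isClosed hK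
    isOpen_interior.isClosed_compl hKI
  let Φ : EuclideanSpace ℝ (Fin n) → EuclideanSpace ℝ (Fin n) := fun x => H (x, τ x)
  have hΦ : Continuous Φ := by fun_prop
  have hΦo : ∀ x ∉ P, Φ x = T (x - p) := by
    intro x hx
    have h1 : τ x = 1 := hτ1 (fun hi => hx (interior_subset hi))
    simp [Φ, H, h1]
  obtain ⟨R, hR⟩ := hPcpt.isBounded.exists_norm_le
  obtain ⟨x, hx⟩ := exists_zero (R := R + ‖p‖ + 1) (fun x => T.symm (Φ (x + p))) (by fun_prop) (by
    intro x hx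
    have hxP : x + p ∉ P := by
      intro hmem
      have h1 := hR _ hmem
      have h2 : ‖x‖ ≤ ‖x + p‖ + ‖p‖ := by
        have := norm_sub_le (x + p) p
        simpa using this
      linarith
    simp [hΦo _ hxP])
  have hx' : Φ (x + p) = 0 := by
    simpa using hx
  by_cases hxP : x + p ∈ P
  · have hxK : x + p ∈ K := ⟨(x + p, τ (x + p)), ⟨⟨hxP, hτ _⟩, hx'⟩, rfl⟩
    have h1 : τ (x + p) = 0 := hτ0 hxK
    have h2 : g₁ (x + p) = 0 := by simpa [Φ, H, h1] using hx'
    obtain ⟨i, hi⟩ := mem_iUnion.1 (hcover hxP)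
    apply hgX i _ hxP hi
    rw [← hg₁i, h2]; rfl
  · rw [hΦo _ hxP] at hx'
    have h1 : x + p - p = 0 := by simpa using hx'
    apply hxP
    rw [sub_eq_zero.1 h1]
    exact interior_subset hpI

end
end
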